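/- Let T be a simple geodesic triangle in Y with vertices p, q, r, and let T̂ be a simple geodesic triangle in Y with vertices p, q', r', where q' ∈ [p,q]_Y and r' ∈ [p,r]_Y. Then there exists ε > 0 such that Int T ∩ B_X(p, ε) = Int T̂ ∩ B_X(p, ε). -/

import Mathlib

open Set Metric Filter

noncomputable section

namespace Cat2Cx

/-! ### Comparison angles -/

/-- Inverse hyperbolic cosine. -/
def arcosh (x : ℝ) : ℝ := Real.log (x + Real.sqrt (x ^ 2 - 1))

/-- The Euclidean comparison angle at the vertex of a (comparison) triangle whose adjacent
sides have lengths `a`, `b` and whose opposite side has length `c`, via the law of cosines. -/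
def euclCompAngle (a b c : ℝ) : ℝ :=
  Real.arccos ((a ^ 2 + b ^ 2 - c ^ 2) / (2 * a * b))

/-- The comparison angle in the model plane `M_κ²` of constant curvature `κ ≤ 0`, via the
(Euclidean or hyperbolic) law of cosines. -/
def compAngle (κ a b c : ℝ) : ℝ :=
  if κ = 0 then euclCompAngle a b c
  else
    Real.arccos
      ((Real.cosh (Real.sqrt (-κ) * a) * Real.cosh (Real.sqrt (-κ) * b) -
          Real.cosh (Real.sqrt (-κ) * c)) /
        (Real.sinh (Real.sqrt (-κ) * a) * Real.sinh (Real.sqrt (-κ) * b)))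

variable {Z : Type*}

/-! ### Geodesics with respect to a distance function -/

/-- `f` restricted to `[a,b]` is a unit-speed geodesic for the distance function `d`
(an isometric embedding of the compact interval `[a,b]`). -/
def IsGeodesicWrt (d : Z → Z → ℝ) (f : ℝ → Z) (a b : ℝ) : Prop :=
  a ≤ b ∧ ∀ s ∈ Icc a b, ∀ t ∈ Icc a b, d (f s) (f t) = |s - t|

/-- `f` is a unit-speed geodesic from `x` to `y` (for the distance function `d`),
staying inside `S`. -/
def IsGeodesicFromTo (d : Z → Z → ℝ) (S : Set Z) (f : ℝ → Z) (x y : Z) : Prop :=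
  f 0 = x ∧ f (d x y) = y ∧ IsGeodesicWrt d f 0 (d x y) ∧ MapsTo f (Icc 0 (d x y)) S

/-- `S`, with the distance function `d`, is a geodesic space. -/
def GeodesicSpaceWrt (d : Z → Z → ℝ) (S : Set Z) : Prop :=
  ∀ x ∈ S, ∀ y ∈ S, ∃ f, IsGeodesicFromTo d S f x y

/-- The geodesic segment `[x,y]`: the union of (the images of) all geodesics from `x` to `y`
inside `S`.  In a uniquely geodesic space this is the image of the unique geodesic. -/
def geodSeg (d : Z → Z → ℝ) (S : Set Z) (x y : Z) : Set Z :=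
  ⋃ f ∈ {f : ℝ → Z | IsGeodesicFromTo d S f x y}, f '' Icc 0 (d x y)

/-- `C ⊆ S` is geodesically convex with respect to `d`: every geodesic (in `S`) between two
points of `C` lies in `C`. -/
def ConvexWrtIn (d : Z → Z → ℝ) (S C : Set Z) : Prop :=
  ∀ x ∈ C, ∀ y ∈ C, geodSeg d S x y ⊆ C

/-- `C` is geodesically convex with respect to `d`. -/
abbrev ConvexWrt (d : Z → Z → ℝ) (C : Set Z) : Prop := ConvexWrtIn d univ C

/-- The geodesically convex hull of `A` with respect to `d`. -/
def convexHullWrt (d : Z → Z → ℝ) (A : Set Z) : Set Z :=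
  ⋂₀ {C | ConvexWrt d C ∧ A ⊆ C}

/-- The Alexandrov (upper) angle at `p` between two paths `σ`, `τ` issuing from `p`
(each parametrized so that `σ 0 = τ 0 = p`): the limit as `ε → 0⁺` (i.e. the infimum over
`ε > 0`) of the supremum over `0 < s, t < ε` of the Euclidean comparison angles. -/
def upperAngleWrt (d : Z → Z → ℝ) (p : Z) (σ τ : ℝ → Z) : ℝ :=
  sInf {a | ∃ ε > 0, a = sSup {b | ∃ s t : ℝ, 0 < s ∧ s < ε ∧ 0 < t ∧ t < ε ∧
      b = euclCompAngle (d p (σ s)) (d p (τ t)) (d (σ s) (τ t))}}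

/-- The CAT(κ) condition (for `κ ≤ 0`), in the angle-comparison form
(Bridson–Haefliger II.1.7(4)): `S` is geodesic and for every triple of distinct points the
Alexandrov angle between geodesics is at most the comparison angle in `M_κ²`. -/
def IsCATWrt (κ : ℝ) (d : Z → Z → ℝ) (S : Set Z) : Prop :=
  GeodesicSpaceWrt d S ∧
    ∀ p ∈ S, ∀ q ∈ S, ∀ r ∈ S, p ≠ q → p ≠ r → q ≠ r →
      ∀ σ τ : ℝ → Z, IsGeodesicFromTo d S σ p q → IsGeodesicFromTo d S τ p r →
        upperAngleWrt d p σ τ ≤ compAngle κ (d p q) (d p r) (d q r)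

/-- Completeness of `S` with respect to the distance function `d`:
every Cauchy sequence converges. -/
def CompleteWrt (d : Z → Z → ℝ) (S : Set Z) : Prop :=
  ∀ u : ℕ → Z, (∀ n, u n ∈ S) →
    (∀ ε > 0, ∃ N, ∀ m ≥ N, ∀ n ≥ N, d (u m) (u n) < ε) →
    ∃ x ∈ S, ∀ ε > 0, ∃ N, ∀ n ≥ N, d (u n) x < ε

variable {X : Type*} [MetricSpace X]

/-- `X` is a CAT(κ) metric space. -/
def IsCATSpace (κ : ℝ) (X : Type*) [MetricSpace X] : Prop :=
  IsCATWrt κ (fun x y : X => dist x y) univ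

/-- The distance function of the metric space `X`. -/
abbrev xDist (X : Type*) [MetricSpace X] : X → X → ℝ := fun x y => dist x y

/-! ### The model plane `M_κ²` and polyhedral 2-complexes -/

/-- The distance function of the model plane `M_κ²` of constant curvature `κ ≤ 0`, in global
coordinates `ℝ²`: the Euclidean distance for `κ = 0`, and for `κ < 0` the distance of the
hyperboloid model rescaled by `1/√(-κ)` (so that the curvature is `κ`). -/
def mDist (κ : ℝ) (u v : ℝ × ℝ) : ℝ :=
  if κ = 0 then Real.sqrt ((u.1 - v.1) ^ 2 + (u.2 - v.2) ^ 2)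
  else
    (1 / Real.sqrt (-κ)) *
      arcosh (Real.sqrt (1 + u.1 ^ 2 + u.2 ^ 2) * Real.sqrt (1 + v.1 ^ 2 + v.2 ^ 2) -
        u.1 * v.1 - u.2 * v.2)

/-- A convex polygonal 2-cell in `M_κ²`: the geodesically convex hull of a finite set of
points, with nonempty interior. -/
def IsPolygonalCell (κ : ℝ) (P : Set (ℝ × ℝ)) : Prop :=
  ∃ F : Finset (ℝ × ℝ), P = convexHullWrt (mDist κ) (F : Set (ℝ × ℝ)) ∧ (interior P).Nonempty

/-- The subset `S` of `X` embeds isometrically into the model plane `M_κ²`. -/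
def IsomEmbedsInModelPlane (κ : ℝ) (S : Set X) : Prop :=
  ∃ f : X → ℝ × ℝ, ∀ x ∈ S, ∀ y ∈ S, mDist κ (f x) (f y) = dist x y

/-- A locally finite `M_κ`-polyhedral 2-complex structure on the metric space `X`:
`X` is partitioned into open 2-cells (faces), open 1-cells (edges) and vertices; the closure of
each face is isometric to a compact convex polygon of the model plane `M_κ²` (so each face has
constant curvature `κ`), each edge is a geodesic arc, and the complex is locally finite. -/
structure PolyComplex2 (κ : ℝ) (X : Type*) [MetricSpace X] where
  faces : Set (Set X)
  edges : Set (Set X)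
  vertices : Set X
  faces_open : ∀ F ∈ faces, IsOpen F
  cover : ⋃₀ faces ∪ ⋃₀ edges ∪ vertices = univ
  cells_disjoint : ∀ c ∈ faces ∪ edges, ∀ c' ∈ faces ∪ edges, c ≠ c' → c ∩ c' = ∅
  cells_vertex_disjoint : ∀ c ∈ faces ∪ edges, c ∩ vertices = ∅
  face_chart : ∀ F ∈ faces, ∃ (f : X → ℝ × ℝ) (P : Set (ℝ × ℝ)),
    IsPolygonalCell κ P ∧ InjOn f (closure F) ∧ f '' closure F = P ∧ f '' F = interior P ∧
    ∀ x ∈ closure F, ∀ y ∈ closure F, mDist κ (f x) (f y) = dist x y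
  edge_geodesic : ∀ e ∈ edges, ∃ (f : ℝ → X) (L : ℝ), 0 < L ∧
    IsGeodesicWrt (fun x y : X => dist x y) f 0 L ∧ f '' Ioo 0 L = e
  edge_closure : ∀ e ∈ edges, closure e \ e ⊆ vertices
  face_closure : ∀ F ∈ faces, closure F \ F ⊆ ⋃₀ edges ∪ vertices
  locally_finite : ∀ x : X, ∃ ε > 0,
    {c | (c ∈ faces ∨ c ∈ edges) ∧ (c ∩ ball x ε).Nonempty}.Finite ∧
    (vertices ∩ ball x ε).Finite

/-! ### Simple closed curves, their interiors, and first homology -/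

/-- A simple closed curve in `X` (identified with its image). -/
structure SCC (X : Type*) [TopologicalSpace X] where
  toFun : ℝ → X
  contOn : ContinuousOn toFun (Icc 0 1)
  loop : toFun 0 = toFun 1
  inj : InjOn toFun (Ico 0 1)

/-- The image of a simple closed curve. -/
def SCC.img {X : Type*} [TopologicalSpace X] (γ : SCC X) : Set X := γ.toFun '' Icc 0 1

/-- The first singular homology class of a loop, via the Hurewicz isomorphism: the class of
the loop in the abelianization of the fundamental group (of its path component); the loop is
nullhomologous iff this class is trivial. -/
def loopClassH1 {B : Type*} [TopologicalSpace B] {x : B} (p : Path x x) :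
    Abelianization (FundamentalGroup B x) :=
  Abelianization.of (FundamentalGroup.fromPath (X := TopCat.of B) ⟦p⟧)

/-- The basepoint of a simple closed curve, regarded in a subspace `B` containing it. -/
def SCC.basePoint {X : Type*} [TopologicalSpace X] (γ : SCC X) (B : Set X)
    (h : γ.img ⊆ B) : B :=
  ⟨γ.toFun 0, h ⟨0, ⟨le_rfl, zero_le_one⟩, rfl⟩⟩

/-- The loop of a simple closed curve, as a `Path` in a subspace `B` containing it. -/
def SCC.pathIn {X : Type*} [TopologicalSpace X] (γ : SCC X) (B : Set X) (h : γ.img ⊆ B) :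
    Path (γ.basePoint B h) (γ.basePoint B h) where
  toFun t := ⟨γ.toFun t, h ⟨(t : ℝ), t.2, rfl⟩⟩
  continuous_toFun := by
    apply Continuous.subtype_mk
    exact γ.contOn.comp_continuous continuous_subtype_val fun t => t.2
  source' := by
    apply Subtype.ext
    rfl
  target' := by
    apply Subtype.ext
    exact γ.loop.symm

/-- The simple closed curve `γ` is nullhomologous in the subspace `B` of `X`:
its class in `H₁(B)` vanishes. -/
def SCC.NullhomologousIn {X : Type*} [TopologicalSpace X] (γ : SCC X) (B : Set X) : Prop :=
  ∀ h : γ.img ⊆ B, loopClassH1 (γ.pathIn B h) = 1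

/-- The interior of a simple closed curve `γ`:
`Int γ = {x ∈ X \ γ | [γ] ≠ 0 ∈ H₁(X \ {x})}`. -/
def SCC.interiorSet {X : Type*} [TopologicalSpace X] (γ : SCC X) : Set X :=
  {x | x ∉ γ.img ∧ ¬ γ.NullhomologousIn {x}ᶜ}

/-- The first singular homology of `B` vanishes: every loop in `B` is nullhomologous
(via the Hurewicz isomorphism on each path component). -/
def H1Trivial (B : Type*) [TopologicalSpace B] : Prop :=
  ∀ (x : B) (p : Path x x), loopClassH1 p = 1

/-! ### Rectifiable connectedness and the induced path metric -/

/-- `g` is a path from `x` to `y` (parametrized by `[0,1]`) inside `E`. -/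
def IsPathIn {X : Type*} [TopologicalSpace X] (E : Set X) (g : ℝ → X) (x y : X) : Prop :=
  ContinuousOn g (Icc 0 1) ∧ g 0 = x ∧ g 1 = y ∧ MapsTo g (Icc 0 1) E

/-- `E` is rectifiably connected: any two of its points are joined by a rectifiable
(finite length) path in `E`. -/
def RectConnected {X : Type*} [MetricSpace X] (E : Set X) : Prop :=
  ∀ x ∈ E, ∀ y ∈ E, ∃ g : ℝ → X, IsPathIn E g x y ∧ eVariationOn g (Icc 0 1) ≠ ⊤

/-- The induced path metric on `E`: the infimum of the lengths of rectifiable paths in `E`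
joining the two points. -/
def pathDistIn {X : Type*} [MetricSpace X] (E : Set X) (x y : X) : ℝ :=
  (⨅ g : {g : ℝ → X // IsPathIn E g x y}, eVariationOn g.1 (Icc 0 1)).toReal


universe u
/-! ### Conical neighborhoods -/


/-- The distance function of the `κ`-cone (κ ≤ 0) over a space with distance function `dL`:
a point is a pair (radius, link point), all points of radius `0` being identified (the cone
point); the distance is given by the law of cosines in curvature `κ`, with angle
`min π (dL ℓ ℓ')`. -/
def coneDist (κ : ℝ) {L : Type*} (dL : L → L → ℝ) (a b : ℝ × L) : ℝ :=
  if κ = 0 then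
    Real.sqrt (a.1 ^ 2 + b.1 ^ 2 - 2 * a.1 * b.1 * Real.cos (min Real.pi (dL a.2 b.2)))
  else
    (1 / Real.sqrt (-κ)) *
      arcosh (Real.cosh (Real.sqrt (-κ) * a.1) * Real.cosh (Real.sqrt (-κ) * b.1) -
        Real.sinh (Real.sqrt (-κ) * a.1) * Real.sinh (Real.sqrt (-κ) * b.1) *
          Real.cos (min Real.pi (dL a.2 b.2)))

/-- `V` is a conical neighborhood of `p` in `X`: an open neighborhood of `p` isometric to a
convex open subset of the `κ`-cone over a metric space (the link of `p`), the isometry taking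
`p` to the cone point. -/
def IsConicalNbhd (κ : ℝ) (p : X) (V : Set X) : Prop :=
  IsOpen V ∧ p ∈ V ∧
    ∃ (L : Type u) (dL : L → L → ℝ) (f : X → ℝ × L),
      (∀ a, dL a a = 0) ∧ (∀ a b, 0 ≤ dL a b) ∧ (∀ a b, dL a b = dL b a) ∧
      (∀ a b c, dL a c ≤ dL a b + dL b c) ∧
      (∀ x ∈ V, 0 ≤ (f x).1) ∧ (f p).1 = 0 ∧
      (∀ x ∈ V, ∀ y ∈ V, dist x y = coneDist κ dL (f x) (f y)) ∧
      (∀ x ∈ V, (f x).1 = 0 → x = p) ∧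
      ConvexWrtIn (coneDist κ dL) {w : ℝ × L | 0 ≤ w.1} (f '' V) ∧
      (∀ z ∈ f '' V, ∃ ε > 0, ∀ w : ℝ × L, 0 ≤ w.1 → coneDist κ dL z w < ε → w ∈ f '' V)

/-! ### Geodesics, triangles, and limit segments in `Y = (E, induced path metric)` -/

/-- The set `α` is (the image of) a geodesic arc of `Y = (E, pathDistIn E)`. -/
def IsYGeodesicArc (E : Set X) (α : Set X) : Prop :=
  ∃ (f : ℝ → X) (a b : ℝ), IsGeodesicWrt (pathDistIn E) f a b ∧
    MapsTo f (Icc a b) E ∧ f '' Icc a b = α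

/-- `T` is a geodesic triangle of `Y = (E, pathDistIn E)` with vertices `p`, `q`, `r`:
the union of the three `Y`-geodesics joining the vertices. -/
def IsYTriangle (E : Set X) (T : Set X) (p q r : X) : Prop :=
  p ∈ E ∧ q ∈ E ∧ r ∈ E ∧
    T = geodSeg (pathDistIn E) E p q ∪ geodSeg (pathDistIn E) E q r ∪
        geodSeg (pathDistIn E) E r p

/-- The set `γim` (a curve in `E`) is locally geodesic in `Y` at `p`: some subarc of `γim`
containing `p` in its relative interior is a geodesic of `Y`. -/
def LocallyYGeodesicAt (E γim : Set X) (p : X) : Prop :=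
  ∃ (f : ℝ → X) (a b t : ℝ), t ∈ Ioo a b ∧ f t = p ∧
    IsGeodesicWrt (pathDistIn E) f a b ∧ MapsTo f (Icc a b) E ∧ f '' Icc a b ⊆ γim

/-- `f : [0,1] → E` is the constant-speed parametrization of the `Y`-geodesic
from `x` to `y`. -/
def IsConstSpeedYGeodesic (E : Set X) (f : ℝ → X) (x y : X) : Prop :=
  f 0 = x ∧ f 1 = y ∧ MapsTo f (Icc 0 1) E ∧
    ∀ s ∈ Icc (0:ℝ) 1, ∀ t ∈ Icc (0:ℝ) 1,
      pathDistIn E (f s) (f t) = pathDistIn E x y * |s - t|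

/-- `R` is the limit segment of length `ε` at `p` of the `Y`-geodesic side from `p` to `q`:
`R` is an `X`-geodesic of length `ε` issuing from `p`, and the `X`-geodesics of length `ε`
from `p` through `σ t` (σ the `Y`-geodesic from `p` to `q`) converge uniformly to `R`
as `t → 0⁺`. -/
def IsLimitSegment (E : Set X) (p q : X) (ε : ℝ) (R : ℝ → X) : Prop :=
  0 < ε ∧ R 0 = p ∧ IsGeodesicWrt (fun x y : X => dist x y) R 0 ε ∧
    ∀ σ : ℝ → X, IsGeodesicFromTo (pathDistIn E) E σ p q →
      ∀ δ > 0, ∃ t₀ > 0, ∀ t, 0 < t → t ≤ t₀ → t ≤ pathDistIn E p q →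
        ∀ g : ℝ → X, IsGeodesicWrt (fun x y : X => dist x y) g 0 ε → g 0 = p →
          g (dist p (σ t)) = σ t → ∀ s ∈ Icc 0 ε, dist (g s) (R s) ≤ δ


end Cat2Cx

end

open Set Metric Filter
noncomputable section
namespace Cat2Cx

/-! ### From the angle condition to the CAT(0) inequality -/

theorem mul_sinh_le_mul_sinh {x y : ℝ} (hx : 0 ≤ x) (hxy : x ≤ y) :
    y * Real.sinh x ≤ x * Real.sinh y := by
  have hconv : ConvexOn ℝ (Ici (0:ℝ)) Real.sinh := by
    refine convexOn_of_deriv2_nonneg (convex_Ici 0) Real.continuous_sinh.continuousOn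
      Real.differentiable_sinh.differentiableOn ?_ ?_
    · rw [Real.deriv_sinh]; exact Real.differentiable_cosh.differentiableOn
    · intro z hz
      rw [interior_Ici] at hz
      simp only [Function.iterate_succ, Function.iterate_zero, Function.comp, id,
        Real.deriv_sinh, Real.deriv_cosh]
      exact Real.sinh_nonneg_iff.2 (le_of_lt hz)
  rcases eq_or_lt_of_le (hx.trans hxy) with h | h
  · have : x = 0 := le_antisymm (hxy.trans h.symm.le) hx
    simp [this, ← h]
  · have := hconv.2 (show (0:ℝ) ∈ Ici (0:ℝ) by simp) (mem_Ici.2 h.le)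
      (show 0 ≤ 1 - x / y by rw [sub_nonneg, div_le_one h]; exact hxy)
      (show 0 ≤ x / y by positivity) (by ring)
    simp only [smul_eq_mul, mul_zero, zero_add, Real.sinh_zero] at this
    rw [div_mul_cancel₀ _ h.ne'] at this
    calc y * Real.sinh x ≤ y * (x / y * Real.sinh y) := by gcongr
      _ = _ := by field_simp

theorem cosh_sub_cosh (x y : ℝ) :
    Real.cosh (x + y) - Real.cosh (x - y) = 2 * Real.sinh x * Real.sinh y := by
  rw [Real.cosh_add, Real.cosh_sub]; ring

/-- The hyperbolic comparison angle is smaller than the Euclidean one. -/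
theorem eucl_ratio_le_hyp_ratio_aux {M S B : ℝ} (hS : 0 < S) (hSM : S ≤ M)
    (hB1 : B ≤ M + S) (hB2 : M - S ≤ B) :
    (M ^ 2 + S ^ 2 - B ^ 2) / (2 * M * S) ≤
      (Real.cosh M * Real.cosh S - Real.cosh B) / (Real.sinh M * Real.sinh S) := by
  have hM : 0 < M := hS.trans_le hSM
  have hsM := Real.sinh_pos_iff.2 hM
  have hsS := Real.sinh_pos_iff.2 hS
  obtain ⟨x, hx⟩ : ∃ x, x = (B + (M - S)) / 2 := ⟨_, rfl⟩
  obtain ⟨y, hy⟩ : ∃ y, y = (B - (M - S)) / 2 := ⟨_, rfl⟩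
  have hBxy : B = x + y := by rw [hx, hy]; ring
  have hMS : M - S = x - y := by rw [hx, hy]; ring
  have h1 := mul_sinh_le_mul_sinh (x := x) (y := M) (by linarith) (by linarith)
  have h2 := mul_sinh_le_mul_sinh (x := y) (y := S) (by linarith) (by linarith)
  have h3 := cosh_sub_cosh x y
  rw [← hBxy, ← hMS, Real.cosh_sub] at h3
  have h4 : M * S * (Real.sinh x * Real.sinh y) ≤ x * y * (Real.sinh M * Real.sinh S) := by
    calc _ = (M * Real.sinh x) * (S * Real.sinh y) := by ring
      _ ≤ (x * Real.sinh M) * (y * Real.sinh S) := by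
        apply mul_le_mul h1 h2
        · exact mul_nonneg hS.le (Real.sinh_nonneg_iff.2 (by linarith))
        · exact mul_nonneg (by linarith) hsM.le
      _ = _ := by ring
  rw [div_le_div_iff₀ (by positivity) (by positivity)]
  have h5 : Real.cosh M * Real.cosh S - Real.cosh B =
      Real.sinh M * Real.sinh S - 2 * Real.sinh x * Real.sinh y := by linarith
  have h6 : M ^ 2 + S ^ 2 - B ^ 2 = 2 * M * S - 4 * (x * y) := by
    have : 4 * (x * y) = B ^ 2 - (M - S) ^ 2 := by rw [hx, hy]; ring
    rw [this]; ring
  rw [h5, h6]; nlinarith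

theorem eucl_ratio_le_hyp_ratio {M S B : ℝ} (hM : 0 < M) (hS : 0 < S)
    (hB1 : B ≤ M + S) (hB2 : M - S ≤ B) (hB3 : S - M ≤ B) :
    (M ^ 2 + S ^ 2 - B ^ 2) / (2 * M * S) ≤
      (Real.cosh M * Real.cosh S - Real.cosh B) / (Real.sinh M * Real.sinh S) := by
  rcases le_total S M with h | h
  · exact eucl_ratio_le_hyp_ratio_aux hS h hB1 hB2
  · have := eucl_ratio_le_hyp_ratio_aux hM h (by linarith) hB3
    convert this using 2 <;> ring

theorem le_cos_arccos {r : ℝ} (h : r ≤ 1) : r ≤ Real.cos (Real.arccos r) := by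
  rcases le_total (-1) r with h' | h'
  · rw [Real.cos_arccos h' h]
  · exact h'.trans (Real.neg_one_le_cos _)

theorem cos_arccos_le {r : ℝ} (h : -1 ≤ r) : Real.cos (Real.arccos r) ≤ r := by
  rcases le_total r 1 with h' | h'
  · rw [Real.cos_arccos h h']
  · exact (Real.cos_le_one _).trans h'

theorem eucl_ratio_le_one {M S B : ℝ} (hM : 0 < M) (hS : 0 < S)
    (hB2 : M - S ≤ B) (hB3 : S - M ≤ B) : (M ^ 2 + S ^ 2 - B ^ 2) / (2 * M * S) ≤ 1 := by
  rw [div_le_one (by positivity)]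
  nlinarith [mul_nonneg (sub_nonneg.2 hB2) (sub_nonneg.2 hB3)]

theorem eucl_ratio_le_cos_compAngle {κ M S B : ℝ} (hκ : κ ≤ 0) (hM : 0 < M) (hS : 0 < S)
    (hB1 : B ≤ M + S) (hB2 : M - S ≤ B) (hB3 : S - M ≤ B) :
    (M ^ 2 + S ^ 2 - B ^ 2) / (2 * M * S) ≤ Real.cos (compAngle κ M S B) := by
  unfold compAngle
  split_ifs with h
  · exact le_cos_arccos (eucl_ratio_le_one hM hS hB2 hB3)
  · have hk : 0 < Real.sqrt (-κ) := Real.sqrt_pos.2 (by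
      have := lt_of_le_of_ne hκ h
      linarith)
    set k := Real.sqrt (-κ)
    have hMk := mul_pos hk hM
    have hSk := mul_pos hk hS
    have e := eucl_ratio_le_hyp_ratio (M := k * M) (S := k * S) (B := k * B)
      hMk hSk (by nlinarith) (by nlinarith) (by nlinarith)
    refine le_trans ?_ (le_cos_arccos ?_)
    · refine le_of_eq_of_le ?_ e
      rw [div_eq_div_iff (by positivity) (by positivity)]; ring
    · rw [div_le_one (mul_pos (Real.sinh_pos_iff.2 hMk) (Real.sinh_pos_iff.2 hSk))]
      have : Real.cosh (k * M - k * S) ≤ Real.cosh (k * B) := by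
        rw [Real.cosh_le_cosh]
        exact (abs_le.2 ⟨by nlinarith, by nlinarith⟩ : |k * M - k * S| ≤ k * B).trans (le_abs_self _)
      rw [Real.cosh_sub] at this
      linarith
end Cat2Cx
end

open Set Metric Filter
noncomputable section
namespace Cat2Cx

theorem eucl_ratio_nonneg_add_one {M S B : ℝ} (hM : 0 < M) (hS : 0 < S) (hB : 0 ≤ B)
    (hB1 : B ≤ M + S) : -1 ≤ (M ^ 2 + S ^ 2 - B ^ 2) / (2 * M * S) := by
  rw [le_div_iff₀ (by positivity)]
  nlinarith

section Angle
variable {X : Type*} [MetricSpace X]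

/-- If the upper angle has cosine larger than `c`, then all small triangles satisfy a law of
cosines inequality with constant `c`. -/
theorem law_of_cosines_of_upperAngle {m : X} {σ τ : ℝ → X} {L L' c : ℝ} (hL : 0 < L)
    (hL' : 0 < L')
    (hσ : IsGeodesicWrt (fun x y : X => dist x y) σ 0 L) (hσ0 : σ 0 = m)
    (hτ : IsGeodesicWrt (fun x y : X => dist x y) τ 0 L') (hτ0 : τ 0 = m)
    (hc : c < Real.cos (upperAngleWrt (fun x y : X => dist x y) m σ τ)) :
    ∃ ε > 0, ∀ s t, 0 < s → s < ε → 0 < t → t < ε →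
      dist (σ s) (τ t) ^ 2 ≤ s ^ 2 + t ^ 2 - 2 * s * t * c := by
  set A := upperAngleWrt (fun x y : X => dist x y) m σ τ with hA
  set δ := Real.cos A - c with hδ
  have hδ0 : 0 < δ := sub_pos.2 hc
  set S : ℝ → Set ℝ := fun ε => {b | ∃ s t : ℝ, 0 < s ∧ s < ε ∧ 0 < t ∧ t < ε ∧
      b = euclCompAngle (dist m (σ s)) (dist m (τ t)) (dist (σ s) (τ t))} with hS
  have hSb : ∀ ε, BddAbove (S ε) := by
    intro ε
    refine ⟨Real.pi, ?_⟩
    rintro b ⟨s, t, _, _, _, _, rfl⟩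
    exact Real.arccos_le_pi _
  have hS0 : ∀ ε, 0 ≤ sSup (S ε) := by
    intro ε
    apply Real.sSup_nonneg
    rintro b ⟨s, t, _, _, _, _, rfl⟩
    exact Real.arccos_nonneg _
  have hSpi : ∀ ε, sSup (S ε) ≤ Real.pi := by
    intro ε
    apply Real.sSup_le
    · rintro b ⟨s, t, _, _, _, _, rfl⟩
      exact Real.arccos_le_pi _
    · exact Real.pi_pos.le
  have hAeq : A = sInf {a | ∃ ε > 0, a = sSup (S ε)} := rfl
  have hA0 : 0 ≤ A := by
    rw [hAeq]
    apply Real.sInf_nonneg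
    rintro a ⟨ε, _, rfl⟩
    exact hS0 ε
  have hApi : A ≤ Real.pi := by
    rw [hAeq]
    have hbdd : BddBelow {a | ∃ ε > 0, a = sSup (S ε)} := by
      refine ⟨0, ?_⟩
      rintro a ⟨ε, _, rfl⟩
      exact hS0 ε
    exact (csInf_le hbdd ⟨1, one_pos, rfl⟩).trans (hSpi 1)
  obtain ⟨a, ⟨ε, hε, rfl⟩, ha⟩ := exists_lt_of_csInf_lt
    (s := {a | ∃ ε > 0, a = sSup (S ε)}) ⟨_, 1, one_pos, rfl⟩
    (show sInf {a | ∃ ε > 0, a = sSup (S ε)} < A + δ by rw [← hAeq]; linarith)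
  refine ⟨min ε (min L L'), lt_min hε (lt_min hL hL'), ?_⟩
  intro s t hs hsε ht htε
  have hsL : s < L := hsε.trans_le ((min_le_right _ _).trans (min_le_left _ _))
  have htL : t < L' := htε.trans_le ((min_le_right _ _).trans (min_le_right _ _))
  have h1 : dist m (σ s) = s := by
    have := hσ.2 0 ⟨le_rfl, hL.le⟩ s ⟨hs.le, hsL.le⟩
    simp only [hσ0, zero_sub, abs_neg, abs_of_pos hs] at this
    exact this
  have h2 : dist m (τ t) = t := by
    have := hτ.2 0 ⟨le_rfl, hL'.le⟩ t ⟨ht.le, htL.le⟩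
    simp only [hτ0, zero_sub, abs_neg, abs_of_pos ht] at this
    exact this
  set B := dist (σ s) (τ t)
  have hle : euclCompAngle s t B < A + δ := by
    refine lt_of_le_of_lt (le_csSup (hSb ε) ?_) ha
    exact ⟨s, t, hs, hsε.trans_le (min_le_left _ _), ht, htε.trans_le (min_le_left _ _),
      by rw [h1, h2]⟩
  have hcos : c ≤ Real.cos (euclCompAngle s t B) := by
    have hnn : 0 ≤ euclCompAngle s t B := Real.arccos_nonneg _
    rcases le_total (euclCompAngle s t B) A with h | h
    · have := Real.cos_le_cos_of_nonneg_of_le_pi hnn hApi h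
      linarith
    · have := Real.abs_cos_sub_cos_le (euclCompAngle s t B) A
      rw [abs_of_nonneg (sub_nonneg.2 h)] at this
      have := (abs_le.1 this).1
      linarith
  have hB1 : B ≤ s + t := by
    have := dist_triangle_left (σ s) (τ t) m
    rw [h1, h2] at this; exact this
  have := hcos.trans (cos_arccos_le (eucl_ratio_nonneg_add_one hs ht dist_nonneg hB1))
  rw [le_div_iff₀ (by positivity)] at this
  linarith

theorem cos_upperAngle_add_le {m p x y : X} {σ τ₁ τ₂ : ℝ → X}
    (hmp : m ≠ p) (hmx : m ≠ x) (hmy : m ≠ y)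
    (hσ : IsGeodesicFromTo (fun x y : X => dist x y) univ σ m p)
    (h₁ : IsGeodesicFromTo (fun x y : X => dist x y) univ τ₁ m x)
    (h₂ : IsGeodesicFromTo (fun x y : X => dist x y) univ τ₂ m y)
    (hbt : dist x m + dist m y = dist x y) :
    Real.cos (upperAngleWrt (fun x y : X => dist x y) m σ τ₁) +
      Real.cos (upperAngleWrt (fun x y : X => dist x y) m σ τ₂) ≤ 0 := by
  by_contra hcon
  push Not at hcon
  set C₁ := Real.cos (upperAngleWrt (fun x y : X => dist x y) m σ τ₁)
  set C₂ := Real.cos (upperAngleWrt (fun x y : X => dist x y) m σ τ₂)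
  obtain ⟨η, hη⟩ : ∃ η, η = (C₁ + C₂) / 2 := ⟨_, rfl⟩
  have hη0 : 0 < η := by rw [hη]; linarith
  obtain ⟨ε₁, hε₁, H₁⟩ := law_of_cosines_of_upperAngle (c := C₁ - η / 2) (dist_pos.2 hmp)
    (dist_pos.2 hmx) hσ.2.2.1 hσ.1 h₁.2.2.1 h₁.1 (by linarith)
  obtain ⟨ε₂, hε₂, H₂⟩ := law_of_cosines_of_upperAngle (c := C₂ - η / 2) (dist_pos.2 hmp)
    (dist_pos.2 hmy) hσ.2.2.1 hσ.1 h₂.2.2.1 h₂.1 (by linarith)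
  obtain ⟨ε, hε, hle₁, hle₂, hlx, hly⟩ : ∃ ε > 0, ε ≤ ε₁ ∧ ε ≤ ε₂ ∧ ε ≤ dist m x ∧
      ε ≤ dist m y := by
    refine ⟨min (min ε₁ ε₂) (min (dist m x) (dist m y)), ?_, ?_, ?_, ?_, ?_⟩
    · exact lt_min (lt_min hε₁ hε₂) (lt_min (dist_pos.2 hmx) (dist_pos.2 hmy))
    all_goals simp
  obtain ⟨b, hb⟩ : ∃ b, b = ε / (2 + η) := ⟨_, rfl⟩
  have hb0 : 0 < b := by rw [hb]; positivity
  have hbε : b * (2 + η) = ε := by rw [hb]; field_simp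
  have hbε' : b < ε := by nlinarith
  have ha0 : 0 < b * η / 2 := by positivity
  have haε : b * η / 2 < ε := by nlinarith
  have e₁ := H₁ (b * η / 2) b ha0 (by linarith) hb0 (by linarith)
  have e₂ := H₂ (b * η / 2) b ha0 (by linarith) hb0 (by linarith)
  set a := b * η / 2 with ha
  have g₁ : dist (τ₁ b) x = dist m x - b := by
    have := h₁.2.2.1.2 b ⟨hb0.le, by linarith⟩ (dist m x) ⟨dist_nonneg, le_rfl⟩
    simp only [h₁.2.1] at this
    rw [this, abs_sub_comm, abs_of_nonneg (by linarith)]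
  have g₂ : dist (τ₂ b) y = dist m y - b := by
    have := h₂.2.2.1.2 b ⟨hb0.le, by linarith⟩ (dist m y) ⟨dist_nonneg, le_rfl⟩
    simp only [h₂.2.1] at this
    rw [this, abs_sub_comm, abs_of_nonneg (by linarith)]
  have g₃ : 2 * b ≤ dist (σ a) (τ₁ b) + dist (σ a) (τ₂ b) := by
    have t1 := dist_triangle x (τ₁ b) y
    have t2 := dist_triangle (τ₁ b) (τ₂ b) y
    have t3 := dist_triangle_left (τ₁ b) (τ₂ b) (σ a)
    rw [dist_comm x (τ₁ b)] at t1
    rw [dist_comm x m] at hbt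
    linarith
  set c₁ := dist (σ a) (τ₁ b)
  set c₂ := dist (σ a) (τ₂ b)
  have g₄ : (2 * b) ^ 2 ≤ 2 * (c₁ ^ 2 + c₂ ^ 2) := by
    have : (2 * b) ^ 2 ≤ (c₁ + c₂) ^ 2 := by gcongr
    nlinarith [sq_nonneg (c₁ - c₂)]
  have g₅ : c₁ ^ 2 + c₂ ^ 2 ≤ 2 * a ^ 2 + 2 * b ^ 2 - 2 * a * b * η := by
    have : C₁ + C₂ = 2 * η := by rw [hη]; ring
    calc _ ≤ 2 * a ^ 2 + 2 * b ^ 2 - 2 * a * b * ((C₁ + C₂) - η) := by linarith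
      _ = _ := by rw [this]; ring
  have : a * (a - b * η) ≥ 0 := by nlinarith
  have : a * (a - b * η) = - a ^ 2 := by rw [ha]; ring
  have : 0 < a ^ 2 := by positivity
  linarith

end Angle

/-- A CAT(0) space: geodesic segments exist, and Stewart's inequality holds. -/
structure Cat0 (X : Type*) [MetricSpace X] : Prop where
  exists_between : ∀ (x y : X) (t : ℝ), 0 ≤ t → t ≤ 1 →
    ∃ m, dist x m = t * dist x y ∧ dist m y = (1 - t) * dist x y
  stewart : ∀ (p x y m : X) (t : ℝ), 0 ≤ t → t ≤ 1 → dist x m = t * dist x y →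
    dist m y = (1 - t) * dist x y →
    dist p m ^ 2 ≤ (1 - t) * dist p x ^ 2 + t * dist p y ^ 2 - t * (1 - t) * dist x y ^ 2

theorem IsCATSpace.cat0 {κ : ℝ} (hκ : κ ≤ 0) {X : Type*} [MetricSpace X]
    (hX : IsCATSpace κ X) : Cat0 X where
  exists_between := by
    intro x y t ht0 ht1
    obtain ⟨f, hf⟩ := hX.1 x (mem_univ _) y (mem_univ _)
    have hD : (0:ℝ) ≤ dist x y := dist_nonneg
    have hm : t * dist x y ∈ Icc 0 (dist x y) := ⟨by positivity, by nlinarith⟩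
    refine ⟨f (t * dist x y), ?_, ?_⟩
    · have := hf.2.2.1.2 0 ⟨le_rfl, hD⟩ (t * dist x y) hm
      simp only [hf.1, zero_sub, abs_neg] at this
      rw [this, abs_of_nonneg hm.1]
    · have := hf.2.2.1.2 (t * dist x y) hm (dist x y) ⟨hD, le_rfl⟩
      simp only [hf.2.1] at this
      rw [this, abs_sub_comm, abs_of_nonneg (by linarith [hm.2])]; ring
  stewart := by
    intro p x y m t ht0 ht1 h1 h2
    by_cases hmx : m = x
    · subst hmx
      rw [dist_self] at h1
      rcases mul_eq_zero.1 h1.symm with h | h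
      · subst h; linarith
      · rw [dist_eq_zero] at h; subst h; simp; linarith
    by_cases hmy : m = y
    · subst hmy
      rw [dist_self] at h2
      rcases mul_eq_zero.1 h2.symm with h | h
      · have : t = 1 := by linarith
        subst this; linarith
      · rw [dist_eq_zero] at h; subst h; simp; linarith
    by_cases hmp : m = p
    · subst hmp
      rw [dist_self, dist_comm m x, h1, h2]
      nlinarith
    by_cases hpx : p = x
    · subst hpx
      rw [h1, dist_self]; nlinarith
    by_cases hpy : p = y
    · subst hpy
      rw [dist_comm p m, h2, dist_self, dist_comm p x]; nlinarith
    obtain ⟨σ, hσ⟩ := hX.1 m (mem_univ _) p (mem_univ _)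
    obtain ⟨τ₁, hτ₁⟩ := hX.1 m (mem_univ _) x (mem_univ _)
    obtain ⟨τ₂, hτ₂⟩ := hX.1 m (mem_univ _) y (mem_univ _)
    have hc := cos_upperAngle_add_le hmp hmx hmy hσ hτ₁ hτ₂ (by rw [h1, h2]; ring)
    have key : ∀ z τ, m ≠ z → p ≠ z →
        IsGeodesicFromTo (fun x y : X => dist x y) univ τ m z →
        (dist m p ^ 2 + dist m z ^ 2 - dist p z ^ 2) / (2 * dist m p * dist m z) ≤
          Real.cos (upperAngleWrt (fun x y : X => dist x y) m σ τ) := by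
      intro z τ hmz hpz hτ
      have hle := hX.2 m (mem_univ _) p (mem_univ _) z (mem_univ _) hmp hmz hpz σ τ hσ hτ
      refine (eucl_ratio_le_cos_compAngle hκ (dist_pos.2 hmp) (dist_pos.2 hmz) ?_ ?_ ?_).trans ?_
      · exact dist_triangle_left _ _ _
      · have := dist_triangle m z p
        rw [dist_comm z p] at this; linarith
      · have := dist_triangle m p z
        linarith
      · apply Real.cos_le_cos_of_nonneg_of_le_pi _ _ hle
        · apply Real.sInf_nonneg
          rintro a ⟨ε, _, rfl⟩
          apply Real.sSup_nonneg
          rintro b ⟨s, t, _, _, _, _, rfl⟩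
          exact Real.arccos_nonneg _
        · unfold compAngle euclCompAngle
          split_ifs <;> exact Real.arccos_le_pi _
    have k1 := key x τ₁ hmx hpx hτ₁
    have k2 := key y τ₂ hmy hpy hτ₂
    have hM := dist_pos.2 hmp
    have hS := dist_pos.2 hmx
    have hT := dist_pos.2 hmy
    have hsum : (dist m p ^ 2 + dist m x ^ 2 - dist p x ^ 2) / (2 * dist m p * dist m x) +
      (dist m p ^ 2 + dist m y ^ 2 - dist p y ^ 2) / (2 * dist m p * dist m y) ≤ 0 := by linarith
    rw [div_add_div _ _ (by positivity) (by positivity), div_le_iff₀ (by positivity),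
      zero_mul] at hsum
    rw [dist_comm m x] at hsum hS
    rw [h1, h2] at hsum
    rw [h1] at hS
    rw [dist_comm p m]
    set M := dist m p
    set D := dist x y
    set B := dist p x
    set C := dist p y
    rw [h2] at hT
    have hD : 0 < D := pos_of_mul_pos_right hS ht0
    have : 2 * M * D * (M ^ 2 - ((1 - t) * B ^ 2 + t * C ^ 2 - t * (1 - t) * D ^ 2)) ≤ 0 := by
      refine le_of_eq_of_le ?_ hsum
      ring
    have h3 : 0 < 2 * M * D := by positivity
    nlinarith [nonpos_of_mul_nonpos_right this h3]

end Cat2Cx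
end

open Set Metric Filter
noncomputable section
namespace Cat2Cx

/-! ### Geodesics in CAT(0) spaces -/

variable {X : Type*} [MetricSpace X]

open Classical in
/-- The point at distance `s` from `o` on the geodesic from `o` to `x` (with `s` clamped to
`[0, dist o x]`). -/
def gd (o x : X) (s : ℝ) : X :=
  if h : ∃ m, dist o m = max 0 (min s (dist o x)) ∧
    dist m x = dist o x - max 0 (min s (dist o x)) then h.choose else o

namespace Cat0

theorem gd_spec (hX : Cat0 X) (o x : X) (s : ℝ) :
    dist o (gd o x s) = max 0 (min s (dist o x)) ∧
      dist (gd o x s) x = dist o x - max 0 (min s (dist o x)) := by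
  have h : ∃ m, dist o m = max 0 (min s (dist o x)) ∧
      dist m x = dist o x - max 0 (min s (dist o x)) := by
    set c := max 0 (min s (dist o x)) with hc
    have hc0 : 0 ≤ c := le_max_left _ _
    have hcD : c ≤ dist o x := max_le dist_nonneg (min_le_right _ _)
    rcases (dist_nonneg : 0 ≤ dist o x).eq_or_lt with h | h
    · refine ⟨o, ?_, ?_⟩
      · rw [dist_self]; linarith
      · linarith
    · obtain ⟨m, h1, h2⟩ := hX.exists_between o x (c / dist o x) (by positivity)
        ((div_le_one h).2 hcD)
      refine ⟨m, ?_, ?_⟩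
      · rw [h1]; field_simp
      · rw [h2]; field_simp
  unfold gd
  rw [dif_pos h]
  exact h.choose_spec

theorem dist_gd (hX : Cat0 X) (o x : X) {s : ℝ} (h0 : 0 ≤ s) (h1 : s ≤ dist o x) :
    dist o (gd o x s) = s := by
  rw [(hX.gd_spec o x s).1, min_eq_left h1, max_eq_right h0]

theorem dist_gd_right (hX : Cat0 X) (o x : X) {s : ℝ} (h0 : 0 ≤ s) (h1 : s ≤ dist o x) :
    dist (gd o x s) x = dist o x - s := by
  rw [(hX.gd_spec o x s).2, min_eq_left h1, max_eq_right h0]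

theorem dist_gd_eq_min (hX : Cat0 X) (o x : X) {s : ℝ} (h0 : 0 ≤ s) :
    dist o (gd o x s) = min s (dist o x) := by
  rw [(hX.gd_spec o x s).1, max_eq_right (le_min h0 dist_nonneg)]

theorem dist_gd_add (hX : Cat0 X) (o x : X) (s : ℝ) :
    dist o (gd o x s) + dist (gd o x s) x = dist o x := by
  rw [(hX.gd_spec o x s).1, (hX.gd_spec o x s).2]; ring

theorem gd_of_le (hX : Cat0 X) (o x : X) {s : ℝ} (h : dist o x ≤ s) : gd o x s = x := by
  have := (hX.gd_spec o x s).2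
  rw [min_eq_right h, max_eq_right dist_nonneg, sub_self] at this
  exact dist_eq_zero.1 this

theorem gd_dist (hX : Cat0 X) (o x : X) : gd o x (dist o x) = x := hX.gd_of_le o x le_rfl

theorem gd_of_nonpos (hX : Cat0 X) (o x : X) {s : ℝ} (h : s ≤ 0) : gd o x s = o := by
  have := (hX.gd_spec o x s).1
  rw [max_eq_left ((min_le_left _ _).trans h)] at this
  exact (dist_eq_zero.1 this).symm

theorem gd_zero (hX : Cat0 X) (o x : X) : gd o x 0 = o := hX.gd_of_nonpos o x le_rfl

theorem gd_self (hX : Cat0 X) (o : X) (s : ℝ) : gd o o s = o := by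
  rcases le_total s 0 with h | h
  · exact hX.gd_of_nonpos _ _ h
  · exact hX.gd_of_le _ _ (by simpa using h)

theorem eq_of_between (hX : Cat0 X) {o x m m' : X} (h : dist o m + dist m x = dist o x)
    (h' : dist o m' + dist m' x = dist o x) (he : dist o m = dist o m') : m = m' := by
  rcases (dist_nonneg : 0 ≤ dist o x).eq_or_lt with hD | hD
  · have h1 : dist o m = 0 := by linarith [@dist_nonneg _ _ o m, @dist_nonneg _ _ m x]
    rw [← dist_eq_zero.1 h1]
    exact dist_eq_zero.1 (he ▸ h1)
  · set D := dist o x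
    set t := dist o m / D with ht
    have e : t * D = dist o m := by rw [ht]; field_simp
    have e2 : (1 - t) * D = dist m x := by linarith
    have e3 : dist m' x = dist m x := by linarith
    have := hX.stewart m' o x m t (by positivity)
      ((div_le_one hD).2 (by linarith [@dist_nonneg _ _ m x])) e.symm e2.symm
    rw [dist_comm m' o, ← he, e3, ← e, ← e2] at this
    have h0 : dist m' m ^ 2 ≤ 0 := by
      refine this.trans (le_of_eq ?_)
      ring
    have : dist m' m = 0 := by nlinarith [@dist_nonneg _ _ m' m]
    exact (dist_eq_zero.1 this).symm

theorem eq_gd (hX : Cat0 X) {o x m : X} (h : dist o m + dist m x = dist o x) :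
    m = gd o x (dist o m) := by
  refine hX.eq_of_between h (hX.dist_gd_add o x _) ?_
  rw [hX.dist_gd o x dist_nonneg (by linarith [@dist_nonneg _ _ m x])]

theorem gd_of_between (hX : Cat0 X) {o x m : X} (h : dist o m + dist m x = dist o x) {s : ℝ}
    (hs : s ≤ dist o m) : gd o m s = gd o x s := by
  rcases le_total s 0 with h0 | h0
  · rw [hX.gd_of_nonpos _ _ h0, hX.gd_of_nonpos _ _ h0]
  have hm : dist o m ≤ dist o x := by linarith [@dist_nonneg _ _ m x]
  have h1 := hX.dist_gd o m h0 hs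
  have h2 := hX.dist_gd_right o m h0 hs
  refine hX.eq_of_between (x := x) ?_ (hX.dist_gd_add o x _) ?_
  · apply le_antisymm _ (dist_triangle _ _ _)
    have := dist_triangle (gd o m s) m x
    linarith
  · rw [h1, hX.dist_gd o x h0 (hs.trans hm)]

theorem gd_gd (hX : Cat0 X) (o x : X) (s t : ℝ) : gd o (gd o x s) t = gd o x (min t s) := by
  rcases le_total s 0 with h0 | h0
  · rw [hX.gd_of_nonpos o x h0, hX.gd_self, hX.gd_of_nonpos o x ((min_le_right _ _).trans h0)]
  rcases le_total (dist o x) s with h1 | h1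
  · rw [hX.gd_of_le o x h1]
    rcases le_total t s with h2 | h2
    · rw [min_eq_left h2]
    · rw [min_eq_right h2, hX.gd_of_le o x h1, hX.gd_of_le o x (h1.trans h2)]
  have hd := hX.dist_gd o x h0 h1
  rcases le_total t s with h2 | h2
  · rw [min_eq_left h2]
    exact hX.gd_of_between (hX.dist_gd_add o x s) (hd.symm ▸ h2)
  · rw [min_eq_right h2, hX.gd_of_le _ _ (by rw [hd]; exact h2)]

theorem contraction (hX : Cat0 X) {o x y m m' : X} {t : ℝ} (h0 : 0 ≤ t) (h1 : t ≤ 1)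
    (hm : dist o m = t * dist o x) (hm2 : dist m x = (1 - t) * dist o x)
    (hm' : dist o m' = t * dist o y) (hm2' : dist m' y = (1 - t) * dist o y) :
    dist m m' ≤ t * dist x y := by
  have s1 := hX.stewart m o y m' t h0 h1 hm' hm2'
  have s2 := hX.stewart y o x m t h0 h1 hm hm2
  rw [dist_comm m o, hm] at s1
  rw [dist_comm y m, dist_comm y o, dist_comm y x] at s2
  apply le_of_sq_le_sq _ (by positivity)
  nlinarith [mul_le_mul_of_nonneg_left s2 h0]

theorem dist_gd_gd_le (hX : Cat0 X) {o x y : X} {t : ℝ} (h0 : 0 ≤ t) (h1 : t ≤ 1) :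
    dist (gd o x (t * dist o x)) (gd o y (t * dist o y)) ≤ t * dist x y := by
  have key : ∀ z, 0 ≤ t * dist o z ∧ t * dist o z ≤ dist o z := fun z =>
    ⟨by positivity, mul_le_of_le_one_left dist_nonneg h1⟩
  refine hX.contraction h0 h1 (hX.dist_gd _ _ (key x).1 (key x).2) ?_
    (hX.dist_gd _ _ (key y).1 (key y).2) ?_
  · rw [hX.dist_gd_right _ _ (key x).1 (key x).2]; ring
  · rw [hX.dist_gd_right _ _ (key y).1 (key y).2]; ring

theorem dist_gd_gd (hX : Cat0 X) (o x : X) {s t : ℝ} (hs : 0 ≤ s) (hst : s ≤ t)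
    (ht : t ≤ dist o x) : dist (gd o x s) (gd o x t) = t - s := by
  have h1 := hX.dist_gd o x (hs.trans hst) ht
  have h2 := hX.dist_gd_right o (gd o x t) hs (by rw [h1]; exact hst)
  rwa [hX.gd_gd, min_eq_left hst, h1] at h2

theorem gd_clamp (hX : Cat0 X) (o x : X) (s : ℝ) :
    gd o x s = gd o x (max 0 (min s (dist o x))) := by
  refine hX.eq_of_between (hX.dist_gd_add o x _) (hX.dist_gd_add o x _) ?_
  rw [(hX.gd_spec o x s).1, hX.dist_gd _ _ (le_max_left _ _)
    (max_le dist_nonneg (min_le_right _ _))]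

theorem dist_gd_gd_le_abs (hX : Cat0 X) (o x : X) (s t : ℝ) :
    dist (gd o x s) (gd o x t) ≤ |s - t| := by
  wlog hst : s ≤ t generalizing s t
  · rw [dist_comm, abs_sub_comm]
    exact this t s (le_of_not_ge hst)
  rw [hX.gd_clamp o x s, hX.gd_clamp o x t]
  rw [hX.dist_gd_gd o x (le_max_left _ _) (by gcongr) (max_le dist_nonneg (min_le_right _ _))]
  rw [abs_sub_comm]
  refine (le_abs_self _).trans ?_
  refine (abs_max_sub_max_le_max _ _ _ _).trans ?_
  rw [sub_self, abs_zero, max_eq_right (abs_nonneg _)]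
  refine (abs_min_sub_min_le_max _ _ _ _).trans ?_
  simp

theorem dist_gd_gd_le_two (hX : Cat0 X) (o x y : X) (s : ℝ) :
    dist (gd o x s) (gd o y s) ≤ 2 * dist x y := by
  wlog hxy : dist o x ≤ dist o y generalizing x y
  · rw [dist_comm, dist_comm x y]
    exact this y x (le_of_not_ge hxy)
  have hc : dist o y - dist o x ≤ dist x y := by linarith [dist_triangle o x y]
  have hc0 : 0 ≤ dist x y := dist_nonneg
  rcases le_total s 0 with h0 | h0
  · rw [hX.gd_of_nonpos _ _ h0, hX.gd_of_nonpos _ _ h0, dist_self]; positivity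
  rcases le_total (dist o y) s with h1 | h1
  · rw [hX.gd_of_le _ _ h1, hX.gd_of_le _ _ (hxy.trans h1)]; linarith
  rcases le_total (dist o x) s with h2 | h2
  · rw [hX.gd_of_le _ _ h2]
    have := hX.dist_gd_right o y h0 h1
    have := dist_triangle_right x (gd o y s) y
    linarith
  · rcases (dist_nonneg : 0 ≤ dist o x).eq_or_lt with ha | ha
    · have hs : s ≤ 0 := by linarith
      rw [hX.gd_of_nonpos _ _ hs, hX.gd_of_nonpos _ _ hs, dist_self]; positivity
    · obtain ⟨l, hl⟩ : ∃ l, l = s / dist o x := ⟨_, rfl⟩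
      have hl0 : 0 ≤ l := by rw [hl]; positivity
      have hl1 : l ≤ 1 := by rw [hl]; exact (div_le_one ha).2 h2
      have hs : s = l * dist o x := by rw [hl]; field_simp
      have e1 := hX.dist_gd_gd_le (o := o) (x := x) (y := y) hl0 hl1
      have e2 := hX.dist_gd_gd_le_abs o y (l * dist o y) s
      rw [← hs] at e1
      have e3 : |l * dist o y - s| ≤ dist x y := by
        rw [hs, ← mul_sub, abs_of_nonneg (mul_nonneg hl0 (by linarith))]
        nlinarith
      have := dist_triangle (gd o x s) (gd o y (l * dist o y)) (gd o y s)
      nlinarith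

theorem dist_gd_le_add (hX : Cat0 X) (o x y : X) (s t : ℝ) :
    dist (gd o x s) (gd o y t) ≤ 2 * dist x y + |s - t| :=
  (dist_triangle _ (gd o y s) _).trans
    (add_le_add (hX.dist_gd_gd_le_two o x y s) (hX.dist_gd_gd_le_abs o y s t))

theorem continuous_gd (hX : Cat0 X) (o : X) : Continuous fun z : X × ℝ => gd o z.1 z.2 := by
  have : LipschitzWith 3 fun z : X × ℝ => gd o z.1 z.2 := by
    refine LipschitzWith.of_dist_le_mul fun z w => ?_
    have := hX.dist_gd_le_add o z.1 w.1 z.2 w.2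
    have h1 : dist z.1 w.1 ≤ dist z w := le_max_left _ _
    have h2 : |z.2 - w.2| ≤ dist z w := le_max_right _ _
    push_cast
    linarith
  exact this.continuous

/-- Local geodesics through a point are global geodesics. -/
theorem dist_eq_add_of_antipodal (hX : Cat0 X) {w z z' : X} {s : ℝ} (hs : 0 < s)
    (hz : s ≤ dist w z) (hz' : s ≤ dist w z')
    (h : dist (gd w z s) (gd w z' s) = 2 * s) : dist z z' = dist z w + dist w z' := by
  wlog hle : dist w z ≤ dist w z' generalizing z z'
  · rw [dist_comm z z', dist_comm z w, dist_comm w z', add_comm]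
    exact this hz' hz (by rw [dist_comm]; exact h) (le_of_not_ge hle)
  set a := dist w z with ha
  set b := dist w z' with hb
  have ha0 : 0 < a := hs.trans_le hz
  have hb0 : 0 < b := ha0.trans_le hle
  set z'' := gd w z' a with hz''
  have d1 : dist w z'' = a := hX.dist_gd w z' ha0.le hle
  have d2 : dist z'' z' = b - a := hX.dist_gd_right w z' ha0.le hle
  have c1 := hX.dist_gd_gd_le (o := w) (x := z) (y := z'') (t := s / a) (by positivity)
    ((div_le_one ha0).2 hz)
  rw [d1, ← ha, div_mul_cancel₀ _ ha0.ne', hz'', hX.gd_gd, min_eq_left hz, h, ← hz''] at c1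
  have c2 : 2 * a ≤ dist z z'' := by
    rw [div_mul_eq_mul_div, le_div_iff₀ ha0] at c1
    nlinarith
  obtain ⟨t, ht⟩ : ∃ t, t = a / b := ⟨_, rfl⟩
  have htb : t * b = a := by rw [ht]; field_simp
  have ht0 : 0 < t := by rw [ht]; positivity
  have st := hX.stewart z w z' z'' t (by positivity) (by rw [ht]; exact (div_le_one hb0).2 hle)
    (by rw [d1, ← hb, htb]) (by rw [d2, ← hb, sub_mul, htb, one_mul])
  rw [dist_comm z w, ← ha, ← hb] at st
  have c3 : (2 * a) ^ 2 ≤ dist z z'' ^ 2 := by gcongr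
  apply le_antisymm (dist_triangle _ _ _)
  rw [dist_comm z w, ← ha]
  apply le_of_sq_le_sq _ dist_nonneg
  have : t * (a + b) ^ 2 ≤ t * dist z z' ^ 2 := by
    have e : t * (a + b) ^ 2 = (2 * a) ^ 2 - (1 - t) * a ^ 2 + t * (1 - t) * b ^ 2 := by
      rw [← htb]; ring
    linarith
  exact le_of_mul_le_mul_left this ht0

end Cat0
end Cat2Cx
end

open Set Metric Filter
noncomputable section
namespace Cat2Cx

/-! ### Polar coordinates in the model plane -/

theorem circle_re_sq_add_im_sq (ζ : Circle) : (ζ : ℂ).re ^ 2 + (ζ : ℂ).im ^ 2 = 1 := by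
  have := Circle.normSq_coe ζ
  rw [Complex.normSq_apply] at this
  linarith

theorem circle_dist_sq (ζ ξ : Circle) : dist ζ ξ ^ 2 =
    ((ζ : ℂ).re - (ξ : ℂ).re) ^ 2 + ((ζ : ℂ).im - (ξ : ℂ).im) ^ 2 := by
  have : dist ζ ξ = dist (ζ : ℂ) (ξ : ℂ) := rfl
  rw [this, Complex.dist_eq, ← Complex.normSq_eq_norm_sq, Complex.normSq_apply]
  simp only [Complex.sub_re, Complex.sub_im]
  ring

/-- Every vector of the plane has polar coordinates. -/
theorem exists_circle_polar (x y : ℝ) : ∃ ζ : Circle, x = √(x ^ 2 + y ^ 2) * (ζ : ℂ).re ∧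
    y = √(x ^ 2 + y ^ 2) * (ζ : ℂ).im := by
  have hn : ‖(⟨x, y⟩ : ℂ)‖ = √(x ^ 2 + y ^ 2) := by
    rw [Complex.norm_eq_sqrt_sq_add_sq]
  have h := Complex.norm_mul_exp_arg_mul_I ⟨x, y⟩
  refine ⟨Circle.exp (Complex.arg ⟨x, y⟩), ?_, ?_⟩
  · rw [← hn, Circle.coe_exp]
    have := congrArg Complex.re h
    rw [Complex.re_ofReal_mul] at this
    exact this.symm
  · rw [← hn, Circle.coe_exp]
    have := congrArg Complex.im h
    rw [Complex.im_ofReal_mul] at this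
    exact this.symm

/-- Polar coordinates around all points of the model plane. -/
structure IsPolar (κ : ℝ) (pol : ℝ × ℝ → Circle → ℝ → ℝ × ℝ) : Prop where
  dist_center : ∀ v ζ s, 0 ≤ s → mDist κ v (pol v ζ s) = s
  surj : ∀ v u, ∃ ζ, pol v ζ (mDist κ v u) = u
  radial : ∀ v ζ s s', 0 ≤ s → 0 ≤ s' → mDist κ (pol v ζ s) (pol v ζ s') = |s - s'|
  antipodal : ∀ v ζ s, 0 ≤ s → mDist κ (pol v ζ s) (pol v (-ζ) s) = 2 * s
  lower : ∀ s, 0 < s → ∃ C, 0 ≤ C ∧ ∀ v ζ ξ,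
    dist ζ ξ ≤ C * mDist κ (pol v ζ s) (pol v ξ s)
  upper : ∀ s, 0 ≤ s → ∃ C, 0 ≤ C ∧ ∀ v ζ ξ,
    mDist κ (pol v ζ s) (pol v ξ s) ≤ C * dist ζ ξ
  cont : Continuous fun z : ((ℝ × ℝ) × ℝ) × Circle => pol z.1.1 z.2 z.1.2
  zero : ∀ v ζ, pol v ζ 0 = v

theorem isPolar_eucl : IsPolar 0 fun v ζ s => (v.1 + s * (ζ : ℂ).re, v.2 + s * (ζ : ℂ).im) where
  dist_center := by
    intro v ζ s hs
    simp only [mDist, if_true]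
    have : (v.1 - (v.1 + s * (ζ : ℂ).re)) ^ 2 + (v.2 - (v.2 + s * (ζ : ℂ).im)) ^ 2 = s ^ 2 := by
      linear_combination s ^ 2 * circle_re_sq_add_im_sq ζ
    rw [this, Real.sqrt_sq hs]
  surj := by
    intro v u
    obtain ⟨ζ, h1, h2⟩ := exists_circle_polar (u.1 - v.1) (u.2 - v.2)
    refine ⟨ζ, ?_⟩
    have : mDist 0 v u = √((u.1 - v.1) ^ 2 + (u.2 - v.2) ^ 2) := by
      simp only [mDist, if_true]
      congr 1; ring
    simp only [this]
    rw [← h1, ← h2]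
    ext <;> simp
  radial := by
    intro v ζ s s' _ _
    simp only [mDist, if_true]
    rw [← Real.sqrt_sq_eq_abs]
    congr 1
    linear_combination (s - s') ^ 2 * circle_re_sq_add_im_sq ζ
  antipodal := by
    intro v ζ s hs
    simp only [mDist, if_true]
    have : (v.1 + s * (ζ : ℂ).re - (v.1 + s * ((-ζ : Circle) : ℂ).re)) ^ 2 +
        (v.2 + s * (ζ : ℂ).im - (v.2 + s * ((-ζ : Circle) : ℂ).im)) ^ 2 = (2 * s) ^ 2 := by
      simp only [Circle.coe_neg, Complex.neg_re, Complex.neg_im]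
      linear_combination 4 * s ^ 2 * circle_re_sq_add_im_sq ζ
    rw [this, Real.sqrt_sq (by positivity)]
  lower := by
    intro s hs
    refine ⟨1 / s, by positivity, fun v ζ ξ => le_of_eq ?_⟩
    simp only [mDist, if_true]
    have : (v.1 + s * (ζ : ℂ).re - (v.1 + s * (ξ : ℂ).re)) ^ 2 +
        (v.2 + s * (ζ : ℂ).im - (v.2 + s * (ξ : ℂ).im)) ^ 2 = (s * dist ζ ξ) ^ 2 := by
      rw [mul_pow, circle_dist_sq]; ring
    rw [this, Real.sqrt_sq (by positivity)]
    field_simp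
  upper := by
    intro s hs
    refine ⟨s, hs, fun v ζ ξ => le_of_eq ?_⟩
    simp only [mDist, if_true]
    have : (v.1 + s * (ζ : ℂ).re - (v.1 + s * (ξ : ℂ).re)) ^ 2 +
        (v.2 + s * (ζ : ℂ).im - (v.2 + s * (ξ : ℂ).im)) ^ 2 = (s * dist ζ ξ) ^ 2 := by
      rw [mul_pow, circle_dist_sq]; ring
    rw [this, Real.sqrt_sq (by positivity)]
  cont := by
    have : Continuous fun z : Circle => (z : ℂ) := continuous_subtype_val
    fun_prop
  zero := by
    intro v ζ
    simp

/-- The height function of the hyperboloid model. -/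
def hht (u : ℝ × ℝ) : ℝ := √(1 + u.1 ^ 2 + u.2 ^ 2)

theorem hht_sq (u : ℝ × ℝ) : hht u ^ 2 = 1 + u.1 ^ 2 + u.2 ^ 2 := Real.sq_sqrt (by positivity)

theorem hht_pos (u : ℝ × ℝ) : 0 < hht u := Real.sqrt_pos.2 (by positivity)

theorem continuous_hht : Continuous hht := by unfold hht; fun_prop

/-- The Lorentzian pairing of the hyperboloid model. -/
def hQ (u v : ℝ × ℝ) : ℝ := hht u * hht v - u.1 * v.1 - u.2 * v.2

theorem one_le_hQ (u v : ℝ × ℝ) : 1 ≤ hQ u v := by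
  have h : (1 + u.1 * v.1 + u.2 * v.2) ^ 2 ≤ (hht u * hht v) ^ 2 := by
    rw [mul_pow, hht_sq, hht_sq]
    nlinarith [sq_nonneg (u.1 - v.1), sq_nonneg (u.2 - v.2), sq_nonneg (u.1 * v.2 - u.2 * v.1)]
  have := le_of_sq_le_sq h (mul_pos (hht_pos u) (hht_pos v)).le
  unfold hQ
  linarith

theorem hQ_sub_one_le (u v : ℝ × ℝ) :
    hQ u v - 1 ≤ ((u.1 - v.1) ^ 2 + (u.2 - v.2) ^ 2) / 2 := by
  unfold hQ
  nlinarith [sq_nonneg (hht u - hht v), hht_sq u, hht_sq v]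

theorem mDist_hyp {κ : ℝ} (hκ : κ < 0) (u v : ℝ × ℝ) :
    mDist κ u v = Real.arcosh (hQ u v) / √(-κ) := by
  unfold mDist
  rw [if_neg hκ.ne, one_div, mul_comm, div_eq_mul_inv]
  rfl

theorem two_mul_sinh_half_sq (D : ℝ) : 2 * Real.sinh (D / 2) ^ 2 = Real.cosh D - 1 := by
  have h := Real.cosh_two_mul (D / 2)
  have h2 := Real.cosh_sq (D / 2)
  rw [mul_div_cancel₀ D two_ne_zero] at h
  linarith

/-- If `cosh D = 1 + δ² / 2` with `D, δ ≥ 0` then `D ≤ δ`. -/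
theorem le_of_cosh_le {D δ : ℝ} (hD : 0 ≤ D) (hδ : 0 ≤ δ) (h : Real.cosh D ≤ 1 + δ ^ 2 / 2) :
    D ≤ δ := by
  have h1 := two_mul_sinh_half_sq D
  have h2 : D / 2 ≤ Real.sinh (D / 2) := Real.self_le_sinh_iff.2 (by positivity)
  have h3 : (D / 2) ^ 2 ≤ Real.sinh (D / 2) ^ 2 := by gcongr
  apply le_of_sq_le_sq _ hδ
  nlinarith

theorem mDist_le {κ : ℝ} (hκ : κ ≤ 0) : ∃ C, 0 ≤ C ∧ ∀ u v, mDist κ u v ≤ C * dist u v := by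
  have key : ∀ u v : ℝ × ℝ, (u.1 - v.1) ^ 2 + (u.2 - v.2) ^ 2 ≤ (2 * dist u v) ^ 2 := by
    intro u v
    have h1 : |u.1 - v.1| ≤ dist u v := le_max_left _ _
    have h2 : |u.2 - v.2| ≤ dist u v := le_max_right _ _
    have h3 := pow_le_pow_left₀ (abs_nonneg _) h1 2
    have h4 := pow_le_pow_left₀ (abs_nonneg _) h2 2
    rw [sq_abs] at h3 h4
    nlinarith
  rcases hκ.eq_or_lt with rfl | hκ
  · refine ⟨2, by norm_num, fun u v => ?_⟩
    simp only [mDist, if_true]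
    rw [Real.sqrt_le_left (by positivity)]
    exact key u v
  · have hk : 0 < √(-κ) := Real.sqrt_pos.2 (by linarith)
    refine ⟨2 / √(-κ), by positivity, fun u v => ?_⟩
    rw [mDist_hyp hκ, div_mul_eq_mul_div, div_le_div_iff_of_pos_right hk]
    refine le_of_cosh_le (Real.arcosh_nonneg (one_le_hQ u v)) (by positivity) ?_
    rw [Real.cosh_arcosh (one_le_hQ u v)]
    linarith [hQ_sub_one_le u v, key u v]

/-- The hyperbolic translation taking the origin to `v`. -/
def boost (v x : ℝ × ℝ) : ℝ × ℝ :=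
  (x.1 + v.1 * ((v.1 * x.1 + v.2 * x.2) / (1 + hht v) + hht x),
    x.2 + v.2 * ((v.1 * x.1 + v.2 * x.2) / (1 + hht v) + hht x))

theorem hht_boost (v x : ℝ × ℝ) :
    hht (boost v x) = hht v * hht x + v.1 * x.1 + v.2 * x.2 := by
  have hv := hht_pos v
  have hx := hht_pos x
  have h0 : 0 ≤ hht v * hht x + v.1 * x.1 + v.2 * x.2 := by
    have := one_le_hQ (-v.1, -v.2) x
    have e : hht (-v.1, -v.2) = hht v := by simp [hht]
    unfold hQ at this
    rw [e] at this
    simp only at this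
    linarith
  rw [hht, Real.sqrt_eq_iff_mul_self_eq (by positivity) h0]
  have hv2 := hht_sq v
  have hx2 := hht_sq x
  simp only [boost]
  set n := hht v
  set m := hht x
  have hn : 1 + n ≠ 0 := by positivity
  obtain ⟨c, hc⟩ : ∃ c, c = (v.1 * x.1 + v.2 * x.2) / (1 + n) := ⟨_, rfl⟩
  have hc' : c * (1 + n) = v.1 * x.1 + v.2 * x.2 := by rw [hc]; field_simp
  rw [← hc]
  have hd : v.1 * x.1 + v.2 * x.2 = c * (1 + n) := hc'.symm
  linear_combination -((c + m) ^ 2 * hv2 + hx2 -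
    (2 * (c + m) - 2 * n * m - (v.1 * x.1 + v.2 * x.2) - c * (1 + n)) * hd)

theorem hQ_boost (v x y : ℝ × ℝ) : hQ (boost v x) (boost v y) = hQ x y := by
  have hv := hht_pos v
  unfold hQ
  rw [hht_boost, hht_boost]
  have hv2 := hht_sq v
  simp only [boost]
  set n := hht v
  set m := hht x
  set k := hht y
  have hn : 1 + n ≠ 0 := by positivity
  obtain ⟨c, hc⟩ : ∃ c, c = (v.1 * x.1 + v.2 * x.2) / (1 + n) := ⟨_, rfl⟩
  have hc' : c * (1 + n) = v.1 * x.1 + v.2 * x.2 := by rw [hc]; field_simp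
  obtain ⟨d, hd⟩ : ∃ d, d = (v.1 * y.1 + v.2 * y.2) / (1 + n) := ⟨_, rfl⟩
  have hd' : d * (1 + n) = v.1 * y.1 + v.2 * y.2 := by rw [hd]; field_simp
  rw [← hc, ← hd]
  have e : (n * m + v.1 * x.1 + v.2 * x.2) * (n * k + v.1 * y.1 + v.2 * y.2) =
      (n * m + c * (1 + n)) * (n * k + d * (1 + n)) := by rw [hc', hd']; ring
  rw [e]
  linear_combination (c + m) * (d + k) * hv2 + (d + k) * hc' + (c + m) * hd'

theorem boost_zero (v : ℝ × ℝ) : boost v 0 = v := by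
  simp [boost, hht]

theorem hQ_zero (x : ℝ × ℝ) : hQ 0 x = hht x := by
  simp [hQ, hht]

theorem boost_boost_neg (v u : ℝ × ℝ) : boost v (boost (-v) u) = u := by
  have hv := hht_pos v
  have hh := hht_boost (-v) u
  have e : hht (-v) = hht v := by simp [hht]
  have hv2 := hht_sq v
  rw [e] at hh
  rw [boost, hh]
  simp only [boost, e, Prod.fst_neg, Prod.snd_neg]
  set n := hht v
  set m := hht u
  have hn : 1 + n ≠ 0 := by positivity
  obtain ⟨c, hc⟩ : ∃ c, c = (v.1 * u.1 + v.2 * u.2) / (1 + n) := ⟨_, rfl⟩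
  have hc' : c * (1 + n) = v.1 * u.1 + v.2 * u.2 := by rw [hc]; field_simp
  have e1 : (-v.1 * u.1 + -v.2 * u.2) / (1 + n) = -c := by rw [hc]; ring
  rw [e1]
  have e2 : (v.1 * (u.1 + -v.1 * (-c + m)) + v.2 * (u.2 + -v.2 * (-c + m))) / (1 + n) =
      c - (n - 1) * (m - c) := by
    rw [div_eq_iff hn]
    linear_combination -hc' + (m - c) * hv2
  rw [e2]
  have e3 : c - (n - 1) * (m - c) + (n * m + -v.1 * u.1 + -v.2 * u.2) = m - c := by
    linear_combination hc'
  rw [e3]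
  ext <;> simp only <;> ring

theorem continuous_boost : Continuous fun z : (ℝ × ℝ) × (ℝ × ℝ) => boost z.1 z.2 := by
  unfold boost
  have h : ∀ z : (ℝ × ℝ) × (ℝ × ℝ), 1 + hht z.1 ≠ 0 := fun z => by
    have := hht_pos z.1; positivity
  have := continuous_hht
  fun_prop (disch := exact h)

theorem arcosh_cosh_abs (t : ℝ) : Real.arcosh (Real.cosh t) = |t| := by
  rw [← Real.cosh_abs, Real.arcosh_cosh (abs_nonneg t)]

theorem hht_polar (a : ℝ) (ζ : Circle) :
    hht (Real.sinh a * (ζ : ℂ).re, Real.sinh a * (ζ : ℂ).im) = Real.cosh a := by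
  unfold hht
  rw [Real.sqrt_eq_iff_mul_self_eq (by positivity) (Real.cosh_pos a).le]
  have := Real.cosh_sq a
  simp only
  linear_combination Real.sinh a ^ 2 * circle_re_sq_add_im_sq ζ - this

theorem hQ_polar (a b : ℝ) (ζ ξ : Circle) :
    hQ (Real.sinh a * (ζ : ℂ).re, Real.sinh a * (ζ : ℂ).im)
      (Real.sinh b * (ξ : ℂ).re, Real.sinh b * (ξ : ℂ).im) =
      Real.cosh (a - b) + Real.sinh a * Real.sinh b * dist ζ ξ ^ 2 / 2 := by
  unfold hQ
  rw [hht_polar, hht_polar, circle_dist_sq, Real.cosh_sub]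
  linear_combination (-Real.sinh a * Real.sinh b / 2) * circle_re_sq_add_im_sq ζ -
    Real.sinh a * Real.sinh b / 2 * circle_re_sq_add_im_sq ξ

theorem circle_dist_neg (ζ : Circle) : dist ζ (-ζ) = 2 := by
  have h : dist ζ (-ζ) ^ 2 = 2 ^ 2 := by
    rw [circle_dist_sq]
    simp only [Circle.coe_neg, Complex.neg_re, Complex.neg_im]
    linear_combination 4 * circle_re_sq_add_im_sq ζ
  exact (sq_eq_sq₀ dist_nonneg two_pos.le).1 h

theorem circle_dist_le_two (ζ ξ : Circle) : dist ζ ξ ≤ 2 := by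
  apply le_of_sq_le_sq _ two_pos.le
  rw [circle_dist_sq]
  nlinarith [circle_re_sq_add_im_sq ζ, circle_re_sq_add_im_sq ξ,
    sq_nonneg ((ζ : ℂ).re + (ξ : ℂ).re), sq_nonneg ((ζ : ℂ).im + (ξ : ℂ).im)]

theorem isPolar_hyp {κ : ℝ} (hκ : κ < 0) : IsPolar κ fun v ζ s =>
    boost v (Real.sinh (√(-κ) * s) * (ζ : ℂ).re, Real.sinh (√(-κ) * s) * (ζ : ℂ).im) := by
  have hk : 0 < √(-κ) := Real.sqrt_pos.2 (by linarith)
  set k := √(-κ) with hkdef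
  have hlow : ∀ s, 0 ≤ s → ∀ ζ ξ : Circle, ∃ D, 0 ≤ D ∧ (∀ v, mDist κ
      (boost v (Real.sinh (k * s) * (ζ : ℂ).re, Real.sinh (k * s) * (ζ : ℂ).im))
      (boost v (Real.sinh (k * s) * (ξ : ℂ).re, Real.sinh (k * s) * (ξ : ℂ).im)) = D / k) ∧
      Real.cosh D = 1 + (Real.sinh (k * s) * dist ζ ξ) ^ 2 / 2 := by
    intro s hs ζ ξ
    refine ⟨Real.arcosh (1 + (Real.sinh (k * s) * dist ζ ξ) ^ 2 / 2),
      Real.arcosh_nonneg ?_, fun v => ?_, Real.cosh_arcosh ?_⟩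
    · have : 0 ≤ (Real.sinh (k * s) * dist ζ ξ) ^ 2 / 2 := by positivity
      linarith
    · rw [mDist_hyp hκ, hQ_boost, hQ_polar, ← hkdef, sub_self, Real.cosh_zero]
      congr 3
      ring
    · have : 0 ≤ (Real.sinh (k * s) * dist ζ ξ) ^ 2 / 2 := by positivity
      linarith
  refine ⟨?_, ?_, ?_, ?_, ?_, ?_, ?_, ?_⟩
  · intro v ζ s hs
    have : mDist κ (boost v 0) (boost v
        (Real.sinh (k * s) * (ζ : ℂ).re, Real.sinh (k * s) * (ζ : ℂ).im)) = s := by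
      rw [mDist_hyp hκ, hQ_boost, hQ_zero, hht_polar, arcosh_cosh_abs, ← hkdef,
        abs_of_nonneg (by positivity)]
      field_simp
    rwa [boost_zero] at this
  · intro v u
    set x := boost (-v) u with hx
    have hu : u = boost v x := (boost_boost_neg v u).symm
    obtain ⟨ζ, h1, h2⟩ := exists_circle_polar x.1 x.2
    refine ⟨ζ, ?_⟩
    have hd : k * mDist κ v u = Real.arcosh (hht x) := by
      have : mDist κ (boost v 0) (boost v x) = Real.arcosh (hht x) / k := by
        rw [mDist_hyp hκ, hQ_boost, hQ_zero]
      rw [boost_zero, ← hu] at this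
      rw [this]; field_simp
    have h1x : 1 ≤ hht x := by
      rw [← hQ_zero]; exact one_le_hQ _ _
    simp only [hd, Real.sinh_arcosh h1x]
    have : hht x ^ 2 - 1 = x.1 ^ 2 + x.2 ^ 2 := by rw [hht_sq]; ring
    rw [this, ← h1, ← h2]
    exact hu.symm
  · intro v ζ s s' _ _
    rw [mDist_hyp hκ, hQ_boost, hQ_polar, ← hkdef, dist_self]
    simp only [ne_eq, OfNat.ofNat_ne_zero, not_false_eq_true, zero_pow, mul_zero, zero_div,
      add_zero]
    rw [arcosh_cosh_abs, ← mul_sub, abs_mul, abs_of_pos hk]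
    field_simp
  · intro v ζ s hs
    obtain ⟨D, hD, h1, h2⟩ := hlow s hs ζ (-ζ)
    rw [h1 v]
    have h3 : Real.cosh D = Real.cosh (2 * (k * s)) := by
      rw [h2, circle_dist_neg, Real.cosh_two_mul, Real.cosh_sq]; ring
    have := congrArg Real.arcosh h3
    rw [Real.arcosh_cosh hD, Real.arcosh_cosh (by positivity)] at this
    rw [this]; field_simp
  · intro s hs
    have hks : 0 < k * s := by positivity
    have hsh := Real.sinh_pos_iff.2 hks
    refine ⟨1 / s, by positivity, fun v ζ ξ => ?_⟩
    obtain ⟨D, hD, h1, h2⟩ := hlow s hs.le ζ ξ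
    rw [h1 v]
    have h3 := two_mul_sinh_half_sq D
    have h4 : Real.sinh (D / 2) = Real.sinh (k * s) * dist ζ ξ / 2 := by
      rw [← sq_eq_sq₀ (Real.sinh_nonneg_iff.2 (by positivity)) (by positivity)]
      linarith
    have h5 : D / 2 ≤ k * s := by
      rw [← Real.sinh_le_sinh, h4]
      nlinarith [circle_dist_le_two ζ ξ]
    have h6 := mul_sinh_le_mul_sinh (x := D / 2) (y := k * s) (by positivity) h5
    rw [h4] at h6
    have h7 : k * s * dist ζ ξ ≤ D := by
      by_contra hcon
      push Not at hcon
      nlinarith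
    rw [one_div, ← div_eq_inv_mul, le_div_iff₀ hs, le_div_iff₀ hk]
    linarith
  · intro s hs
    have hsh := Real.sinh_nonneg_iff.2 (mul_nonneg hk.le hs)
    refine ⟨Real.sinh (k * s) / k, by positivity, fun v ζ ξ => ?_⟩
    obtain ⟨D, hD, h1, h2⟩ := hlow s hs ζ ξ
    rw [h1 v, div_mul_eq_mul_div, div_le_div_iff_of_pos_right hk]
    exact le_of_cosh_le hD (by positivity) h2.le
  · have : Continuous fun z : Circle => (z : ℂ) := continuous_subtype_val
    refine continuous_boost.comp (f := fun z : ((ℝ × ℝ) × ℝ) × Circle =>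
      (z.1.1, (Real.sinh (k * z.1.2) * (z.2 : ℂ).re, Real.sinh (k * z.1.2) * (z.2 : ℂ).im))) ?_
    have := Real.continuous_sinh
    fun_prop
  · intro v ζ
    simp only [mul_zero, Real.sinh_zero, zero_mul]
    exact boost_zero v

theorem exists_isPolar {κ : ℝ} (hκ : κ ≤ 0) : ∃ pol, IsPolar κ pol := by
  rcases hκ.eq_or_lt with rfl | hκ
  · exact ⟨_, isPolar_eucl⟩
  · exact ⟨_, isPolar_hyp hκ⟩

end Cat2Cx
end

open Set Metric Filter
noncomputable section
namespace Cat2Cx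

/-! ### Flat points -/

variable {X : Type*} [MetricSpace X]

/-- Polar coordinates on the closed ball of radius `R` around `w`. -/
structure FlatAt (w : X) (R : ℝ) (P : Circle → ℝ → X) : Prop where
  pos : 0 < R
  dist_center : ∀ ζ s, 0 ≤ s → s ≤ R → dist w (P ζ s) = s
  surj : ∀ y, dist w y ≤ R → ∃ ζ, P ζ (dist w y) = y
  radial : ∀ ζ s s', 0 ≤ s → s ≤ R → 0 ≤ s' → s' ≤ R → dist (P ζ s) (P ζ s') = |s - s'|
  antipodal : ∀ ζ s, 0 ≤ s → s ≤ R → dist (P ζ s) (P (-ζ) s) = 2 * s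
  lower : ∀ s, 0 < s → s ≤ R → ∃ C, 0 ≤ C ∧ ∀ ζ ξ, dist ζ ξ ≤ C * dist (P ζ s) (P ξ s)
  upper : ∀ s, 0 ≤ s → s ≤ R → ∃ C, 0 ≤ C ∧ ∀ ζ ξ, dist (P ζ s) (P ξ s) ≤ C * dist ζ ξ

open Topology in
theorem PolyComplex2.exists_flatAt {κ : ℝ} (hκ : κ ≤ 0) (PC : PolyComplex2 κ X) {F : Set X}
    (hF : F ∈ PC.faces) {w : X} (hw : w ∈ F) :
    ∃ s₀ > 0, ∀ w' ∈ ball w s₀, ∃ P, FlatAt w' s₀ P := by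
  obtain ⟨f, Q, -, hinj, -, hFint, hd⟩ := PC.face_chart F hF
  obtain ⟨pol, hpol⟩ := exists_isPolar hκ
  have hsub : F ⊆ closure F := subset_closure
  have hU : IsOpen (f '' F) := by rw [hFint]; exact isOpen_interior
  have hcont : ∀ v, ∀ U ∈ 𝓝 v, ∀ᶠ z : (ℝ × ℝ) × ℝ in 𝓝 (v, 0),
      ∀ ζ ∈ (univ : Set Circle), pol z.1 ζ z.2 ∈ U := by
    intro v U hU
    refine isCompact_univ.eventually_forall_of_forall_eventually (x₀ := ((v, 0) : (ℝ × ℝ) × ℝ))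
      (P := fun z ζ => pol z.1 ζ z.2 ∈ U) ?_
    intro ζ _
    have h1 := hpol.cont.continuousAt (x := (((v, 0) : (ℝ × ℝ) × ℝ), ζ))
    apply h1
    simp only [hpol.zero]
    exact hU
  obtain ⟨δ, hδ, h1⟩ := Metric.eventually_nhds_iff.1
    (hcont (f w) (f '' F) (hU.mem_nhds ⟨w, hw, rfl⟩))
  obtain ⟨δ', hδ', h2⟩ := Metric.eventually_nhds_iff.1 (hcont (f w) _ (ball_mem_nhds _ hδ))
  obtain ⟨r, hr, hrF⟩ := Metric.isOpen_iff.1 (PC.faces_open F hF) w hw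
  obtain ⟨s₀, hs₀, ha, hb, hc⟩ : ∃ s₀ > 0, s₀ < δ ∧ s₀ < δ' ∧ 2 * s₀ < r := by
    refine ⟨min δ (min δ' r) / 3, ?_, ?_, ?_, ?_⟩
    · have := lt_min hδ (lt_min hδ' hr)
      positivity
    all_goals
      have h0 := lt_min hδ (lt_min hδ' hr)
      have h1 := min_le_left δ (min δ' r)
      have h2 := (min_le_right δ (min δ' r)).trans (min_le_left _ _)
      have h3 := (min_le_right δ (min δ' r)).trans (min_le_right _ _)
      linarith
  refine ⟨s₀, hs₀, ?_⟩
  intro w' hw'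
  rw [mem_ball] at hw'
  have hnear : ∀ y, dist w' y ≤ s₀ → y ∈ F := by
    intro y hy
    apply hrF
    rw [mem_ball, dist_comm]
    have := dist_triangle w w' y
    rw [dist_comm w w'] at this
    linarith
  have hw'F : w' ∈ F := hnear w' (by rw [dist_self]; exact hs₀.le)
  have hv : dist (f w') (f w) < δ := by
    obtain ⟨ζ, hζ⟩ := hpol.surj (f w) (f w')
    have h3 := h2 (y := (f w, mDist κ (f w) (f w'))) (by
      rw [Prod.dist_eq]
      apply max_lt
      · simpa using hδ'
      · rw [hd w (hsub hw) w' (hsub hw'F), Real.dist_eq, sub_zero, abs_of_nonneg dist_nonneg,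
          dist_comm]
        linarith) ζ (mem_univ _)
    simp only at h3
    rw [hζ] at h3
    exact h3
  have hin : ∀ ζ s, 0 ≤ s → s ≤ s₀ → pol (f w') ζ s ∈ f '' F := by
    intro ζ s hs0 hs
    refine h1 (y := (f w', s)) ?_ ζ (mem_univ _)
    rw [Prod.dist_eq]
    apply max_lt hv
    rw [Real.dist_eq, sub_zero, abs_of_nonneg hs0]
    linarith
  have : Nonempty X := ⟨w⟩
  have hP : ∃ P : Circle → ℝ → X, ∀ ζ s, 0 ≤ s → s ≤ s₀ →
      P ζ s ∈ closure F ∧ f (P ζ s) = pol (f w') ζ s := by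
    refine ⟨fun ζ s => Function.invFunOn f F (pol (f w') ζ s), fun ζ s hs0 hs => ?_⟩
    exact ⟨hsub (Function.invFunOn_mem (hin ζ s hs0 hs)), Function.invFunOn_eq (hin ζ s hs0 hs)⟩
  obtain ⟨P, hP⟩ := hP
  have hPd : ∀ ζ s ξ s', 0 ≤ s → s ≤ s₀ → 0 ≤ s' → s' ≤ s₀ → dist (P ζ s) (P ξ s') =
      mDist κ (pol (f w') ζ s) (pol (f w') ξ s') := by
    intro ζ s ξ s' a b c d
    rw [← (hP ζ s a b).2, ← (hP ξ s' c d).2, hd _ (hP ζ s a b).1 _ (hP ξ s' c d).1]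
  refine ⟨P, hs₀, ?_, ?_, ?_, ?_, ?_, ?_⟩
  · intro ζ s a b
    rw [← hd _ (hsub hw'F) _ (hP ζ s a b).1, (hP ζ s a b).2, hpol.dist_center _ _ _ a]
  · intro y hy
    have hyF := hsub (hnear y hy)
    obtain ⟨ζ, hζ⟩ := hpol.surj (f w') (f y)
    rw [hd _ (hsub hw'F) _ hyF] at hζ
    refine ⟨ζ, hinj (hP ζ _ dist_nonneg hy).1 hyF ?_⟩
    rw [(hP ζ _ dist_nonneg hy).2, hζ]
  · intro ζ s s' a b c d
    rw [hPd ζ s ζ s' a b c d, hpol.radial _ _ _ _ a c]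
  · intro ζ s a b
    rw [hPd ζ s (-ζ) s a b a b, hpol.antipodal _ _ _ a]
  · intro s a b
    obtain ⟨C, hC, h⟩ := hpol.lower s a
    refine ⟨C, hC, fun ζ ξ => ?_⟩
    rw [hPd ζ s ξ s a.le b a.le b]
    exact h _ _ _
  · intro s a b
    obtain ⟨C, hC, h⟩ := hpol.upper s a
    refine ⟨C, hC, fun ζ ξ => ?_⟩
    rw [hPd ζ s ξ s a b a b]
    exact h _ _ _

open Classical in
/-- The direction at the flat point `w` of the geodesic from `w` to `y`. -/
def dir (w : X) (R : ℝ) (P : Circle → ℝ → X) (y : X) : Circle :=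
  if h : ∃ ζ, P ζ (min R (dist w y)) = gd w y (min R (dist w y)) then h.choose else 1

namespace FlatAt

variable {w : X} {R : ℝ} {P : Circle → ℝ → X}

theorem inj (h : FlatAt w R P) {s : ℝ} (hs : 0 < s) (hsR : s ≤ R) {ζ ξ : Circle}
    (he : P ζ s = P ξ s) : ζ = ξ := by
  obtain ⟨C, _, hC⟩ := h.lower s hs hsR
  have := hC ζ ξ
  rw [he, dist_self, mul_zero] at this
  exact dist_le_zero.1 this

theorem gd_polar (hX : Cat0 X) (h : FlatAt w R P) (ζ : Circle) {s t : ℝ} (hs : 0 ≤ s)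
    (hst : s ≤ t) (ht : t ≤ R) : gd w (P ζ t) s = P ζ s := by
  have h1 := h.dist_center ζ s hs (hst.trans ht)
  have h2 := h.dist_center ζ t (hs.trans hst) ht
  have h3 := h.radial ζ s t hs (hst.trans ht) (hs.trans hst) ht
  rw [abs_sub_comm, abs_of_nonneg (sub_nonneg.2 hst)] at h3
  have := hX.eq_gd (o := w) (x := P ζ t) (m := P ζ s) (by rw [h1, h2, h3]; ring)
  rw [h1] at this
  exact this.symm

theorem dir_spec (hX : Cat0 X) (h : FlatAt w R P) (y : X) {s : ℝ} (hs : 0 ≤ s) (hsR : s ≤ R)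
    (hsy : s ≤ dist w y) : gd w y s = P (dir w R P y) s := by
  set t := min R (dist w y) with ht
  have ht0 : 0 ≤ t := le_min h.pos.le dist_nonneg
  have hex : ∃ ζ, P ζ (min R (dist w y)) = gd w y (min R (dist w y)) := by
    have e := hX.dist_gd w y ht0 (min_le_right _ _)
    obtain ⟨ζ, hζ⟩ := h.surj (gd w y t) (by rw [e]; exact min_le_left _ _)
    rw [e] at hζ
    exact ⟨ζ, hζ⟩
  have hst : s ≤ t := le_min hsR hsy
  have hd : P (dir w R P y) t = gd w y t := by
    unfold dir
    rw [dif_pos hex]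
    exact hex.choose_spec
  have := h.gd_polar hX (dir w R P y) hs hst (min_le_left _ _)
  rw [hd, hX.gd_gd, min_eq_left hst] at this
  exact this

theorem dir_eq (hX : Cat0 X) (h : FlatAt w R P) {y : X} {s : ℝ} (hs : 0 < s) (hsR : s ≤ R)
    (hsy : s ≤ dist w y) {ζ : Circle} (he : gd w y s = P ζ s) : dir w R P y = ζ := by
  rw [h.dir_spec hX y hs.le hsR hsy] at he
  exact h.inj hs hsR he

theorem dir_gd (hX : Cat0 X) (h : FlatAt w R P) {y : X} (hy : y ≠ w) {s : ℝ} (hs : 0 < s) :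
    dir w R P (gd w y s) = dir w R P y := by
  have hd : 0 < dist w y := dist_pos.2 hy.symm
  have e := hX.dist_gd_eq_min w y hs.le
  have ht : 0 < min R (min s (dist w y)) := lt_min h.pos (lt_min hs hd)
  refine h.dir_eq hX ht (min_le_left _ _) (by rw [e]; exact min_le_right _ _) ?_
  rw [hX.gd_gd, min_eq_left ((min_le_right _ _).trans (min_le_left _ _))]
  exact h.dir_spec hX y ht.le (min_le_left _ _) ((min_le_right _ _).trans (min_le_right _ _))

theorem dir_lipschitz (hX : Cat0 X) (h : FlatAt w R P) {ε : ℝ} (hε : 0 < ε) :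
    ∃ K, 0 ≤ K ∧ ∀ y y', ε ≤ dist w y → ε ≤ dist w y' →
      dist (dir w R P y) (dir w R P y') ≤ K * dist y y' := by
  have hs : 0 < min R ε := lt_min h.pos hε
  obtain ⟨C, hC, hl⟩ := h.lower (min R ε) hs (min_le_left _ _)
  refine ⟨C * 2, by positivity, fun y y' hy hy' => ?_⟩
  refine (hl _ _).trans ?_
  rw [← h.dir_spec hX y hs.le (min_le_left _ _) ((min_le_right _ _).trans hy),
    ← h.dir_spec hX y' hs.le (min_le_left _ _) ((min_le_right _ _).trans hy'), mul_assoc]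
  exact mul_le_mul_of_nonneg_left (hX.dist_gd_gd_le_two _ _ _ _) hC

theorem continuousOn_dir (hX : Cat0 X) (h : FlatAt w R P) :
    ContinuousOn (dir w R P) {w}ᶜ := by
  intro y hy
  apply ContinuousAt.continuousWithinAt
  have hd : 0 < dist w y := dist_pos.2 (Ne.symm hy)
  obtain ⟨K, hK, hl⟩ := h.dir_lipschitz hX (half_pos hd)
  refine Metric.continuousAt_iff.2 fun ε hε => ?_
  refine ⟨min (dist w y / 2) (ε / (K + 1)), lt_min (by positivity) (by positivity), ?_⟩
  intro z hz
  have h1 : dist z y < dist w y / 2 := hz.trans_le (min_le_left _ _)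
  have h2 : dist z y < ε / (K + 1) := hz.trans_le (min_le_right _ _)
  have h3 : dist w y / 2 ≤ dist w z := by linarith [dist_triangle w z y]
  refine (hl z y h3 (by linarith)).trans_lt ?_
  rw [lt_div_iff₀ (by positivity)] at h2
  nlinarith [@dist_nonneg _ _ z y]

theorem continuous_polar (h : FlatAt w R P) {s : ℝ} (hs : 0 ≤ s) (hsR : s ≤ R) :
    Continuous fun ζ => P ζ s := by
  obtain ⟨C, hC, hl⟩ := h.upper s hs hsR
  exact (LipschitzWith.of_dist_le_mul (K := ⟨C, hC⟩) fun ζ ξ => hl ζ ξ).continuous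

theorem isCompact_sphere (h : FlatAt w R P) {s : ℝ} (hs : 0 ≤ s) (hsR : s ≤ R) :
    IsCompact {y | dist w y = s} := by
  have : {y | dist w y = s} = range fun ζ => P ζ s := by
    ext y
    constructor
    · intro hy
      have hy' : dist w y = s := hy
      obtain ⟨ζ, hζ⟩ := h.surj y (by rw [hy']; exact hsR)
      rw [hy'] at hζ
      exact ⟨ζ, hζ⟩
    · rintro ⟨ζ, rfl⟩
      exact h.dist_center ζ s hs hsR
  rw [this]
  exact isCompact_range (h.continuous_polar hs hsR)

theorem dist_eq_add (hX : Cat0 X) (h : FlatAt w R P) {y y' : X} (hy : y ≠ w) (hy' : y' ≠ w)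
    (hd : dir w R P y' = -dir w R P y) : dist y y' = dist y w + dist w y' := by
  have h1 : 0 < dist w y := dist_pos.2 hy.symm
  have h2 : 0 < dist w y' := dist_pos.2 hy'.symm
  set s := min R (min (dist w y) (dist w y')) with hs
  have hs0 : 0 < s := lt_min h.pos (lt_min h1 h2)
  have hsR : s ≤ R := min_le_left _ _
  have hsy : s ≤ dist w y := (min_le_right _ _).trans (min_le_left _ _)
  have hsy' : s ≤ dist w y' := (min_le_right _ _).trans (min_le_right _ _)
  refine hX.dist_eq_add_of_antipodal hs0 hsy hsy' ?_
  rw [h.dir_spec hX y hs0.le hsR hsy, h.dir_spec hX y' hs0.le hsR hsy', hd]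
  exact h.antipodal _ _ hs0.le hsR

end FlatAt
end Cat2Cx
end

open Set Metric Filter
noncomputable section
namespace Cat2Cx

/-! ### Generic values of Lipschitz maps -/

open MeasureTheory in
theorem volume_eq_zero_of_dimH_lt {V : Type*} [NormedAddCommGroup V] [NormedSpace ℝ V]
    [FiniteDimensional ℝ V] [MeasurableSpace V] [BorelSpace V] (μ : Measure V)
    [μ.IsAddHaarMeasure] {s : Set V} (hs : dimH s < Module.finrank ℝ V) : μ s = 0 := by
  have h := Measure.absolutelyContinuous_isAddHaarMeasure μ
    (Measure.hausdorffMeasure (Module.finrank ℝ V) : Measure V)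
  have h2 : Measure.hausdorffMeasure (Module.finrank ℝ V : ℝ) s = 0 := by
    have := hausdorffMeasure_of_dimH_lt (s := s) (d := (Module.finrank ℝ V : NNReal))
      (by simpa using hs)
    simpa using this
  exact h h2

variable {X : Type*} [MetricSpace X]

open MeasureTheory in
theorem ae_ae_not_mem_of_dimH_le_one {S : Set X} (hS : dimH S ≤ 1) {f₁ f₂ : X → ℝ}
    {K₁ K₂ : NNReal} (h₁ : LipschitzOnWith K₁ f₁ S) (h₂ : LipschitzOnWith K₂ f₂ S) :
    ∀ᵐ a : ℝ, ∀ᵐ b : ℝ, ∀ y ∈ S, f₁ y = a → f₂ y ≠ b := by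
  have h0 : (volume : Measure (ℝ × ℝ)) ((fun y => (f₁ y, f₂ y)) '' S) = 0 := by
    apply volume_eq_zero_of_dimH_lt
    refine ((h₁.prodMk h₂).dimH_image_le.trans hS).trans_lt ?_
    simp
  have h := Measure.measure_ae_null_of_prod_null
    (μ := (volume : Measure ℝ)) (ν := (volume : Measure ℝ)) h0
  filter_upwards [h] with a ha
  rw [Pi.zero_apply, measure_eq_zero_iff_ae_notMem] at ha
  filter_upwards [ha] with b hb y hy h1 h2
  exact hb ⟨y, hy, by simp only [h1, h2]⟩

open MeasureTheory in
theorem ae_ae_ae_not_mem_of_dimH_le_two {S : Set X} (hS : dimH S ≤ 2) {f₁ f₂ f₃ : X → ℝ}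
    {K₁ K₂ K₃ : NNReal} (h₁ : LipschitzOnWith K₁ f₁ S) (h₂ : LipschitzOnWith K₂ f₂ S)
    (h₃ : LipschitzOnWith K₃ f₃ S) :
    ∀ᵐ a : ℝ, ∀ᵐ b : ℝ, ∀ᵐ c : ℝ, ∀ y ∈ S, f₁ y = a → f₂ y = b → f₃ y ≠ c := by
  have h0 : (volume : Measure (ℝ × ℝ × ℝ)) ((fun y => (f₁ y, f₂ y, f₃ y)) '' S) = 0 := by
    have : (volume : Measure (ℝ × ℝ × ℝ)).IsAddHaarMeasure :=
      inferInstanceAs ((volume : Measure ℝ).prod (volume : Measure (ℝ × ℝ))).IsAddHaarMeasure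
    apply volume_eq_zero_of_dimH_lt
    refine ((h₁.prodMk (h₂.prodMk h₃)).dimH_image_le.trans hS).trans_lt ?_
    simp
    norm_num
  have h := Measure.measure_ae_null_of_prod_null
    (μ := (volume : Measure ℝ)) (ν := (volume : Measure (ℝ × ℝ))) h0
  filter_upwards [h] with a ha
  have h' := Measure.measure_ae_null_of_prod_null
    (μ := (volume : Measure ℝ)) (ν := (volume : Measure ℝ)) ha
  filter_upwards [h'] with b hb
  rw [Pi.zero_apply, measure_eq_zero_iff_ae_notMem] at hb
  filter_upwards [hb] with c hc y hy h1 h2 h3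
  exact hc ⟨y, hy, by simp only [h1, h2, h3]⟩

open MeasureTheory in
theorem exists_mem_Ioo_of_ae {p : ℝ → Prop} (hp : ∀ᵐ a, p a) {x y : ℝ} (hxy : x < y) :
    ∃ a ∈ Ioo x y, p a := by
  by_contra h
  push Not at h
  have : volume (Ioo x y) = 0 := by
    refine measure_mono_null (fun a ha => ?_) (ae_iff.1 hp)
    exact h a ha
  simp [hxy.not_ge] at this

namespace PolyComplex2
variable {κ : ℝ} (PC : PolyComplex2 κ X)

theorem compl_faces_subset : (⋃₀ PC.faces)ᶜ ⊆ ⋃₀ PC.edges ∪ PC.vertices := by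
  intro x hx
  have : x ∈ ⋃₀ PC.faces ∪ ⋃₀ PC.edges ∪ PC.vertices := by rw [PC.cover]; trivial
  rcases this with (h | h) | h
  · exact absurd h hx
  · exact Or.inl h
  · exact Or.inr h

theorem finite_of_isCompact {K : Set X} (hK : IsCompact K) :
    {c | (c ∈ PC.faces ∨ c ∈ PC.edges) ∧ (c ∩ K).Nonempty}.Finite ∧
      (PC.vertices ∩ K).Finite := by
  choose ε hε h1 h2 using PC.locally_finite
  obtain ⟨t, _, ht⟩ := hK.elim_nhds_subcover (fun x => ball x (ε x))
    (fun x _ => ball_mem_nhds _ (hε x))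
  constructor
  · refine (t.finite_toSet.biUnion fun x _ => h1 x).subset ?_
    rintro c ⟨hc, y, hyc, hyK⟩
    obtain ⟨x, hx, hyx⟩ := mem_iUnion₂.1 (ht hyK)
    exact mem_iUnion₂.2 ⟨x, hx, hc, y, hyc, hyx⟩
  · refine (t.finite_toSet.biUnion fun x _ => h2 x).subset ?_
    rintro y ⟨hyc, hyK⟩
    obtain ⟨x, hx, hyx⟩ := mem_iUnion₂.1 (ht hyK)
    exact mem_iUnion₂.2 ⟨x, hx, hyc, hyx⟩

theorem dimH_face_le (hκ : κ ≤ 0) {F : Set X} (hF : F ∈ PC.faces) : dimH F ≤ 2 := by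
  obtain ⟨f, Q, -, hinj, -, hFint, hd⟩ := PC.face_chart F hF
  obtain ⟨C, hC, hmD⟩ := mDist_le hκ
  rcases F.eq_empty_or_nonempty with rfl | ⟨w, hw⟩
  · simp
  have : Nonempty X := ⟨w⟩
  have hsub : F ⊆ closure F := subset_closure
  have hinjF : InjOn f F := hinj.mono hsub
  have hl : LipschitzOnWith ⟨C, hC⟩ (Function.invFunOn f F) (f '' F) := by
    apply LipschitzOnWith.of_dist_le_mul
    rintro _ ⟨x, hx, rfl⟩ _ ⟨y, hy, rfl⟩
    rw [hinjF.leftInvOn_invFunOn hx, hinjF.leftInvOn_invFunOn hy, ← hd x (hsub hx) y (hsub hy)]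
    exact hmD _ _
  have h1 := hl.dimH_image_le
  rw [hinjF.leftInvOn_invFunOn.image_image] at h1
  refine h1.trans ((dimH_mono (subset_univ _)).trans ?_)
  rw [Real.dimH_univ_eq_finrank]
  simp

theorem dimH_edge_le {e : Set X} (he : e ∈ PC.edges) : dimH e ≤ 1 := by
  obtain ⟨f, L, hL, hf, rfl⟩ := PC.edge_geodesic e he
  have hl : LipschitzOnWith 1 f (Ioo 0 L) := by
    apply LipschitzOnWith.of_dist_le_mul
    intro x hx y hy
    rw [NNReal.coe_one, one_mul, Real.dist_eq,
      ← hf.2 x (Ioo_subset_Icc_self hx) y (Ioo_subset_Icc_self hy)]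
  refine hl.dimH_image_le.trans ((dimH_mono (subset_univ _)).trans ?_)
  rw [Real.dimH_univ]

theorem dimH_skeleton_le {K : Set X} (hK : IsCompact K) :
    dimH (K ∩ (⋃₀ PC.faces)ᶜ) ≤ 1 := by
  obtain ⟨h1, h2⟩ := PC.finite_of_isCompact hK
  have hsub : K ∩ (⋃₀ PC.faces)ᶜ ⊆
      (⋃₀ {c | c ∈ PC.edges ∧ (c ∩ K).Nonempty}) ∪ (PC.vertices ∩ K) := by
    rintro y ⟨hyK, hy⟩
    rcases PC.compl_faces_subset hy with ⟨e, he, hye⟩ | hy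
    · exact Or.inl ⟨e, ⟨he, y, hye, hyK⟩, hye⟩
    · exact Or.inr ⟨hy, hyK⟩
  refine (dimH_mono hsub).trans ?_
  have h3 : {c | c ∈ PC.edges ∧ (c ∩ K).Nonempty}.Finite :=
    h1.subset fun c hc => ⟨Or.inr hc.1, hc.2⟩
  rw [dimH_union, dimH_finite h2, dimH_sUnion h3.countable]
  refine max_le (iSup₂_le fun e he => PC.dimH_edge_le he.1) zero_le

theorem dimH_faces_le (hκ : κ ≤ 0) {K : Set X} (hK : IsCompact K) :
    dimH (⋃₀ {F | F ∈ PC.faces ∧ (F ∩ K).Nonempty}) ≤ 2 := by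
  obtain ⟨h1, -⟩ := PC.finite_of_isCompact hK
  have h3 : {c | c ∈ PC.faces ∧ (c ∩ K).Nonempty}.Finite :=
    h1.subset fun c hc => ⟨Or.inl hc.1, hc.2⟩
  rw [dimH_sUnion h3.countable]
  exact iSup₂_le fun F hF => PC.dimH_face_le hκ hF.1

end PolyComplex2

end Cat2Cx
end

open Set Metric Filter
noncomputable section
namespace Cat2Cx

/-! ### Logarithms of circle-valued maps -/

theorem circle_arg_continuousAt {z : Circle} (hz : z ≠ -1) :
    ContinuousAt (fun w : Circle => Complex.arg w) z := by
  refine (Complex.continuousAt_arg ?_).comp continuous_subtype_val.continuousAt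
  rw [Complex.mem_slitPlane_iff_not_le_zero, Complex.le_def]
  rintro ⟨h1, h2⟩
  apply hz
  have h3 := circle_re_sq_add_im_sq z
  simp only [Complex.zero_re, Complex.zero_im] at h1 h2
  rw [h2] at h3
  have : (z : ℂ).re = -1 := by nlinarith
  ext
  apply Complex.ext
  · simpa using this
  · simpa using h2

theorem continuous_arg_comp {Y : Type*} [TopologicalSpace Y] {f : Y → Circle}
    (hf : Continuous f) (h : ∀ y, f y ≠ -1) : Continuous fun y => Complex.arg (f y) :=
  continuous_iff_continuousAt.2 fun y =>
    (circle_arg_continuousAt (h y)).comp (f := f) hf.continuousAt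

theorem exists_log_homotopy {Y : Type*} [PseudoMetricSpace Y] [CompactSpace Y]
    {H : Y × unitInterval → Circle} (hH : Continuous H) :
    ∃ g : Y → ℝ, Continuous g ∧ (∀ y, H (y, 1) = H (y, 0) * Circle.exp (g y)) ∧
      (∀ y y', (∀ s, H (y, s) = H (y', s)) → g y = g y') ∧
      ∀ y, (∀ s, H (y, s) = H (y, 0)) → g y = 0 := by
  have hu := CompactSpace.uniformContinuous_of_continuous hH
  obtain ⟨δ, hδ, hd⟩ := Metric.uniformContinuous_iff.1 hu 2 two_pos
  obtain ⟨n, hn⟩ := exists_nat_one_div_lt hδ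
  set σ : ℕ → unitInterval := fun k => projIcc 0 1 zero_le_one ((k : ℝ) / (n + 1)) with hσ
  have hσd : ∀ k, dist (σ (k + 1)) (σ k) < δ := by
    intro k
    refine lt_of_le_of_lt ?_ hn
    have h1 := (LipschitzWith.projIcc (zero_le_one' ℝ)).dist_le_mul
      (((k + 1 : ℕ) : ℝ) / (n + 1)) ((k : ℝ) / (n + 1))
    refine h1.trans (le_of_eq ?_)
    rw [NNReal.coe_one, one_mul, Real.dist_eq, ← sub_div]
    push_cast
    rw [add_sub_cancel_left, abs_of_nonneg (by positivity)]
  have hne : ∀ k y, H (y, σ (k + 1)) / H (y, σ k) ≠ -1 := by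
    intro k y h
    have h1 := hd (a := (y, σ (k + 1))) (b := (y, σ k)) (by
      rw [Prod.dist_eq, dist_self]
      exact max_lt hδ (hσd k))
    rw [div_eq_iff_eq_mul] at h
    rw [h, neg_one_mul, dist_comm, circle_dist_neg] at h1
    exact lt_irrefl _ h1
  have hstep : ∀ (k : ℕ) (y : Y), H (y, σ k) = H (y, 0) * Circle.exp
      (∑ j ∈ Finset.range k, Complex.arg (H (y, σ (j + 1)) / H (y, σ j) : Circle)) := by
    intro k y
    induction k with
    | zero =>
      have : σ 0 = 0 := by simp [hσ]
      simp [this]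
    | succ k ih =>
      rw [Finset.sum_range_succ, Circle.exp_add, ← mul_assoc, ← ih, Circle.exp_arg,
        mul_div_cancel]
  refine ⟨fun y => ∑ j ∈ Finset.range (n + 1), Complex.arg (H (y, σ (j + 1)) / H (y, σ j) : Circle),
    ?_, ?_, ?_, ?_⟩
  · refine continuous_finsetSum _ fun j _ => ?_
    refine continuous_arg_comp ?_ (hne j)
    exact (hH.comp (by fun_prop)).div' (hH.comp (by fun_prop))
  · intro y
    have : σ (n + 1) = 1 := by
      have h0 : ((n + 1 : ℕ) : ℝ) / (n + 1) = 1 := by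
        push_cast
        exact div_self (by positivity)
      simp only [hσ, h0]
      exact projIcc_right _
    rw [← this]
    exact hstep (n + 1) y
  · intro y y' h
    simp only [h]
  · intro y h
    simp [h]

theorem exists_lift {f : unitInterval → Circle} (hf : Continuous f) :
    ∃ g : unitInterval → ℝ, Continuous g ∧ ∀ t, f t = Circle.exp (g t) := by
  obtain ⟨g, hg, h1, -, -⟩ := exists_log_homotopy
    (H := fun z : unitInterval × unitInterval => f (z.1 * z.2)) (by fun_prop)
  refine ⟨fun t => Complex.arg (f 0) + g t, by fun_prop, fun t => ?_⟩
  rw [Circle.exp_add, Circle.exp_arg]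
  simpa using h1 t

theorem lift_unique {g g' : unitInterval → ℝ} (hg : Continuous g) (hg' : Continuous g')
    (h : ∀ t, Circle.exp (g t) = Circle.exp (g' t)) (s t : unitInterval) :
    g s - g t = g' s - g' t := by
  have h1 : ∀ t, ∃ n : ℤ, g t = g' t + n * (2 * Real.pi) := fun t => Circle.exp_eq_exp.1 (h t)
  choose n hn using h1
  have hn' : ∀ t, (n t : ℝ) = (g t - g' t) / (2 * Real.pi) := by
    intro t
    rw [hn t]
    field_simp
    ring
  have hc : Continuous n := by
    rw [Int.isClosedEmbedding_coe_real.isInducing.continuous_iff]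
    have : (Int.cast ∘ n : unitInterval → ℝ) = fun t => (g t - g' t) / (2 * Real.pi) := by
      ext t
      exact hn' t
    rw [this]
    fun_prop
  have := PreconnectedSpace.constant inferInstance hc (x := s) (y := t)
  rw [hn s, hn t, this]
  ring

/-- A loop in the circle has a logarithm. -/
def HasLog (f : unitInterval → Circle) : Prop :=
  ∃ g : unitInterval → ℝ, Continuous g ∧ g 0 = g 1 ∧ ∀ t, f t = Circle.exp (g t)

namespace HasLog
variable {f f' : unitInterval → Circle}

theorem mul (h : HasLog f) (h' : HasLog f') : HasLog fun t => f t * f' t := by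
  obtain ⟨g, a, b, c⟩ := h
  obtain ⟨g', a', b', c'⟩ := h'
  refine ⟨fun t => g t + g' t, by fun_prop, by simp only [b, b'], fun t => ?_⟩
  simp only [Circle.exp_add, c, c']

theorem one : HasLog fun _ => 1 := ⟨fun _ => 0, continuous_const, rfl, by simp⟩

theorem zpow (h : HasLog f) (m : ℤ) : HasLog fun t => f t ^ m := by
  obtain ⟨g, a, b, c⟩ := h
  refine ⟨fun t => m * g t, by fun_prop, by simp only [b], fun t => ?_⟩
  simp only [c, ← zsmul_eq_mul, Circle.exp_zsmul]

theorem congr (h : HasLog f) (he : ∀ t, f' t = f t) : HasLog f' := by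
  have : f' = f := funext he
  rwa [this]

theorem prod {ι : Type*} (s : Finset ι) {F : ι → unitInterval → Circle}
    (h : ∀ i ∈ s, HasLog (F i)) : HasLog fun t => ∏ i ∈ s, F i t := by
  classical
  induction s using Finset.induction_on with
  | empty => simpa using HasLog.one
  | insert i s hi ih =>
    refine ((h i (Finset.mem_insert_self _ _)).mul
      (ih fun j hj => h j (Finset.mem_insert_of_mem hj))).congr fun t => ?_
    rw [Finset.prod_insert hi]

theorem of_ne_neg (h : HasLog f') (hf : Continuous f) (h01 : f 0 = f 1)
    (hne : ∀ t, f t ≠ -f' t) : HasLog f := by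
  obtain ⟨g, a, b, c⟩ := h
  have hf' : Continuous f' := by
    have : f' = fun t => Circle.exp (g t) := funext c
    rw [this]
    fun_prop
  refine ⟨fun t => g t + Complex.arg (f t / f' t : Circle), ?_, ?_, fun t => ?_⟩
  · refine a.add (continuous_arg_comp (hf.div' hf') fun t ht => hne t ?_)
    rw [div_eq_iff_eq_mul] at ht
    rw [ht, neg_one_mul]
  · simp only [b, h01, c]
  · rw [Circle.exp_add, ← c, Circle.exp_arg, mul_div_cancel]

theorem lift_eq (h : HasLog f) {g : unitInterval → ℝ} (hg : Continuous g)
    (he : ∀ t, f t = Circle.exp (g t)) : g 0 = g 1 := by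
  obtain ⟨g', a, b, c⟩ := h
  have := lift_unique hg a (fun t => by rw [← he, ← c]) 0 1
  rw [b, sub_self] at this
  linarith

end HasLog

theorem exists_degree {f : Circle → Circle} (hf : Continuous f) :
    ∃ (m : ℤ) (g : Circle → ℝ), Continuous g ∧ ∀ ζ, f ζ = ζ ^ m * Circle.exp (g ζ) := by
  set q : unitInterval → Circle := fun t => Circle.exp (2 * Real.pi * t) with hq
  have hqc : Continuous q := by fun_prop
  have hpi := Real.pi_pos
  have hqs : Function.Surjective q := by
    intro ζ
    obtain ⟨t, ht⟩ := Circle.exp_surjective ζ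
    have h1 : Int.fract (t / (2 * Real.pi)) ∈ unitInterval :=
      ⟨Int.fract_nonneg _, (Int.fract_lt_one _).le⟩
    refine ⟨⟨_, h1⟩, ?_⟩
    rw [← ht, hq]
    apply Circle.exp_eq_exp.2
    refine ⟨-⌊t / (2 * Real.pi)⌋, ?_⟩
    have h2 := Int.self_sub_floor (t / (2 * Real.pi))
    simp only
    rw [← h2]
    push_cast
    field_simp
    ring
  have hqq : Topology.IsQuotientMap q := hqc.isClosedMap.isQuotientMap hqc hqs
  have hq2 : ∀ s t, q s = q t → s = t ∨ (s = 0 ∧ t = 1) ∨ (s = 1 ∧ t = 0) := by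
    intro s t h
    obtain ⟨n, hn⟩ := Circle.exp_eq_exp.1 h
    have h1 : (s : ℝ) = t + n := by
      have : 2 * Real.pi * ((s : ℝ) - t - n) = 0 := by linarith
      rcases mul_eq_zero.1 this with h | h
      · linarith
      · linarith
    have hs := s.2
    have ht := t.2
    have h2 : n ≤ 1 := by
      have : (n : ℝ) ≤ 1 := by linarith [hs.2, ht.1]
      exact_mod_cast this
    have h3 : -1 ≤ n := by
      have : (-1 : ℝ) ≤ n := by linarith [hs.1, ht.2]
      exact_mod_cast this
    obtain rfl | rfl | rfl : n = -1 ∨ n = 0 ∨ n = 1 := by omega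
    · push_cast at h1
      refine Or.inr (Or.inl ⟨Subtype.ext ?_, Subtype.ext ?_⟩)
      · simp only [Set.Icc.coe_zero]; linarith [hs.1, ht.2]
      · simp only [Set.Icc.coe_one]; linarith [hs.1, ht.2]
    · left
      apply Subtype.ext
      simpa using h1
    · push_cast at h1
      refine Or.inr (Or.inr ⟨Subtype.ext ?_, Subtype.ext ?_⟩)
      · simp only [Set.Icc.coe_one]; linarith [hs.2, ht.1]
      · simp only [Set.Icc.coe_zero]; linarith [hs.2, ht.1]
  obtain ⟨g, hg, hfg⟩ := exists_lift (hf.comp hqc)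
  have h01 : q 1 = q 0 := by simp [hq]
  obtain ⟨m, hm⟩ : ∃ m : ℤ, g 1 = g 0 + m * (2 * Real.pi) := by
    apply Circle.exp_eq_exp.1
    rw [← hfg, ← hfg]
    simp only [Function.comp, h01]
  set h : unitInterval → ℝ := fun t => g t - m * (2 * Real.pi * t) with hh
  have hh01 : h 0 = h 1 := by
    simp only [hh, Set.Icc.coe_zero, Set.Icc.coe_one, hm]
    ring
  have hfib : ∀ s t, q s = q t → h s = h t := by
    intro s t hst
    rcases hq2 s t hst with rfl | ⟨rfl, rfl⟩ | ⟨rfl, rfl⟩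
    · rfl
    · exact hh01
    · exact hh01.symm
  have hinv : ∀ t, h (Function.surjInv hqs (q t)) = h t :=
    fun t => hfib _ _ (Function.surjInv_eq hqs _)
  refine ⟨m, fun ζ => h (Function.surjInv hqs ζ), ?_, ?_⟩
  · rw [hqq.continuous_iff]
    have : ((fun ζ => h (Function.surjInv hqs ζ)) ∘ q) = h := funext hinv
    rw [this]
    fun_prop
  · intro ζ
    obtain ⟨t, rfl⟩ := hqs ζ
    have h1 := hfg t
    simp only [Function.comp] at h1
    simp only [hinv]
    rw [h1, hq]
    simp only
    rw [← Circle.exp_zsmul, ← Circle.exp_add, zsmul_eq_mul]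
    congr 1
    simp only [hh]
    ring

variable {X : Type*} [MetricSpace X]

/-- Every circle-valued map on `S` has a logarithm along every loop of `S`. -/
def LogTrivial (S : Set X) : Prop :=
  ∀ f : X → Circle, ContinuousOn f S → ∀ γ : unitInterval → X, Continuous γ →
    (∀ t, γ t ∈ S) → γ 0 = γ 1 → HasLog fun t => f (γ t)

theorem Cat0.logTrivial_of_starShaped (hX : Cat0 X) {S : Set X} {o : X}
    (hS : ∀ y ∈ S, ∀ s, gd o y s ∈ S) : LogTrivial S := by
  intro f hf γ hγ hγS h01
  obtain ⟨L, hL⟩ : ∃ L, ∀ t, dist o (γ t) ≤ L := by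
    have : IsCompact (range fun t => dist o (γ t)) := isCompact_range (by fun_prop)
    obtain ⟨L, hL⟩ := this.bddAbove
    exact ⟨L, fun t => hL ⟨t, rfl⟩⟩
  obtain ⟨g, hg, h1, h2, -⟩ := exists_log_homotopy
    (H := fun z : unitInterval × unitInterval => f (gd o (γ z.1) (z.2 * L))) (by
      refine hf.comp_continuous ?_ fun z => hS _ (hγS _) _
      exact (hX.continuous_gd o).comp (g := fun z : X × ℝ => gd o z.1 z.2)
        (f := fun z : unitInterval × unitInterval => (γ z.1, (z.2 : ℝ) * L)) (by fun_prop))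
  refine ⟨fun t => Complex.arg (f o) + g t, by fun_prop, ?_, fun t => ?_⟩
  · simp only
    rw [h2 0 1 (fun s => by simp only [h01])]
  · have := h1 t
    simp only [Set.Icc.coe_one, one_mul, Set.Icc.coe_zero, zero_mul, hX.gd_zero] at this
    rw [hX.gd_of_le _ _ (hL t)] at this
    rw [Circle.exp_add, Circle.exp_arg]
    exact this

end Cat2Cx
end

open Set Metric Filter
noncomputable section
namespace Cat2Cx

/-! ### Cocycles on the fundamental groupoid -/

/-- A homotopy-invariant additive function on paths, with values in a commutative group. -/
structure PathCocycle (B : Type*) [TopologicalSpace B] (A : Type*) [CommGroup A] where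
  val : ∀ {x y : B}, Path x y → A
  val_homotopic : ∀ {x y : B} {p q : Path x y}, p.Homotopic q → val p = val q
  val_trans : ∀ {x y z : B} (p : Path x y) (q : Path y z), val (p.trans q) = val p * val q

namespace PathCocycle
variable {B : Type*} [TopologicalSpace B] {A : Type*} [CommGroup A] (c : PathCocycle B A)

theorem val_refl (x : B) : c.val (Path.refl x) = 1 := by
  have := c.val_trans (Path.refl x) (Path.refl x)
  rw [Path.refl_trans_refl] at this
  exact left_eq_mul.1 this

theorem val_map_eq {Z : Type*} [TopologicalSpace Z] [SimplyConnectedSpace Z] {m : Z → B}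
    (hm : Continuous m) {a b : Z} (p q : Path a b) : c.val (p.map hm) = c.val (q.map hm) :=
  c.val_homotopic ((SimplyConnectedSpace.paths_homotopic p q).map ⟨m, hm⟩)

theorem val_eq_one_of_loopClassH1 {x : B} {p : Path x x} (h : loopClassH1 p = 1) :
    c.val p = 1 := by
  let φ : FundamentalGroup B x →* A :=
    { toFun := fun a => Quotient.liftOn (s := Path.Homotopic.setoid x x) a c.val
        fun p q h => c.val_homotopic h
      map_one' := c.val_refl x
      map_mul' := by
        intro a b
        induction a using Quotient.inductionOn
        induction b using Quotient.inductionOn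
        rename_i a b
        exact (c.val_trans b a).trans (mul_comm _ _) }
  have h1 := congrArg (Abelianization.lift φ) h
  rw [loopClassH1, Abelianization.lift_apply_of, map_one] at h1
  exact h1

end PathCocycle

theorem loopClassH1_congr {B : Type*} [TopologicalSpace B] {x : B} {p q : Path x x}
    (h : p.Homotopic q) : loopClassH1 p = loopClassH1 q := by
  unfold loopClassH1
  congr 2
  exact Quotient.sound h

theorem loopClassH1_trans {B : Type*} [TopologicalSpace B] {x : B} (p q : Path x x) :
    loopClassH1 (p.trans q) = loopClassH1 p * loopClassH1 q := by
  rw [mul_comm]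
  exact map_mul Abelianization.of (FundamentalGroup.fromPath (X := TopCat.of B) ⟦q⟧)
    (FundamentalGroup.fromPath (X := TopCat.of B) ⟦p⟧)

theorem loopClassH1_symm {B : Type*} [TopologicalSpace B] {x : B} (p : Path x x) :
    loopClassH1 p.symm = (loopClassH1 p)⁻¹ :=
  map_inv Abelianization.of (FundamentalGroup.fromPath (X := TopCat.of B) ⟦p⟧)

open Classical in
/-- The universal cocycle, relative to a base point. -/
def univCocycle {B : Type*} [TopologicalSpace B] (x : B) :
    PathCocycle B (Abelianization (FundamentalGroup B x)) where
  val {y z} p := if h : Joined x y then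
      loopClassH1 ((h.somePath.trans p).trans (h.trans ⟨p⟩).somePath.symm) else 1
  val_homotopic := by
    intro y z p q h
    by_cases hj : Joined x y
    · simp only [hj, dite_true]
      exact loopClassH1_congr (((Path.Homotopic.refl _).hcomp h).hcomp (Path.Homotopic.refl _))
    · simp only [hj, dite_false]
  val_trans := by
    intro y z w p q
    by_cases hj : Joined x y
    · have hz : Joined x z := hj.trans ⟨p⟩
      simp only [hj, hz, dite_true]
      rw [← loopClassH1_trans]
      apply loopClassH1_congr
      rw [← Path.Homotopic.Quotient.eq]
      simp only [Path.Homotopic.Quotient.mk_trans, Path.Homotopic.Quotient.mk_symm,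
        Path.Homotopic.Quotient.trans_assoc]
      congr 2
      rw [← Path.Homotopic.Quotient.trans_assoc
        (Path.Homotopic.Quotient.symm _) (Path.Homotopic.Quotient.mk _),
        Path.Homotopic.Quotient.symm_trans, Path.Homotopic.Quotient.refl_trans]
    · have hz : ¬ Joined x z := fun h => hj (h.trans ⟨p.symm⟩)
      simp only [hj, hz, dite_false, mul_one]

theorem loopClassH1_eq_one {B : Type*} [TopologicalSpace B] {x : B} {p : Path x x}
    (h : (univCocycle x).val p = 1) : loopClassH1 p = 1 := by
  have hj : Joined x x := Joined.refl x
  have h1 : (univCocycle x).val p = loopClassH1 ((hj.somePath.trans p).trans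
    hj.somePath.symm) := dif_pos hj
  rw [h, loopClassH1_trans, loopClassH1_trans, loopClassH1_symm, mul_comm, inv_mul_cancel_left]
    at h1
  exact h1.symm

open Classical in
/-- The change of the logarithm of a circle-valued map along a path. -/
def logDiff (f : unitInterval → Circle) : ℝ :=
  if h : Continuous f then (exists_lift h).choose 1 - (exists_lift h).choose 0 else 0

theorem logDiff_eq {f : unitInterval → Circle} {g : unitInterval → ℝ} (hg : Continuous g)
    (he : ∀ t, f t = Circle.exp (g t)) : logDiff f = g 1 - g 0 := by
  have hf : Continuous f := by
    have : f = fun t => Circle.exp (g t) := funext he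
    rw [this]
    fun_prop
  unfold logDiff
  rw [dif_pos hf]
  have := (exists_lift hf).choose_spec
  exact lift_unique this.1 hg (fun t => by rw [← he, ← this.2]) 1 0

/-- The cocycle measuring the change of logarithm of a circle-valued map. -/
def logCocycle {B : Type*} [TopologicalSpace B] {f : B → Circle} (hf : Continuous f) :
    PathCocycle B (Multiplicative ℝ) where
  val p := Multiplicative.ofAdd (logDiff fun t => f (p t))
  val_homotopic := by
    rintro x y p q ⟨F⟩
    obtain ⟨k, hk, h1, -, h2⟩ := exists_log_homotopy
      (H := fun z : unitInterval × unitInterval => f (F (z.2, z.1))) (by fun_prop)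
    obtain ⟨g, hg, hg'⟩ := exists_lift (f := fun t => f (p t)) (by fun_prop)
    refine congrArg Multiplicative.ofAdd ?_
    rw [logDiff_eq hg hg', logDiff_eq (hg.add hk)]
    · rw [Pi.add_apply, Pi.add_apply, h2 0 (by simp), h2 1 (by simp)]
      ring
    · intro t
      have := h1 t
      simp only [F.apply_one, F.apply_zero] at this
      rw [Pi.add_apply, Circle.exp_add, ← hg']
      exact this
  val_trans := by
    intro x y z p q
    obtain ⟨g, hg, hg'⟩ := exists_lift (f := fun t => f (p t)) (by fun_prop)
    obtain ⟨k, hk, hk'⟩ := exists_lift (f := fun t => f (q t)) (by fun_prop)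
    let P : Path (g 0) (g 1) := ⟨⟨g, hg⟩, rfl, rfl⟩
    let Q : Path (g 1) (g 1 + (k 1 - k 0)) := ⟨⟨fun t => g 1 + (k t - k 0), by fun_prop⟩,
      by simp, by simp⟩
    rw [← ofAdd_add]
    refine congrArg Multiplicative.ofAdd ?_
    rw [logDiff_eq hg hg', logDiff_eq hk hk', logDiff_eq (P.trans Q).continuous]
    · simp only [Path.source, Path.target]
      ring
    · intro t
      rw [Path.trans_apply, Path.trans_apply]
      split_ifs with h
      · exact hg' _
      · refine (hk' _).trans ?_
        change _ = Circle.exp (g 1 + (k _ - k 0))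
        have h1 : Circle.exp (g 1) = Circle.exp (k 0) := by rw [← hg', ← hk']; simp
        rw [Circle.exp_add, Circle.exp_sub, h1, mul_div_cancel]

variable {X : Type*} [MetricSpace X]

theorem H1Trivial.logTrivial {E : Set X} (h : H1Trivial ↥E) : LogTrivial E := by
  intro f hf γ hγ hγE h01
  let p : Path (⟨γ 0, hγE 0⟩ : E) ⟨γ 0, hγE 0⟩ :=
    { toFun := fun t => ⟨γ t, hγE t⟩
      continuous_toFun := by fun_prop
      source' := rfl
      target' := by simp [h01] }
  have hfE : Continuous fun y : E => f y := continuousOn_iff_continuous_domRestrict.1 hf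
  have h1 := (logCocycle hfE).val_eq_one_of_loopClassH1 (h _ p)
  obtain ⟨g, hg, hg'⟩ := exists_lift (f := fun t => f (γ t)) (hf.comp_continuous hγ hγE)
  have h2 : logDiff (fun t => f (γ t)) = 0 := h1
  rw [logDiff_eq hg hg'] at h2
  exact ⟨g, hg, by linarith, hg'⟩

end Cat2Cx
end

open Set Metric Filter
noncomputable section
namespace Cat2Cx

variable {X : Type*} [MetricSpace X]

/-! ### Cones -/

/-- The union of the geodesics from `o` to the points of `S`. -/
def cone (o : X) (S : Set X) : Set X := {z | ∃ y ∈ S, ∃ s, z = gd o y s}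

theorem Cat0.subset_cone (hX : Cat0 X) (o : X) (S : Set X) : S ⊆ cone o S :=
  fun y hy => ⟨y, hy, dist o y, (hX.gd_dist o y).symm⟩

theorem Cat0.gd_mem_cone (hX : Cat0 X) {o : X} {S : Set X} :
    ∀ y ∈ cone o S, ∀ s, gd o y s ∈ cone o S := by
  rintro _ ⟨y, hy, t, rfl⟩ s
  exact ⟨y, hy, _, hX.gd_gd _ _ _ _⟩

theorem Cat0.logTrivial_cone (hX : Cat0 X) (o : X) (S : Set X) : LogTrivial (cone o S) :=
  hX.logTrivial_of_starShaped hX.gd_mem_cone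

theorem Cat0.isCompact_cone (hX : Cat0 X) (o : X) {S : Set X} (hS : IsCompact S) :
    IsCompact (cone o S) := by
  obtain ⟨L, hL⟩ : ∃ L, ∀ y ∈ S, dist o y ≤ L := by
    have : IsCompact ((fun y => dist o y) '' S) := hS.image (by fun_prop)
    obtain ⟨L, hL⟩ := this.bddAbove
    exact ⟨L, fun y hy => hL ⟨y, hy, rfl⟩⟩
  have : cone o S = (fun z : X × ℝ => gd o z.1 z.2) '' (S ×ˢ Icc 0 L) := by
    ext z
    constructor
    · rintro ⟨y, hy, s, rfl⟩
      refine ⟨(y, max 0 (min s (dist o y))), ⟨hy, le_max_left _ _, ?_⟩, ?_⟩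
      · exact max_le (dist_nonneg.trans (hL y hy)) ((min_le_right _ _).trans (hL y hy))
      · simp only
        rcases le_total s 0 with h | h
        · rw [hX.gd_of_nonpos o y h, max_eq_left ((min_le_left _ _).trans h), hX.gd_zero]
        · rw [max_eq_right (le_min h dist_nonneg)]
          rcases le_total s (dist o y) with h' | h'
          · rw [min_eq_left h']
          · rw [min_eq_right h', hX.gd_dist, hX.gd_of_le _ _ h']
    · rintro ⟨⟨y, s⟩, ⟨hy, -⟩, rfl⟩
      exact ⟨y, hy, s, rfl⟩
  rw [this]
  exact (hS.prod isCompact_Icc).image (hX.continuous_gd o)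

/-! ### Removing singular discs -/

theorem continuousAt_ite_of_eq {Y Z : Type*} [TopologicalSpace Y] [TopologicalSpace Z]
    {p : Y → Prop} [DecidablePred p] {f g : Y → Z} {y : Y} (hf : ContinuousAt f y) (hg : ContinuousAt g y)
    (h : f y = g y) : ContinuousAt (fun z => if p z then f z else g z) y := by
  have hy : (if p y then f y else g y) = f y := by split_ifs <;> simp [h]
  rw [ContinuousAt, ← h] at hg
  unfold ContinuousAt
  simp only [hy]
  rw [tendsto_def] at hg ⊢
  intro U hU
  have h1 := hg U hU
  have h2 := hf.preimage_mem_nhds hU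
  refine mem_of_superset (inter_mem h1 h2) fun z hz => ?_
  by_cases hp : p z
  · simpa [hp] using hz.2
  · simpa [hp] using hz.1

open Classical in
theorem FlatAt.exists_peel (hX : Cat0 X) {w : X} {R s : ℝ} {P : Circle → ℝ → X}
    (hw : FlatAt w R P) (hs : 0 < s) (hsR : s ≤ R) {C : Set X} (hC : IsClosed C)
    (hsC : ∀ y, dist w y = s → y ∉ C) {f : X → Circle} (hf : ContinuousOn f Cᶜ) :
    ∃ (m : ℤ) (f' : X → Circle), ContinuousOn f' (C \ ball w s)ᶜ ∧
      ∀ y ∉ ball w s, f' y = f y * dir w R P y ^ (-m) := by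
  have hF0 : Continuous fun ζ => f (P ζ s) :=
    hf.comp_continuous (hw.continuous_polar hs.le hsR)
      fun ζ => hsC _ (hw.dist_center ζ s hs.le hsR)
  obtain ⟨m, g, hg, hmg⟩ := exists_degree hF0
  refine ⟨m, fun y => if dist w y < s then Circle.exp (dist w y / s * g (dir w R P y)) else
    f y * dir w R P y ^ (-m), ?_, ?_⟩
  swap
  · intro y hy
    rw [mem_ball, dist_comm] at hy
    simp only [hy, if_false]
  have hdir : ∀ y, y ≠ w → ContinuousAt (dir w R P) y := fun y hy =>
    (hw.continuousOn_dir hX).continuousAt (isOpen_compl_singleton.mem_nhds hy)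
  have hin : ∀ y, ContinuousAt (fun y => Circle.exp (dist w y / s * g (dir w R P y))) y := by
    intro y
    refine Circle.exp.continuous.continuousAt.comp
      (f := fun y => dist w y / s * g (dir w R P y)) ?_
    by_cases hy : y = w
    · subst hy
      obtain ⟨M, hM⟩ := (isCompact_range hg).isBounded.exists_norm_le
      have h0 : dist y y / s * g (dir y R P y) = 0 := by simp
      unfold ContinuousAt
      simp only [h0]
      refine squeeze_zero_norm (a := fun z => dist y z / s * M) (fun z => ?_) ?_
      · rw [norm_mul, Real.norm_of_nonneg (by positivity)]
        exact mul_le_mul_of_nonneg_left (hM _ ⟨_, rfl⟩) (by positivity)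
      · have : Continuous fun z => dist y z / s * M := by fun_prop
        have := this.tendsto y
        simpa using this
    · have h1 := hg.continuousAt.comp (hdir y hy)
      have h2 : ContinuousAt (fun y => dist w y / s) y := by fun_prop
      exact h2.mul h1
  have hout : ∀ y, y ∉ C → y ≠ w → ContinuousAt (fun y => f y * dir w R P y ^ (-m)) y := by
    intro y hyC hyw
    exact (hf.continuousAt (hC.isOpen_compl.mem_nhds hyC)).mul ((hdir y hyw).zpow _)
  intro y hy
  apply ContinuousAt.continuousWithinAt
  have hyC : s ≤ dist w y → y ∉ C := by
    intro h hC
    refine hy ⟨hC, ?_⟩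
    rw [mem_ball, dist_comm]
    exact h.not_gt
  rcases lt_trichotomy (dist w y) s with h | h | h
  · refine (hin y).congr ?_
    have : ∀ᶠ z in nhds y, dist w z < s :=
      (continuous_const.dist continuous_id).continuousAt.eventually_lt_const h
    filter_upwards [this] with z hz
    rw [if_pos hz]
  · have hyw : y ≠ w := by
      rintro rfl
      rw [dist_self] at h
      exact hs.ne h
    refine continuousAt_ite_of_eq (hin y) (hout y (hyC h.ge) hyw) ?_
    have h1 := hw.dir_spec hX y hs.le hsR h.ge
    rw [hX.gd_of_le _ _ h.le] at h1
    have h2 := hmg (dir w R P y)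
    rw [← h1] at h2
    rw [h2, h, div_self hs.ne', one_mul, mul_comm, ← mul_assoc, zpow_neg, inv_mul_cancel, one_mul]
  · have hyw : y ≠ w := by
      rintro rfl
      rw [dist_self] at h
      exact hs.not_gt h
    refine (hout y (hyC h.le) hyw).congr ?_
    have : ∀ᶠ z in nhds y, s < dist w z :=
      (continuous_const.dist continuous_id).continuousAt.eventually_const_lt h
    filter_upwards [this] with z hz
    rw [if_neg hz.not_gt]

theorem exists_peel_finset (hX : Cat0 X) {γ : unitInterval → X} {ι : Type*}
    (S : Finset ι) {w : ι → X} {R s : ι → ℝ} {P : ι → Circle → ℝ → X}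
    (hw : ∀ i ∈ S, FlatAt (w i) (R i) (P i)) (hs : ∀ i ∈ S, 0 < s i ∧ s i ≤ R i)
    (hγ : ∀ i ∈ S, ∀ t, s i ≤ dist (w i) (γ t))
    (hlog : ∀ i ∈ S, HasLog fun t => dir (w i) (R i) (P i) (γ t))
    {C : Set X} (hC : IsClosed C) (hsC : ∀ i ∈ S, ∀ y, dist (w i) y = s i → y ∉ C)
    {f : X → Circle} (hf : ContinuousOn f Cᶜ) :
    ∃ f' : X → Circle, ContinuousOn f' (C \ ⋃ i ∈ S, ball (w i) (s i))ᶜ ∧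
      ((HasLog fun t => f' (γ t)) → HasLog fun t => f (γ t)) := by
  classical
  induction S using Finset.induction_on with
  | empty => exact ⟨f, by simpa using hf, id⟩
  | insert i S hi ih =>
    obtain ⟨f₁, h1, h2⟩ := ih (fun j hj => hw j (Finset.mem_insert_of_mem hj))
      (fun j hj => hs j (Finset.mem_insert_of_mem hj))
      (fun j hj => hγ j (Finset.mem_insert_of_mem hj))
      (fun j hj => hlog j (Finset.mem_insert_of_mem hj))
      (fun j hj => hsC j (Finset.mem_insert_of_mem hj))
    have hm := Finset.mem_insert_self i S
    have hC' : IsClosed (C \ ⋃ i ∈ S, ball (w i) (s i)) :=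
      hC.sdiff (isOpen_biUnion fun _ _ => isOpen_ball)
    obtain ⟨m, f', h3, h4⟩ := (hw i hm).exists_peel hX (hs i hm).1 (hs i hm).2 hC'
      (fun y hy h => hsC i hm y hy h.1) h1
    refine ⟨f', ?_, fun h => h2 ?_⟩
    · rw [Finset.set_biUnion_insert, union_comm, ← sdiff_sdiff]
      exact h3
    · refine (h.mul ((hlog i hm).zpow m)).congr fun t => ?_
      rw [h4 (γ t) (by rw [mem_ball, dist_comm]; exact (hγ i hm t).not_gt), mul_assoc, zpow_neg,
        inv_mul_cancel, mul_one]

end Cat2Cx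
end

open Set Metric Filter
noncomputable section
namespace Cat2Cx

variable {X : Type*} [MetricSpace X]

theorem exists_countable_dense {K : Set X} (hK : IsCompact K) :
    ∃ D : Set X, D.Countable ∧ K ⊆ closure D := hK.isSeparable

theorem PolyComplex2.exists_disc {κ : ℝ} (hκ : κ ≤ 0) (PC : PolyComplex2 κ X) {K D U W : Set X}
    (hD : K ⊆ closure D)
    (hW : ∀ c ∈ D, ∀ᵐ s : ℝ, ∀ y ∈ ⋃₀ {F | F ∈ PC.faces ∧ (F ∩ K).Nonempty}, y ∈ W → dist c y ≠ s)
    {w : X} (hwK : w ∈ K) (hw : w ∈ ⋃₀ PC.faces) (hU : IsOpen U) (hwU : w ∈ U) :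
    ∃ c R P s, FlatAt c R P ∧ 0 < s ∧ s ≤ R ∧ dist c w < s ∧ closedBall c s ⊆ U ∧
      ∀ y, dist c y = s → y ∉ W := by
  obtain ⟨F, hF, hwF⟩ := hw
  obtain ⟨s₀, hs₀, hflat⟩ := PC.exists_flatAt hκ hF hwF
  obtain ⟨δ, hδ, hball⟩ := Metric.isOpen_iff.1 (hU.inter (PC.faces_open F hF)) w ⟨hwU, hwF⟩
  set ρ := min s₀ δ / 4 with hρ
  have h1 : 4 * ρ ≤ s₀ := by rw [hρ]; linarith [min_le_left s₀ δ]
  have h2 : 4 * ρ ≤ δ := by rw [hρ]; linarith [min_le_right s₀ δ]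
  have h0 : 0 < ρ := by rw [hρ]; have := lt_min hs₀ hδ; positivity
  obtain ⟨c, hcD, hc⟩ := Metric.mem_closure_iff.1 (hD hwK) ρ h0
  obtain ⟨s, hs, hs'⟩ := exists_mem_Ioo_of_ae (hW c hcD) (show ρ < 2 * ρ by linarith)
  obtain ⟨P, hP⟩ := hflat c (by rw [mem_ball, dist_comm]; linarith)
  have hsub : closedBall c s ⊆ U ∩ F := by
    intro y hy
    apply hball
    rw [mem_closedBall] at hy
    rw [mem_ball]
    have := dist_triangle y c w
    rw [dist_comm c w] at this
    linarith [hs.2]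
  refine ⟨c, s₀, P, s, hP, h0.trans hs.1, by linarith [hs.2], by rw [dist_comm]; linarith [hs.1],
    hsub.trans inter_subset_left, fun y hy hyW => hs' y ⟨F, ⟨hF, w, hwF, hwK⟩, ?_⟩ hyW hy⟩
  exact (hsub (by rw [mem_closedBall, dist_comm, hy])).2

/-- Clamping to the unit interval. -/
def clampUnit (x : ℝ) : ℝ := max 0 (min x 1)

theorem continuous_clampUnit : Continuous clampUnit := by unfold clampUnit; fun_prop

theorem clampUnit_of_nonpos {x : ℝ} (h : x ≤ 0) : clampUnit x = 0 := by
  unfold clampUnit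
  rw [min_eq_left (by linarith), max_eq_left h]

theorem clampUnit_of_one_le {x : ℝ} (h : 1 ≤ x) : clampUnit x = 1 := by
  unfold clampUnit
  rw [min_eq_right h, max_eq_right zero_le_one]

open Classical in
/-- A loop with a subarc from `x` to `y ≠ x` that the rest of the loop does not meet has nonzero
winding number around some flat point. -/
theorem exists_flatAt_not_hasLog {κ : ℝ} (hκ : κ ≤ 0) (PC : PolyComplex2 κ X) (hX : Cat0 X)
    {γ : unitInterval → X} (hγ : Continuous γ) (h01 : γ 0 = γ 1) {t₁ t₂ : unitInterval}
    (ht : t₁ ≤ t₂) (hne : γ t₁ ≠ γ t₂)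
    (hsep : ∀ t, t ∉ Icc t₁ t₂ → ∀ t' ∈ Icc t₁ t₂, γ t ≠ γ t') :
    ∃ u R P, FlatAt u R P ∧ (∀ t, γ t ≠ u) ∧ ¬ HasLog fun t => dir u R P (γ t) := by
  by_contra hcon
  push Not at hcon
  set A := γ '' Icc t₁ t₂ with hA
  have hAc : IsCompact A := isCompact_Icc.image hγ
  have hAn : A.Nonempty := ⟨γ t₁, t₁, left_mem_Icc.2 ht, rfl⟩
  set π : X → ℝ := fun y => dist (γ t₁) y with hπ
  have hπc : Continuous π := by fun_prop
  have hπl : LipschitzWith 1 π := LipschitzWith.dist_right _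
  set h : X → ℝ := fun y => infDist y A with hh
  have hhl : LipschitzWith 1 h := lipschitz_infDist_pt _
  have hhc : Continuous h := hhl.continuous
  have hh0 : ∀ t ∈ Icc t₁ t₂, h (γ t) = 0 := fun t ht => infDist_zero_of_mem ⟨t, ht, rfl⟩
  set M := π (γ t₂) with hM
  have hM0 : 0 < M := dist_pos.2 hne
  have hπ1 : π (γ t₁) = 0 := dist_self _
  obtain ⟨r₀, hr₀, hr₀'⟩ : ∃ r₀ > 0, ∀ t, t ∉ Icc t₁ t₂ →
      ((t ≤ t₁ ∧ M / 3 ≤ π (γ t)) ∨ (t₂ ≤ t ∧ π (γ t) ≤ 2 * M / 3)) → r₀ ≤ h (γ t) := by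
    have hB : IsClosed {t : unitInterval |
        (t ≤ t₁ ∧ M / 3 ≤ π (γ t)) ∨ (t₂ ≤ t ∧ π (γ t) ≤ 2 * M / 3)} := by
      refine IsClosed.union (IsClosed.inter isClosed_Iic ?_) (IsClosed.inter isClosed_Ici ?_)
      · exact isClosed_le continuous_const (hπc.comp hγ)
      · exact isClosed_le (hπc.comp hγ) continuous_const
    obtain ⟨r₀, h1, h2⟩ := hB.isCompact.exists_forall_le' (f := fun t => h (γ t)) (a := 0)
      (hhc.comp hγ).continuousOn (fun t ht => by
        refine (hAc.isClosed.notMem_iff_infDist_pos hAn).1 ?_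
        rintro ⟨t', ht', he⟩
        have hn : t ∉ Icc t₁ t₂ := by
          rintro ⟨h1, h2⟩
          rcases ht with h | h
          · have : t = t₁ := le_antisymm h.1 h1
            rw [this, hπ1] at h
            linarith [h.2]
          · have : t = t₂ := le_antisymm h2 h.1
            rw [this] at h
            linarith [h.2]
        exact hsep t hn t' ht' he.symm)
    exact ⟨r₀, h1, fun t _ ht => h2 t ht⟩
  have hγc : IsCompact (range γ) := isCompact_range hγ
  set K := cone (γ 0) (range γ) with hK
  have hKc : IsCompact K := hX.isCompact_cone _ hγc
  obtain ⟨D, hDc, hD⟩ := exists_countable_dense hKc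
  have hgen1 := ae_ae_not_mem_of_dimH_le_one (PC.dimH_skeleton_le hKc) hπl.lipschitzOnWith
    hhl.lipschitzOnWith
  have hgen2 : ∀ᵐ a : ℝ, ∀ c ∈ D, ∀ᵐ b : ℝ, ∀ᵐ s : ℝ,
      ∀ y ∈ ⋃₀ {F | F ∈ PC.faces ∧ (F ∩ K).Nonempty}, π y = a → h y = b → dist c y ≠ s := by
    rw [MeasureTheory.ae_ball_iff hDc]
    intro c _
    exact ae_ae_ae_not_mem_of_dimH_le_two (PC.dimH_faces_le hκ hKc) hπl.lipschitzOnWith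
      hhl.lipschitzOnWith (LipschitzWith.dist_right c).lipschitzOnWith
  obtain ⟨τ, ⟨hτ1, hτ2⟩, hτ3, hτ4⟩ := exists_mem_Ioo_of_ae (hgen1.and hgen2)
    (show M / 3 < 2 * M / 3 by linarith)
  rw [← MeasureTheory.ae_ball_iff hDc] at hτ4
  obtain ⟨r, ⟨hr1, hr2⟩, hr3, hr4⟩ := exists_mem_Ioo_of_ae (hτ3.and hτ4) hr₀
  set W := {y | π y = τ ∧ h y = r} with hW
  have hWγ : ∀ t, γ t ∉ W := by
    rintro t ⟨h1, h2⟩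
    by_cases htI : t ∈ Icc t₁ t₂
    · rw [hh0 t htI] at h2
      exact hr1.ne h2
    · have : t < t₁ ∨ t₂ < t := by
        by_contra! hc
        exact htI hc
      have := hr₀' t htI (this.imp (fun h => ⟨h.le, by linarith⟩) fun h => ⟨h.le, by linarith⟩)
      linarith
  have hWcl : IsClosed W := (isClosed_eq hπc continuous_const).inter
    (isClosed_eq hhc continuous_const)
  have hdisc : ∀ w ∈ K ∩ W, ∃ c R P s, FlatAt c R P ∧ 0 < s ∧ s ≤ R ∧ dist c w < s ∧
      closedBall c s ⊆ (range γ)ᶜ ∧ ∀ y, dist c y = s → y ∉ W := by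
    rintro w ⟨hwK, hwW⟩
    refine PC.exists_disc hκ hD (fun c hc => ?_) hwK ?_ hγc.isClosed.isOpen_compl ?_
    · filter_upwards [hr4 c hc] with s hs y hy hyW
      exact hs y hy hyW.1 hyW.2
    · by_contra hn
      exact hr3 w ⟨hwK, hn⟩ hwW.1 hwW.2
    · rintro ⟨t, rfl⟩
      exact hWγ t hwW
  choose! c R P s hflat hs hsR hcw hball hsW using hdisc
  obtain ⟨S, hSW, hScov⟩ := (hKc.inter_right hWcl).elim_nhds_subcover
    (fun w => ball (c w) (s w)) (fun w hw => isOpen_ball.mem_nhds (by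
      rw [mem_ball, dist_comm]; exact hcw w hw))
  have hQ : IsCompact ((K \ ⋃ w ∈ S, ball (c w) (s w)) ∪ ⋃ w ∈ S, {y | dist (c w) y = s w}) := by
    refine (hKc.diff (isOpen_biUnion fun _ _ => isOpen_ball)).union ?_
    exact S.isCompact_biUnion fun w hw =>
      (hflat w (hSW w hw)).isCompact_sphere (hs w (hSW w hw)).le (hsR w (hSW w hw))
  have hQW : ∀ y ∈ (K \ ⋃ w ∈ S, ball (c w) (s w)) ∪ ⋃ w ∈ S, {y | dist (c w) y = s w},
      y ∉ W := by
    rintro y (⟨h1, h2⟩ | h1) hyW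
    · exact h2 (hScov ⟨h1, hyW⟩)
    · simp only [mem_iUnion] at h1
      obtain ⟨w, hw, h1⟩ := h1
      exact hsW w (hSW w hw) y h1 hyW
  obtain ⟨ε₀, hε₀, hε₁⟩ := (hQ.inter_right (isClosed_eq hhc
    (continuous_const (y := r)))).exists_forall_le' (f := fun y => |π y - τ|) (a := 0)
    (by fun_prop) (by
      rintro y ⟨hy, hyr⟩
      rw [abs_pos, sub_ne_zero]
      exact fun he => hQW y hy ⟨he, hyr⟩)
  set ε := min ε₀ (min (τ - M / 3) (2 * M / 3 - τ)) with hε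
  have hε0 : 0 < ε := lt_min hε₀ (lt_min (by linarith) (by linarith))
  have hεa : ε ≤ ε₀ := min_le_left _ _
  have hεb : ε ≤ τ - M / 3 := (min_le_right _ _).trans (min_le_left _ _)
  have hεc : ε ≤ 2 * M / 3 - τ := (min_le_right _ _).trans (min_le_right _ _)
  have hlow : ∀ x, x ≤ τ - ε / 2 → clampUnit ((x - τ) / ε + 1 / 2) = 0 := by
    intro x hx
    apply clampUnit_of_nonpos
    have : (x - τ) / ε ≤ -(1 / 2) := by rw [div_le_iff₀ hε0]; linarith
    linarith
  have hhigh : ∀ x, τ + ε / 2 ≤ x → clampUnit ((x - τ) / ε + 1 / 2) = 1 := by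
    intro x hx
    apply clampUnit_of_one_le
    have : 1 / 2 ≤ (x - τ) / ε := by rw [le_div_iff₀ hε0]; linarith
    linarith
  set f₀ : X → ℝ := fun y => 2 * Real.pi * clampUnit ((π y - τ) / ε + 1 / 2) with hf₀
  have hf₀c : Continuous f₀ := by
    have := continuous_clampUnit
    fun_prop
  have hf₀1 : ∀ y, ε / 2 ≤ |π y - τ| → Circle.exp (f₀ y) = 1 := by
    intro y hy
    rw [hf₀]
    rcases le_abs.1 hy with h1 | h1
    · simp only
      rw [hhigh _ (by linarith), mul_one, Circle.exp_two_pi]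
    · simp only
      rw [hlow _ (by linarith), mul_zero, Circle.exp_zero]
  set f : X → Circle := fun y => if h y < r then Circle.exp (f₀ y) else 1 with hf
  set C := {y | h y = r ∧ |π y - τ| ≤ ε / 2} with hC
  have hCcl : IsClosed C := (isClosed_eq hhc continuous_const).inter
    (isClosed_le (f := fun y => |π y - τ|) (by fun_prop) continuous_const)
  have hfc : ContinuousOn f Cᶜ := by
    intro y hy
    apply ContinuousAt.continuousWithinAt
    have hexp : ContinuousAt (fun y => Circle.exp (f₀ y)) y :=
      (Circle.exp.continuous.comp hf₀c).continuousAt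
    rcases lt_trichotomy (h y) r with h1 | h1 | h1
    · refine hexp.congr ?_
      filter_upwards [hhc.continuousAt.eventually_lt_const h1] with z hz
      exact (if_pos hz).symm
    · refine continuousAt_ite_of_eq hexp continuousAt_const (hf₀1 y ?_)
      by_contra! hc
      exact hy ⟨h1, hc.le⟩
    · refine (continuousAt_const (y := (1 : Circle))).congr ?_
      filter_upwards [hhc.continuousAt.eventually_const_lt h1] with z hz
      exact (if_neg (not_lt.2 hz.le)).symm
  obtain ⟨f', hf'c, hf'⟩ := exists_peel_finset hX (γ := γ) S (w := c) (R := R) (s := s) (P := P)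
    (fun w hw => hflat w (hSW w hw)) (fun w hw => ⟨hs w (hSW w hw), hsR w (hSW w hw)⟩)
    (fun w hw t => by
      by_contra! hc
      exact hball w (hSW w hw) (by rw [mem_closedBall, dist_comm]; exact hc.le) ⟨t, rfl⟩)
    (fun w hw => hcon _ _ _ (hflat w (hSW w hw)) fun t he =>
      hball w (hSW w hw) (by
        rw [mem_closedBall, he, dist_self]; exact (hs w (hSW w hw)).le) ⟨t, rfl⟩)
    hCcl (fun w hw y hy hyC => by
      have hm : y ∈ ⋃ w ∈ S, {y | dist (c w) y = s w} := by
        simp only [mem_iUnion]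
        exact ⟨w, hw, hy⟩
      have h1 := hε₁ y ⟨Or.inr hm, hyC.1⟩
      have h2 : |π y - τ| ≤ ε / 2 := hyC.2
      linarith) hfc
  have hlog : HasLog fun t => f (γ t) := by
    refine hf' (hX.logTrivial_cone (γ 0) (range γ) f' (hf'c.mono ?_) γ hγ
      (fun t => hX.subset_cone _ _ ⟨t, rfl⟩) h01)
    rintro y hyK ⟨hyC, hyb⟩
    have h1 := hε₁ y ⟨Or.inl ⟨hyK, hyb⟩, hyC.1⟩
    have h2 : |π y - τ| ≤ ε / 2 := hyC.2
    linarith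
  have hgl := hlog.lift_eq (g := fun t => f₀ (γ (max t₁ (min t t₂)))) (by fun_prop) (fun t => by
    by_cases htI : t ∈ Icc t₁ t₂
    · rw [min_eq_left htI.2, max_eq_right htI.1]
      exact if_pos (by rw [hh0 t htI]; exact hr1)
    · have hor : t < t₁ ∨ t₂ < t := by
        by_contra! hc
        exact htI hc
      have h1 : f (γ t) = 1 := by
        by_cases hlt : h (γ t) < r
        · rw [hf]
          simp only [if_pos hlt]
          apply hf₀1
          rcases hor with h1 | h1
          · have : π (γ t) < M / 3 := by
              by_contra! hc
              linarith [hr₀' t htI (Or.inl ⟨h1.le, hc⟩)]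
            rw [le_abs]
            right
            linarith
          · have : 2 * M / 3 < π (γ t) := by
              by_contra! hc
              linarith [hr₀' t htI (Or.inr ⟨h1.le, hc⟩)]
            rw [le_abs]
            left
            linarith
        · exact if_neg hlt
      rw [h1]
      symm
      apply hf₀1
      rcases hor with h2 | h2
      · rw [min_eq_left (h2.le.trans ht), max_eq_left h2.le, hπ1, le_abs]
        right
        linarith
      · rw [min_eq_right h2.le, max_eq_right ht, le_abs]
        left
        linarith)
  have e0 : max t₁ (min 0 t₂) = t₁ := by
    rw [min_eq_left unitInterval.nonneg', max_eq_left unitInterval.nonneg']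
  have e1 : max t₁ (min 1 t₂) = t₂ := by
    rw [min_eq_right unitInterval.le_one', max_eq_right ht]
  simp only [e0, e1, hf₀] at hgl
  rw [hπ1, hlow 0 (by linarith), hhigh M (by linarith)] at hgl
  linarith [Real.pi_pos]

end Cat2Cx
end

open Set Metric Filter
noncomputable section
namespace Cat2Cx

variable {X : Type*} [MetricSpace X]

open Classical in
theorem exists_circle_bump (θ : Circle) {ε : ℝ} (hε : 0 < ε) :
    ∃ φ : Circle → Circle, Continuous φ ∧ (∀ ζ, ε ≤ dist ζ θ → φ ζ = 1) ∧ ∀ ζ, ζ ≠ θ * φ ζ := by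
  suffices h : ∃ φ : Circle → Circle, Continuous φ ∧ (∀ ζ, ε ≤ dist ζ 1 → φ ζ = 1) ∧
      ∀ ζ, ζ ≠ φ ζ by
    obtain ⟨φ, h1, h2, h3⟩ := h
    refine ⟨fun ζ => φ (θ⁻¹ * ζ), by fun_prop, fun ζ hζ => h2 _ ?_, fun ζ he => ?_⟩
    · have h4 : dist (θ⁻¹ * ζ) 1 = dist ((θ⁻¹ * ζ : Circle) : ℂ) 1 := rfl
      have h5 : dist ζ θ = dist (ζ : ℂ) (θ : ℂ) := rfl
      have h6 : ((θ⁻¹ * ζ : Circle) : ℂ) - 1 = (θ : ℂ)⁻¹ * ((ζ : ℂ) - θ) := by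
        rw [Circle.coe_mul, Circle.coe_inv, mul_sub, inv_mul_cancel₀ (Circle.coe_ne_zero θ)]
      rwa [h4, dist_eq_norm, h6, norm_mul, norm_inv, Circle.norm_coe, inv_one, one_mul,
        ← dist_eq_norm]
    · exact h3 (θ⁻¹ * ζ) (inv_mul_eq_iff_eq_mul.2 he)
  set δ := min (1 / 2) (ε / 2) with hδ
  have hδ0 : 0 < δ := lt_min (by norm_num) (by linarith)
  have hδ1 : δ ≤ 1 / 2 := min_le_left _ _
  have hδε : δ ≤ ε / 2 := min_le_right _ _
  have hre : Continuous fun ζ : Circle => (ζ : ℂ).re := by fun_prop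
  have him : Continuous fun ζ : Circle => (ζ : ℂ).im := by fun_prop
  set a : Circle → ℝ := fun ζ => 2 * Real.pi * clampUnit ((ζ : ℂ).im / (2 * δ) + 1 / 2) with ha
  have hac : Continuous a := by
    have := continuous_clampUnit
    fun_prop
  have ha1 : ∀ ζ : Circle, δ ≤ |(ζ : ℂ).im| → Circle.exp (a ζ) = 1 := by
    intro ζ hζ
    rw [ha]
    simp only
    rcases le_abs.1 hζ with h | h
    · rw [clampUnit_of_one_le, mul_one, Circle.exp_two_pi]
      have : 1 / 2 ≤ (ζ : ℂ).im / (2 * δ) := by rw [le_div_iff₀ (by positivity)]; linarith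
      linarith
    · rw [clampUnit_of_nonpos, mul_zero, Circle.exp_zero]
      have : (ζ : ℂ).im / (2 * δ) ≤ -(1 / 2) := by rw [div_le_iff₀ (by positivity)]; linarith
      linarith
  refine ⟨fun ζ => if 0 < (ζ : ℂ).re then Circle.exp (a ζ) else 1, ?_, fun ζ hζ => ?_, fun ζ => ?_⟩
  · rw [continuous_iff_continuousAt]
    intro ζ
    have hexp : ContinuousAt (fun ζ => Circle.exp (a ζ)) ζ :=
      (Circle.exp.continuous.comp hac).continuousAt
    rcases lt_trichotomy 0 (ζ : ℂ).re with h | h | h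
    · refine hexp.congr ?_
      filter_upwards [hre.continuousAt.eventually_const_lt h] with z hz
      exact (if_pos hz).symm
    · refine continuousAt_ite_of_eq hexp continuousAt_const (ha1 ζ ?_)
      have := circle_re_sq_add_im_sq ζ
      rw [← h] at this
      have h1 : |(ζ : ℂ).im| = 1 := by
        rw [← sq_eq_sq₀ (abs_nonneg _) zero_le_one, sq_abs]
        linarith
      linarith
    · refine (continuousAt_const (y := (1 : Circle))).congr ?_
      filter_upwards [hre.continuousAt.eventually_lt_const h] with z hz
      exact (if_neg (not_lt.2 hz.le)).symm
  · by_cases h : 0 < (ζ : ℂ).re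
    · simp only [if_pos h]
      apply ha1
      by_contra! hc
      have h1 := circle_re_sq_add_im_sq ζ
      have h2 := circle_dist_sq ζ 1
      simp only [Circle.coe_one, Complex.one_re, Complex.one_im] at h2
      have h3 : (ζ : ℂ).im ^ 2 < δ ^ 2 := by
        rw [← sq_abs]
        exact pow_lt_pow_left₀ hc (abs_nonneg _) two_ne_zero
      nlinarith [sq_nonneg ((ζ : ℂ).im)]
    · simp only [if_neg h]
  · by_cases h : 0 < (ζ : ℂ).re
    · simp only [if_pos h]
      intro he
      by_cases h1 : δ ≤ |(ζ : ℂ).im|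
      · rw [ha1 ζ h1] at he
        rw [he] at h1
        simp at h1
        linarith
      · push Not at h1
        obtain ⟨h2, h3⟩ := abs_lt.1 h1
        have e : a ζ = Real.pi * ((ζ : ℂ).im / δ) + Real.pi := by
          rw [ha]
          simp only
          unfold clampUnit
          have l1 : (ζ : ℂ).im / (2 * δ) ≤ 1 / 2 := by rw [div_le_iff₀ (by positivity)]; linarith
          have l2 : -(1 / 2) ≤ (ζ : ℂ).im / (2 * δ) := by
            rw [le_div_iff₀ (by positivity)]; linarith
          rw [min_eq_left (by linarith), max_eq_right (by linarith)]
          field_simp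
        have himv : (ζ : ℂ).im = -Real.sin (Real.pi * ((ζ : ℂ).im / δ)) := by
          conv_lhs => rw [he]
          rw [e, Circle.coe_exp, Complex.exp_ofReal_mul_I_im, Real.sin_add_pi]
        have hrev : (ζ : ℂ).re = -Real.cos (Real.pi * ((ζ : ℂ).im / δ)) := by
          conv_lhs => rw [he]
          rw [e, Circle.coe_exp, Complex.exp_ofReal_mul_I_re, Real.cos_add_pi]
        have l1 : (ζ : ℂ).im / δ < 1 := by rw [div_lt_one hδ0]; exact h3
        have l2 : -1 < (ζ : ℂ).im / δ := by rw [lt_div_iff₀ hδ0]; linarith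
        rcases lt_trichotomy (ζ : ℂ).im 0 with hi | hi | hi
        · have hq : (ζ : ℂ).im / δ < 0 := div_neg_of_neg_of_pos hi hδ0
          have := Real.sin_neg_of_neg_of_neg_pi_lt (x := Real.pi * ((ζ : ℂ).im / δ))
            (by nlinarith [Real.pi_pos]) (by nlinarith [Real.pi_pos])
          linarith
        · rw [hi] at hrev
          simp at hrev
          linarith
        · have hq : 0 < (ζ : ℂ).im / δ := div_pos hi hδ0
          have := Real.sin_pos_of_pos_of_lt_pi (x := Real.pi * ((ζ : ℂ).im / δ))
            (by nlinarith [Real.pi_pos]) (by nlinarith [Real.pi_pos])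
          linarith
    · simp only [if_neg h]
      rintro rfl
      simp at h

theorem exists_cos_ne {a b : ℝ} (hab : a < b) :
    ∃ x ∈ Ioo a b, ∃ y ∈ Ioo a b, x < y ∧ Real.cos x ≠ Real.cos y := by
  set h := min 1 ((b - a) / 4) with hh
  have h0 : 0 < h := lt_min one_pos (by linarith)
  have h1 : h ≤ 1 := min_le_left _ _
  have h2 : h ≤ (b - a) / 4 := min_le_right _ _
  by_contra! hc
  have e1 := hc (a + h) ⟨by linarith, by linarith⟩ (a + h + h) ⟨by linarith, by linarith⟩ (by linarith)
  have e2 := hc (a + h + h) ⟨by linarith, by linarith⟩ (a + h + h + h) ⟨by linarith, by linarith⟩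
    (by linarith)
  have hcos : Real.cos h < 1 := by
    have := Real.cos_lt_cos_of_nonneg_of_le_pi le_rfl (y := h) (by linarith [Real.pi_gt_three]) h0
    simpa using this
  have e3 := Real.cos_add (a + h + h) h
  have e4 := Real.cos_sub (a + h + h) h
  rw [show a + h + h - h = a + h by ring] at e4
  have e5 : Real.cos (a + h + h) * (1 - Real.cos h) = 0 := by linarith
  have e6 : Real.cos (a + h + h) = 0 := by
    rcases mul_eq_zero.1 e5 with h | h
    · exact h
    · linarith
  have hsin : 0 < Real.sin h := Real.sin_pos_of_pos_of_lt_pi h0 (by linarith [Real.pi_gt_three])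
  have e7 : Real.sin (a + h + h) = 0 := by
    rw [← e2, e6] at e3
    have : Real.sin (a + h + h) * Real.sin h = 0 := by linarith
    exact (mul_eq_zero.1 this).resolve_right hsin.ne'
  have := Real.sin_sq_add_cos_sq (a + h + h)
  rw [e6, e7] at this
  norm_num at this

/-- The points of the circle with generic real part are dense. -/
theorem exists_re_mem_of_ae {G : ℝ → Prop} (hG : ∀ᵐ x, G x) {U : Set Circle} (hU : IsOpen U)
    {ζ : Circle} (hζ : ζ ∈ U) : ∃ θ ∈ U, G (θ : ℂ).re := by
  have hV : IsOpen (Circle.exp ⁻¹' U) := hU.preimage Circle.exp.continuous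
  obtain ⟨δ, hδ, hball⟩ := Metric.isOpen_iff.1 hV (Complex.arg ζ) (by
    rw [mem_preimage, Circle.exp_arg]; exact hζ)
  rw [Real.ball_eq_Ioo] at hball
  obtain ⟨x, hx, y, hy, hxy, hne⟩ := exists_cos_ne
    (show Complex.arg ζ - δ < Complex.arg ζ + δ by linarith)
  suffices h : ∃ α ∈ Ioo x y, G (Real.cos α) by
    obtain ⟨α, hα, hGα⟩ := h
    refine ⟨Circle.exp α, hball ⟨hx.1.trans hα.1, hα.2.trans hy.2⟩, ?_⟩
    rwa [Circle.coe_exp, Complex.exp_ofReal_mul_I_re]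
  rcases lt_or_gt_of_ne hne with h | h
  · obtain ⟨v, hv, hGv⟩ := exists_mem_Ioo_of_ae hG h
    obtain ⟨α, hα, rfl⟩ := intermediate_value_Ioo hxy.le Real.continuous_cos.continuousOn hv
    exact ⟨α, hα, hGv⟩
  · obtain ⟨v, hv, hGv⟩ := exists_mem_Ioo_of_ae hG h
    obtain ⟨α, hα, rfl⟩ := intermediate_value_Ioo' hxy.le Real.continuous_cos.continuousOn hv
    exact ⟨α, hα, hGv⟩

end Cat2Cx
end

open Set Metric Filter
noncomputable section
namespace Cat2Cx

variable {X : Type*} [MetricSpace X]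

/-- For almost every real part of the direction, the radial coordinate is generic along the
skeleton and along the spheres with centres in a countable set. -/
theorem FlatAt.ae_generic {κ : ℝ} (hκ : κ ≤ 0) (PC : PolyComplex2 κ X) (hX : Cat0 X) {u : X}
    {R : ℝ} {P : Circle → ℝ → X} (hu : FlatAt u R P) {K D : Set X} (hK : IsCompact K)
    (hD : D.Countable) :
    ∀ᵐ x : ℝ, ∀ᵐ ℓ : ℝ,
      (∀ y ∈ K ∩ (⋃₀ PC.faces)ᶜ, 0 < dist u y → (dir u R P y : ℂ).re = x → dist u y ≠ ℓ) ∧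
      ∀ c ∈ D, ∀ᵐ s : ℝ, ∀ y ∈ ⋃₀ {F | F ∈ PC.faces ∧ (F ∩ K).Nonempty}, 0 < dist u y →
        (dir u R P y : ℂ).re = x → dist u y = ℓ → dist c y ≠ s := by
  have hlip : ∀ n : ℕ, ∃ L : NNReal, LipschitzOnWith L (fun y => (dir u R P y : ℂ).re)
      {y | 1 / ((n : ℝ) + 1) ≤ dist u y} := by
    intro n
    obtain ⟨L, hL0, hL⟩ := hu.dir_lipschitz hX (ε := 1 / ((n : ℝ) + 1)) (by positivity)
    refine ⟨⟨L, hL0⟩, LipschitzOnWith.of_dist_le_mul fun y hy z hz => ?_⟩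
    refine le_trans ?_ (hL y z hy hz)
    rw [Real.dist_eq, ← Complex.sub_re]
    exact (Complex.abs_re_le_norm _).trans_eq (Complex.dist_eq _ _).symm
  choose L hL using hlip
  have hn : ∀ y : X, 0 < dist u y → ∃ n : ℕ, y ∈ {y | 1 / ((n : ℝ) + 1) ≤ dist u y} := by
    intro y hy
    obtain ⟨n, hn⟩ := exists_nat_one_div_lt hy
    exact ⟨n, hn.le⟩
  have h1 : ∀ᵐ x : ℝ, ∀ᵐ ℓ : ℝ, ∀ y ∈ K ∩ (⋃₀ PC.faces)ᶜ, 0 < dist u y →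
      (dir u R P y : ℂ).re = x → dist u y ≠ ℓ := by
    have : ∀ᵐ x : ℝ, ∀ n : ℕ, ∀ᵐ ℓ : ℝ,
        ∀ y ∈ (K ∩ (⋃₀ PC.faces)ᶜ) ∩ {y | 1 / ((n : ℝ) + 1) ≤ dist u y},
        (dir u R P y : ℂ).re = x → dist u y ≠ ℓ := by
      rw [MeasureTheory.ae_all_iff]
      intro n
      exact ae_ae_not_mem_of_dimH_le_one
        ((dimH_mono inter_subset_left).trans (PC.dimH_skeleton_le hK))
        ((hL n).mono inter_subset_right) (LipschitzWith.dist_right u).lipschitzOnWith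
    filter_upwards [this] with x hx
    rw [← MeasureTheory.ae_all_iff] at hx
    filter_upwards [hx] with ℓ hℓ y hy hy0
    obtain ⟨n, hyn⟩ := hn y hy0
    exact hℓ n y ⟨hy, hyn⟩
  have h2 : ∀ᵐ x : ℝ, ∀ᵐ ℓ : ℝ, ∀ c ∈ D, ∀ᵐ s : ℝ,
      ∀ y ∈ ⋃₀ {F | F ∈ PC.faces ∧ (F ∩ K).Nonempty}, 0 < dist u y →
        (dir u R P y : ℂ).re = x → dist u y = ℓ → dist c y ≠ s := by
    have : ∀ᵐ x : ℝ, ∀ c ∈ D, ∀ n : ℕ, ∀ᵐ ℓ : ℝ, ∀ᵐ s : ℝ,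
        ∀ y ∈ (⋃₀ {F | F ∈ PC.faces ∧ (F ∩ K).Nonempty}) ∩ {y | 1 / ((n : ℝ) + 1) ≤ dist u y},
        (dir u R P y : ℂ).re = x → dist u y = ℓ → dist c y ≠ s := by
      rw [MeasureTheory.ae_ball_iff hD]
      intro c _
      rw [MeasureTheory.ae_all_iff]
      intro n
      exact ae_ae_ae_not_mem_of_dimH_le_two
        ((dimH_mono inter_subset_left).trans (PC.dimH_faces_le hκ hK))
        ((hL n).mono inter_subset_right) (LipschitzWith.dist_right u).lipschitzOnWith
        (LipschitzWith.dist_right c).lipschitzOnWith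
    filter_upwards [this] with x hx
    rw [MeasureTheory.ae_ball_iff hD]
    intro c hc
    have hxc := hx c hc
    rw [← MeasureTheory.ae_all_iff] at hxc
    filter_upwards [hxc] with ℓ hℓ
    rw [← MeasureTheory.ae_all_iff] at hℓ
    filter_upwards [hℓ] with s hs y hy hy0
    obtain ⟨n, hyn⟩ := hn y hy0
    exact hs n y ⟨hy, hyn⟩
  filter_upwards [h1, h2] with x hx1 hx2
  exact hx1.and hx2

/-- The shadow, seen from `u`, of the trace of `ball c s` on the sphere of radius `ℓ`. -/
def shadow (u : X) (ℓ : ℝ) (c : X) (s : ℝ) : Set X :=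
  {y | ℓ < dist u y ∧ dist (gd u y ℓ) c < s}

theorem Cat0.isOpen_shadow (hX : Cat0 X) (u : X) (ℓ : ℝ) (c : X) (s : ℝ) :
    IsOpen (shadow u ℓ c s) := by
  have h : Continuous fun y => gd u y ℓ :=
    (hX.continuous_gd u).comp (continuous_id.prodMk continuous_const)
  exact (isOpen_lt continuous_const (continuous_const.dist continuous_id)).inter
    (isOpen_lt (h.dist continuous_const) continuous_const)

open Classical in
theorem FlatAt.hasLog_of_shadows (hX : Cat0 X) {u : X} {R : ℝ} {P : Circle → ℝ → X}
    (hu : FlatAt u R P) {γ : unitInterval → X} (hγ : Continuous γ) (h01 : γ 0 = γ 1)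
    (hγu : ∀ t, γ t ≠ u) {I : Type*} [LinearOrder I] (S : Finset I) {ℓ s : I → ℝ} {c : I → X}
    {E : I → Set X} (hℓ : ∀ i ∈ S, 0 < ℓ i) (hlog : ∀ i ∈ S, LogTrivial (E i))
    (hE : ∀ i ∈ S, closedBall (c i) (s i) ⊆ (E i)ᶜ) (hγE : ∀ i ∈ S, ∀ t, γ t ∈ E i)
    {θ : Circle} {ε : ℝ} (hε : 0 < ε)
    (hsph : ∀ i ∈ S, ∀ y, dist u y = ℓ i → dist (c i) y = s i → ε ≤ dist (dir u R P y) θ)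
    (hcov : ∀ t, (∀ i ∈ S, γ t ∉ shadow u (ℓ i) (c i) (s i)) → ε ≤ dist (dir u R P (γ t)) θ) :
    HasLog fun t => dir u R P (γ t) := by
  obtain ⟨φ, hφc, hφ1, hφθ⟩ := exists_circle_bump θ hε
  set A : I → Set X := fun i => shadow u (ℓ i) (c i) (s i) with hA
  set key : I → ℝ ×ₗ I := fun i => toLex (ℓ i, i) with hkey
  have hkinj : ∀ i j, key i = key j → i = j := fun i j h => by
    have := congrArg (fun z => (ofLex z).2) h
    exact this
  have hkle : ∀ i j, key i < key j → ℓ i ≤ ℓ j := by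
    intro i j h
    rcases Prod.Lex.lt_iff.1 h with h | h
    · exact le_of_lt h
    · exact le_of_eq h.1
  set B : I → Set X := fun i => {y | y ∈ A i ∧ ∀ k ∈ S, key k < key i → y ∉ A k} with hB
  set F : I → X → Circle := fun i y => if y ∈ B i then φ (dir u R P y) else 1 with hF
  have hρ : ∀ y, y ≠ u → ContinuousAt (dir u R P) y := fun y hy =>
    (hu.continuousOn_dir hX).continuousAt (isOpen_compl_singleton.mem_nhds hy)
  have hgc : ∀ a, Continuous fun y => gd u y a := fun a =>
    (hX.continuous_gd u).comp (continuous_id.prodMk continuous_const)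
  have hdc : Continuous fun y => dist u y := by fun_prop
  have hloc : ∀ k ∈ S, ∀ y, dist (dir u R P y) θ < ε → ℓ k < dist u y →
      ∀ᶠ z in nhds y, (z ∈ A k ↔ y ∈ A k) := by
    intro k hk y hy hlt
    have hyu : y ≠ u := by
      rintro rfl
      rw [dist_self] at hlt
      linarith [hℓ k hk]
    have hne : dist (gd u y (ℓ k)) (c k) ≠ s k := by
      intro he
      have h1 := hsph k hk (gd u y (ℓ k)) (hX.dist_gd u y (hℓ k hk).le hlt.le)
        (by rw [dist_comm]; exact he)
      rw [hu.dir_gd hX hyu (hℓ k hk)] at h1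
      linarith
    have hc' : Continuous fun z => dist (gd u z (ℓ k)) (c k) :=
      (hgc (ℓ k)).dist continuous_const
    rcases lt_or_gt_of_ne hne with h1 | h1
    · have hyA : y ∈ A k := ⟨hlt, h1⟩
      filter_upwards [(hX.isOpen_shadow u (ℓ k) (c k) (s k)).mem_nhds hyA] with z hz
      exact ⟨fun _ => hyA, fun _ => hz⟩
    · filter_upwards [hc'.continuousAt.eventually_const_lt h1] with z hz
      exact ⟨fun h => absurd h.2 (not_lt.2 (le_of_lt hz)), fun h => absurd h.2 (not_lt.2 h1.le)⟩
  have hnotA : ∀ i y, (∀ᶠ z in nhds y, z ∉ A i) → ContinuousAt (F i) y := by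
    intro i y h
    refine (continuousAt_const (y := (1 : Circle))).congr ?_
    filter_upwards [h] with z hz
    exact (if_neg fun hzB => hz hzB.1).symm
  have hFc : ∀ i ∈ S, ContinuousOn (F i) (E i) := by
    intro i hi y hyE
    apply ContinuousAt.continuousWithinAt
    rcases lt_or_ge (dist u y) (ℓ i) with h1 | h1
    · apply hnotA
      filter_upwards [hdc.continuousAt.eventually_lt_const h1] with z hz hzA
      exact (hzA.1.trans hz).false
    have hyu : y ≠ u := by
      rintro rfl
      rw [dist_self] at h1
      linarith [hℓ i hi]
    have hφρ : ContinuousAt (fun z => φ (dir u R P z)) y :=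
      hφc.continuousAt.comp (hρ y hyu)
    by_cases h2 : ε ≤ dist (dir u R P y) θ
    · exact continuousAt_ite_of_eq (p := fun z => z ∈ B i) hφρ continuousAt_const (hφ1 _ h2)
    push Not at h2
    rcases eq_or_lt_of_le h1 with h3 | h3
    · have h4 : dist (c i) y ≠ s i := fun he => (hsph i hi y h3.symm he).not_gt h2
      have h5 : ¬ dist (c i) y ≤ s i := fun hle =>
        hE i hi (by rw [mem_closedBall, dist_comm]; exact hle) hyE
      have h6 : s i < dist (gd u y (ℓ i)) (c i) := by
        rw [hX.gd_of_le _ _ h3.ge, dist_comm]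
        exact not_le.1 h5
      apply hnotA
      have hc' : Continuous fun z => dist (gd u z (ℓ i)) (c i) :=
        (hgc (ℓ i)).dist continuous_const
      filter_upwards [hc'.continuousAt.eventually_const_lt h6] with z hz hzA
      exact absurd hzA.2 (not_lt.2 (le_of_lt hz))
    · have h4 : ∀ᶠ z in nhds y, ∀ k ∈ S, ℓ k ≤ ℓ i → (z ∈ A k ↔ y ∈ A k) := by
        rw [Filter.eventually_all_finset]
        intro k hk
        by_cases hki : ℓ k ≤ ℓ i
        · filter_upwards [hloc k hk y h2 (hki.trans_lt h3)] with z hz _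
          exact hz
        · exact Eventually.of_forall fun z h => absurd h hki
      have h5 : ∀ᶠ z in nhds y, (z ∈ B i ↔ y ∈ B i) := by
        filter_upwards [h4] with z hz
        refine and_congr (hz i hi le_rfl) (forall₂_congr fun k hk => ?_)
        refine imp_congr_right fun hki => not_congr (hz k hk (hkle k i hki))
      by_cases hyB : y ∈ B i
      · refine hφρ.congr ?_
        filter_upwards [h5] with z hz
        exact (if_pos (hz.2 hyB)).symm
      · refine (continuousAt_const (y := (1 : Circle))).congr ?_
        filter_upwards [h5] with z hz
        exact (if_neg fun h => hyB (hz.1 h)).symm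
  have hprod : ∀ t, φ (dir u R P (γ t)) = ∏ i ∈ S, F i (γ t) := by
    intro t
    by_cases hex : ∃ i ∈ S, γ t ∈ A i
    · have hne : (S.filter fun i => γ t ∈ A i).Nonempty := by
        obtain ⟨i, hi, h⟩ := hex
        exact ⟨i, Finset.mem_filter.2 ⟨hi, h⟩⟩
      obtain ⟨k, hk, hmin⟩ := Finset.exists_min_image _ key hne
      rw [Finset.mem_filter] at hk
      rw [Finset.prod_eq_single k]
      · refine (if_pos ⟨hk.2, fun j hj hlt hjA => ?_⟩).symm
        exact (hmin j (Finset.mem_filter.2 ⟨hj, hjA⟩)).not_gt hlt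
      · intro j hj hjk
        refine if_neg fun hjB => hjB.2 k hk.1 ?_ hk.2
        exact lt_of_le_of_ne (hmin j (Finset.mem_filter.2 ⟨hj, hjB.1⟩))
          fun h => hjk (hkinj _ _ h).symm
      · exact fun h => absurd hk.1 h
    · push Not at hex
      rw [hφ1 _ (hcov t hex)]
      exact (Finset.prod_eq_one fun i hi => if_neg fun h => hex i hi h.1).symm
  have h1 : HasLog fun t => φ (dir u R P (γ t)) :=
    (HasLog.prod S (F := fun i t => F i (γ t)) fun i hi =>
      hlog i hi (F i) (hFc i hi) γ hγ (hγE i hi) h01).congr hprod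
  have h2 : HasLog fun _ => -θ := ⟨fun _ => Complex.arg (-θ : Circle), continuous_const, rfl,
    fun _ => (Circle.exp_arg _).symm⟩
  refine (h2.mul h1).of_ne_neg ?_ (by rw [h01]) fun t he => hφθ (dir u R P (γ t)) ?_
  · rw [continuous_iff_continuousAt]
    exact fun t => (hρ _ (hγu t)).comp hγ.continuousAt
  · rwa [neg_mul, neg_neg] at he

end Cat2Cx
end

open Set Metric Filter
noncomputable section
namespace Cat2Cx

variable {X : Type*} [MetricSpace X]

theorem exists_pos_le_finset {I : Type*} (S : Finset I) {f : I → ℝ} (hf : ∀ i ∈ S, 0 < f i) :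
    ∃ ε > 0, ∀ i ∈ S, ε ≤ f i := by
  classical
  induction S using Finset.induction_on with
  | empty => exact ⟨1, one_pos, by simp⟩
  | insert i S _ ih =>
    obtain ⟨ε, h1, h2⟩ := ih fun j hj => hf j (Finset.mem_insert_of_mem hj)
    refine ⟨min ε (f i), lt_min h1 (hf i (Finset.mem_insert_self _ _)), fun j hj => ?_⟩
    rcases Finset.mem_insert.1 hj with rfl | hj
    · exact min_le_right _ _
    · exact (min_le_left _ _).trans (h2 j hj)

/-- If a loop lying in closed sets `E i` without circle-valued cohomology winds around the flat
point `u`, then in every direction some point of the loop is visible from `u` in all `E i`. -/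
theorem FlatAt.exists_visible {κ : ℝ} (hκ : κ ≤ 0) (PC : PolyComplex2 κ X) (hX : Cat0 X) {u : X}
    {R : ℝ} {P : Circle → ℝ → X} (hu : FlatAt u R P) {γ : unitInterval → X} (hγ : Continuous γ)
    (h01 : γ 0 = γ 1) (hγu : ∀ t, γ t ≠ u) (hlog : ¬ HasLog fun t => dir u R P (γ t))
    {J : Type*} {E : J → Set X} (hEc : ∀ j, IsClosed (E j)) (hE : ∀ j, LogTrivial (E j))
    (hγE : ∀ j t, γ t ∈ E j) (ζ : Circle) :
    ∃ t, dir u R P (γ t) = ζ ∧ ∀ j s, gd u (γ t) s ∈ E j := by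
  have hρ : Continuous fun t => dir u R P (γ t) := by
    rw [continuous_iff_continuousAt]
    exact fun t => ((hu.continuousOn_dir hX).continuousAt
      (isOpen_compl_singleton.mem_nhds (hγu t))).comp hγ.continuousAt
  have hgc : ∀ a, Continuous fun y => gd u y a := fun a =>
    (hX.continuous_gd u).comp (continuous_id.prodMk continuous_const)
  have hgc' : ∀ y, Continuous fun a => gd u y a := fun y =>
    (hX.continuous_gd u).comp (continuous_const.prodMk continuous_id)
  set V : Set Circle := (fun t => dir u R P (γ t)) '' {t | ∀ j s, gd u (γ t) s ∈ E j} with hV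
  have hVc : IsClosed V := by
    refine (IsCompact.image (IsClosed.isCompact ?_) hρ).isClosed
    have : {t | ∀ j s, gd u (γ t) s ∈ E j} = ⋂ (j) (s : ℝ), {t | gd u (γ t) s ∈ E j} := by
      ext t
      simp
    rw [this]
    exact isClosed_iInter fun j => isClosed_iInter fun s =>
      (hEc j).preimage ((hgc s).comp hγ)
  suffices hmem : ζ ∈ V by
    obtain ⟨t, h1, h2⟩ := hmem
    exact ⟨t, h2, h1⟩
  by_contra hζ
  set K := cone u (range γ) with hK
  have hKc : IsCompact K := hX.isCompact_cone _ (isCompact_range hγ)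
  obtain ⟨D, hDc, hD⟩ := exists_countable_dense hKc
  obtain ⟨θ, hθV, hθ⟩ := exists_re_mem_of_ae (hu.ae_generic hκ PC hX hKc hDc)
    hVc.isOpen_compl hζ
  have hcut : ∀ t, dir u R P (γ t) = θ → ∃ E' ℓ c s ε, E' ∈ range E ∧ 0 < ℓ ∧ 0 < ε ∧
      closedBall c s ⊆ E'ᶜ ∧ γ t ∈ shadow u ℓ c s ∧
      ∀ y, dist u y = ℓ → dist c y = s → ε ≤ dist (dir u R P y) θ := by
    intro t ht
    have hnv : ∃ j s, gd u (γ t) s ∉ E j := by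
      by_contra! hc
      exact hθV ⟨t, hc, ht⟩
    obtain ⟨j, a, ha⟩ := hnv
    have hd : 0 < dist u (γ t) := dist_pos.2 (hγu t).symm
    have ha1 : a < dist u (γ t) := by
      by_contra! hc
      rw [hX.gd_of_le _ _ hc] at ha
      exact ha (hγE j t)
    obtain ⟨δ, hδ, hball⟩ := Metric.isOpen_iff.1
      ((hEc j).isOpen_compl.preimage (hgc' (γ t))) (max a 0) (by
        rcases le_total a 0 with h | h
        · rw [max_eq_right h, mem_preimage, hX.gd_zero, ← hX.gd_of_nonpos u (γ t) h]
          exact ha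
        · rw [max_eq_left h]
          exact ha)
    rw [Real.ball_eq_Ioo] at hball
    obtain ⟨ℓ, ⟨hℓ1, hℓ2⟩, hℓ3, hℓ4⟩ := exists_mem_Ioo_of_ae hθ
      (show max a 0 < min (max a 0 + δ) (dist u (γ t)) from
        lt_min (by linarith) (max_lt ha1 hd))
    have hℓ0 : 0 < ℓ := (le_max_right a 0).trans_lt hℓ1
    have hℓd : ℓ < dist u (γ t) := hℓ2.trans_le (min_le_right _ _)
    set w := gd u (γ t) ℓ with hw
    have hwE : w ∈ (E j)ᶜ := hball ⟨by linarith, hℓ2.trans_le (min_le_left _ _)⟩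
    have hwd : dist u w = ℓ := hX.dist_gd u (γ t) hℓ0.le hℓd.le
    have hwθ : dir u R P w = θ := by rw [hw, hu.dir_gd hX (hγu t) hℓ0, ht]
    have hwK : w ∈ K := ⟨γ t, ⟨t, rfl⟩, ℓ, rfl⟩
    obtain ⟨c, R', P', s, hfl, hs0, hsR, hcw, hball', hsph⟩ := PC.exists_disc hκ hD
      (W := {y | dist u y = ℓ ∧ dir u R P y = θ}) (U := (E j)ᶜ) (fun c hc => by
        filter_upwards [hℓ4 c hc] with s hs y hy hyW
        exact hs y hy (hyW.1.symm ▸ hℓ0) (by rw [hyW.2]) hyW.1) hwK (by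
        by_contra hn
        exact hℓ3 w ⟨hwK, hn⟩ (hwd.symm ▸ hℓ0) (by rw [hwθ]) hwd) (hEc j).isOpen_compl hwE
    have hcpt : IsCompact ({y | dist c y = s} ∩ {y | dist u y = ℓ}) :=
      (hfl.isCompact_sphere hs0.le hsR).inter_right
        (isClosed_eq (continuous_const.dist continuous_id) continuous_const)
    obtain ⟨ε, hε0, hε⟩ := hcpt.exists_forall_le' (f := fun y => dist (dir u R P y) θ) (a := 0)
      (continuous_dist.comp_continuousOn (ContinuousOn.prodMk ((hu.continuousOn_dir hX).mono fun y hy he => by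
        have h1 : dist u y = ℓ := hy.2
        rw [mem_singleton_iff] at he
        rw [he, dist_self] at h1
        exact hℓ0.ne h1) continuousOn_const))
      (fun y hy => dist_pos.2 fun he => hsph y hy.1 ⟨hy.2, he⟩)
    exact ⟨E j, ℓ, c, s, ε, ⟨j, rfl⟩, hℓ0, hε0, hball', ⟨hℓd, by rw [dist_comm]; exact hcw⟩,
      fun y h1 h2 => hε y ⟨h2, h1⟩⟩
  have : Nonempty X := ⟨u⟩
  choose! E' ℓ c s ε hE' hℓ0 hε0 hball hsh hε using hcut
  have hTc : IsCompact {t | dir u R P (γ t) = θ} :=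
    (isClosed_eq hρ continuous_const).isCompact
  obtain ⟨S, hSθ, hScov⟩ := hTc.elim_nhds_subcover
    (fun t => γ ⁻¹' shadow u (ℓ t) (c t) (s t)) fun t ht =>
      ((hX.isOpen_shadow _ _ _ _).preimage hγ).mem_nhds (hsh t ht)
  obtain ⟨ε₁, hε₁, hε₁'⟩ := exists_pos_le_finset S fun t ht => hε0 t (hSθ t ht)
  have hRc : IsCompact (⋃ t ∈ S, γ ⁻¹' shadow u (ℓ t) (c t) (s t))ᶜ :=
    (isOpen_biUnion fun t _ => (hX.isOpen_shadow _ _ _ _).preimage hγ).isClosed_compl.isCompact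
  obtain ⟨ε₂, hε₂, hε₂'⟩ := hRc.exists_forall_le' (f := fun t => dist (dir u R P (γ t)) θ) (a := 0)
    (hρ.dist continuous_const).continuousOn fun t ht => dist_pos.2 fun he => ht (hScov he)
  refine hlog (hu.hasLog_of_shadows hX hγ h01 hγu S (E := E')
    (fun t ht => hℓ0 t (hSθ t ht)) (fun t ht => by
      obtain ⟨j, hj⟩ := hE' t (hSθ t ht)
      exact hj ▸ hE j) (fun t ht => hball t (hSθ t ht))
    (fun t ht => by
      obtain ⟨j, hj⟩ := hE' t (hSθ t ht)
      exact hj ▸ hγE j) (lt_min hε₁ hε₂)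
    (fun t ht y h1 h2 => (min_le_left _ _).trans ((hε₁' t ht).trans (hε t (hSθ t ht) y h1 h2)))
    fun t ht => (min_le_right _ _).trans (hε₂' t ?_))
  intro hmem
  simp only [mem_iUnion] at hmem
  obtain ⟨i, hi, h⟩ := hmem
  exact ht i hi h

end Cat2Cx
end

open Set Metric Filter
noncomputable section
namespace Cat2Cx

variable {X : Type*} [MetricSpace X]

/-- `f` is a `1`-Lipschitz arc in `S` from `x` to `y` parametrized by `[0, ℓ]` and extended by
constants. -/
structure IsArc (S : Set X) (x y : X) (ℓ : ℝ) (f : ℝ → X) : Prop where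
  nonneg : 0 ≤ ℓ
  dist_le : ∀ s t, dist (f s) (f t) ≤ |s - t|
  mem : ∀ t, f t ∈ S
  left : ∀ t ≤ 0, f t = x
  right : ∀ t, ℓ ≤ t → f t = y

namespace IsArc

variable {S : Set X} {x y z : X} {ℓ m : ℝ} {f g : ℝ → X}

theorem continuous (h : IsArc S x y ℓ f) : Continuous f :=
  (LipschitzWith.of_dist_le_mul (K := 1) fun s t => by
    rw [NNReal.coe_one, one_mul, Real.dist_eq]; exact h.dist_le s t).continuous

theorem zero (h : IsArc S x y ℓ f) : f 0 = x := h.left 0 le_rfl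

theorem end_eq (h : IsArc S x y ℓ f) : f ℓ = y := h.right ℓ le_rfl

theorem const (hx : x ∈ S) : IsArc S x x 0 fun _ => x :=
  ⟨le_rfl, fun _ _ => by rw [dist_self]; exact abs_nonneg _, fun _ => hx, fun _ _ => rfl,
    fun _ _ => rfl⟩

theorem rev (h : IsArc S x y ℓ f) : IsArc S y x ℓ fun t => f (ℓ - t) where
  nonneg := h.nonneg
  dist_le s t := by
    refine (h.dist_le _ _).trans_eq ?_
    rw [abs_sub_comm s t]
    congr 1
    ring
  mem _ := h.mem _
  left t ht := h.right _ (by linarith)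
  right t ht := h.left _ (by linarith)

theorem trans (h : IsArc S x y ℓ f) (h' : IsArc S y z m g) :
    IsArc S x z (ℓ + m) fun t => if t ≤ ℓ then f t else g (t - ℓ) := by
  have key : ∀ s t, s ≤ ℓ → ℓ < t → dist (f s) (g (t - ℓ)) ≤ |s - t| := by
    intro s t hs ht
    have h1 := h.dist_le s ℓ
    have h2 := h'.dist_le 0 (t - ℓ)
    rw [h.end_eq] at h1
    rw [h'.zero] at h2
    refine (dist_triangle _ y _).trans ((add_le_add h1 h2).trans_eq ?_)
    rw [abs_of_nonpos (by linarith), abs_of_nonpos (by linarith), abs_of_nonpos (by linarith)]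
    ring
  refine ⟨add_nonneg h.nonneg h'.nonneg, fun s t => ?_, fun t => ?_, fun t ht => ?_, fun t ht => ?_⟩
  · by_cases hs : s ≤ ℓ <;> by_cases ht : t ≤ ℓ
    · simp only [hs, ht, if_true]
      exact h.dist_le s t
    · simp only [hs, ht, if_true, if_false]
      exact key s t hs (not_le.1 ht)
    · simp only [hs, ht, if_true, if_false]
      rw [dist_comm, abs_sub_comm]
      exact key t s ht (not_le.1 hs)
    · simp only [hs, ht, if_false]
      refine (h'.dist_le _ _).trans_eq ?_
      congr 1
      ring
  · by_cases ht : t ≤ ℓ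
    · simp only [ht, if_true]
      exact h.mem t
    · simp only [ht, if_false]
      exact h'.mem _
  · simp only [ht.trans h.nonneg, if_true]
    exact h.left t ht
  · by_cases h1 : t ≤ ℓ
    · have hm : m = 0 := le_antisymm (by linarith) h'.nonneg
      have : t = ℓ := by linarith
      simp only [h1, if_true]
      rw [this, h.end_eq, ← h'.zero, ← hm, h'.end_eq]
    · simp only [h1, if_false]
      exact h'.right _ (by linarith)

theorem sub (h : IsArc S x y ℓ f) {a b : ℝ} (hab : a ≤ b) :
    IsArc S (f a) (f b) (b - a) fun t => f (max a (min (a + t) b)) where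
  nonneg := by linarith
  dist_le s t := by
    refine (h.dist_le _ _).trans ((abs_max_sub_max_le_max _ _ _ _).trans ?_)
    rw [sub_self, abs_zero, max_eq_right (abs_nonneg _)]
    refine (abs_min_sub_min_le_max _ _ _ _).trans ?_
    rw [sub_self, abs_zero, max_eq_left (abs_nonneg _), add_sub_add_left_eq_sub]
  mem _ := h.mem _
  left t ht := by rw [min_eq_left (by linarith), max_eq_left (by linarith)]
  right t ht := by rw [min_eq_right (by linarith), max_eq_right hab]

theorem gd (hX : Cat0 X) (h : ∀ s, gd x y s ∈ S) : IsArc S x y (dist x y) (Cat2Cx.gd x y) where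
  nonneg := dist_nonneg
  dist_le := fun _ _ => hX.dist_gd_gd_le_abs _ _ _ _
  mem := h
  left _ ht := hX.gd_of_nonpos _ _ ht
  right _ ht := hX.gd_of_le _ _ ht

theorem mono {S' : Set X} (h : IsArc S x y ℓ f) (hS : ∀ t, f t ∈ S') : IsArc S' x y ℓ f :=
  { h with mem := hS }

end IsArc

/-- `f` is an arc in `S` of least length. -/
structure IsGeo (S : Set X) (x y : X) (ℓ : ℝ) (f : ℝ → X) : Prop where
  arc : IsArc S x y ℓ f
  le : ∀ m g, IsArc S x y m g → ℓ ≤ m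

namespace IsGeo

variable {S : Set X} {x y z : X} {ℓ m : ℝ} {f g : ℝ → X}

theorem length_eq (h : IsGeo S x y ℓ f) (h' : IsGeo S x y m g) : ℓ = m :=
  le_antisymm (h.le _ _ h'.arc) (h'.le _ _ h.arc)

theorem rev (h : IsGeo S x y ℓ f) : IsGeo S y x ℓ fun t => f (ℓ - t) :=
  ⟨h.arc.rev, fun _ _ hg => h.le _ _ hg.rev⟩

theorem le_of_arc (h : IsGeo S x y ℓ f) {a b : ℝ} (ha : 0 ≤ a) (hb : b ≤ ℓ)
    {m : ℝ} {g : ℝ → X} (hg : IsArc S (f a) (f b) m g) : b - a ≤ m := by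
  have h1 := h.arc.sub ha
  have h2 := h.arc.sub hb
  rw [h.arc.zero] at h1
  rw [h.arc.end_eq] at h2
  have := h.le _ _ ((h1.trans hg).trans h2)
  linarith

theorem sub (h : IsGeo S x y ℓ f) {a b : ℝ} (ha : 0 ≤ a) (hab : a ≤ b) (hb : b ≤ ℓ) :
    IsGeo S (f a) (f b) (b - a) fun t => f (max a (min (a + t) b)) :=
  ⟨h.arc.sub hab, fun _ _ hg => h.le_of_arc ha hb hg⟩

/-- Two geodesics with the same endpoints meet only at equal parameters. -/
theorem param_eq (h : IsGeo S x y ℓ f) (h' : IsGeo S x y ℓ g) {s t : ℝ} (hs : s ∈ Icc 0 ℓ)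
    (ht : t ∈ Icc 0 ℓ) (he : f s = g t) : s = t := by
  have key : ∀ {f g : ℝ → X} {s t : ℝ}, IsGeo S x y ℓ f → IsGeo S x y ℓ g → s ∈ Icc 0 ℓ →
      t ∈ Icc 0 ℓ → f s = g t → t ≤ s := by
    intro f g s t h h' hs ht he
    have h1 := h.arc.sub hs.1
    have h2 := h'.arc.sub ht.2
    rw [h.arc.zero, he] at h1
    rw [h'.arc.end_eq] at h2
    have := h.le _ _ (h1.trans h2)
    linarith
  exact le_antisymm (key h' h ht hs he.symm) (key h h' hs ht he)

theorem injOn (h : IsGeo S x y ℓ f) : InjOn f (Icc 0 ℓ) := fun _ hs _ ht he =>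
  h.param_eq h hs ht he

end IsGeo

theorem exists_gap {C : Set ℝ} (hC : IsClosed C) {a b s : ℝ} (ha : a ∈ C) (hb : b ∈ C)
    (has : a ≤ s) (hsb : s ≤ b) (hs : s ∉ C) :
    ∃ s₁ s₂, s₁ ∈ C ∧ s₂ ∈ C ∧ a ≤ s₁ ∧ s₂ ≤ b ∧ s₁ < s₂ ∧ ∀ t ∈ Ioo s₁ s₂, t ∉ C := by
  obtain ⟨s₁, ⟨h1, h2⟩, h3⟩ := (isCompact_Icc.inter_left hC).exists_isGreatest
    ⟨a, ha, le_rfl, has⟩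
  obtain ⟨s₂, ⟨h4, h5⟩, h6⟩ := (isCompact_Icc.inter_left hC).exists_isLeast
    ⟨b, hb, hsb, le_rfl⟩
  have l1 : s₁ < s := lt_of_le_of_ne h2.2 fun h => hs (h ▸ h1)
  have l2 : s < s₂ := lt_of_le_of_ne h5.1 fun h => hs (h ▸ h4)
  refine ⟨s₁, s₂, h1, h4, h2.1, h5.2, l1.trans l2, fun t ht htC => ?_⟩
  rcases le_total t s with h | h
  · exact (h3 ⟨htC, h2.1.trans ht.1.le, h⟩).not_gt ht.1
  · exact (h6 ⟨htC, h, ht.2.le.trans h5.2⟩).not_gt ht.2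

/-- No point of a geodesic of `S` is visible from `u` in the direction opposite to that of another
visible point, unless the geodesic passes through `u`. -/
theorem FlatAt.not_antipodal (hX : Cat0 X) {u : X} {R : ℝ} {P : Circle → ℝ → X}
    (hu : FlatAt u R P) {S : Set X} {x y : X} {ℓ : ℝ} {f : ℝ → X} (hf : IsGeo S x y ℓ f)
    {s s' : ℝ} (hs : 0 ≤ s) (hs' : s' ≤ ℓ) (hss : s ≤ s')
    (hfu : ∀ t ∈ Icc s s', f t ≠ u) (hv : ∀ a, gd u (f s) a ∈ S) (hv' : ∀ a, gd u (f s') a ∈ S) :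
    dir u R P (f s') ≠ -dir u R P (f s) := by
  intro he
  have hd := hu.dist_eq_add hX (hfu s ⟨le_rfl, hss⟩) (hfu s' ⟨hss, le_rfl⟩) he
  have h1 := (IsArc.gd hX hv).rev.trans (IsArc.gd hX hv')
  have h2 := hf.le_of_arc hs hs' h1
  rw [dist_comm u (f s), ← hd] at h2
  have h3 := hf.arc.dist_le s s'
  rw [abs_of_nonpos (by linarith)] at h3
  have e : dist (f s) (f s') = s' - s := by linarith
  have h4 : s + dist (f s) u ∈ Icc s s' := ⟨by linarith [dist_nonneg (x := f s) (y := u)],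
    by linarith [dist_nonneg (x := u) (y := f s')]⟩
  refine hfu _ h4 ?_
  have h5 := hf.arc.dist_le s (s + dist (f s) u)
  have h6 := hf.arc.dist_le (s + dist (f s) u) s'
  rw [abs_of_nonpos (by linarith [dist_nonneg (x := f s) (y := u)])] at h5
  rw [abs_of_nonpos (by linarith [h4.2])] at h6
  have h7 := dist_triangle (f s) (f (s + dist (f s) u)) (f s')
  have h8 : dist (f s) (f (s + dist (f s) u)) = dist (f s) u := by linarith
  exact hX.eq_of_between (o := f s) (x := f s') (by linarith) (by linarith) h8

end Cat2Cx
end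

open Set Metric Filter
noncomputable section
namespace Cat2Cx

variable {X : Type*} [MetricSpace X]

theorem circle_preconnectedSpace : PreconnectedSpace Circle := by
  refine ⟨?_⟩
  have h : range (Circle.exp : ℝ → Circle) = univ :=
    range_eq_univ.2 fun ζ => ⟨Complex.arg ζ, Circle.exp_arg ζ⟩
  rw [← h]
  exact isPreconnected_range Circle.exp.continuous

/-- Geodesics in an intersection of closed sets without circle-valued cohomology are unique. -/
theorem IsGeo.unique {κ : ℝ} (hκ : κ ≤ 0) (PC : PolyComplex2 κ X) (hX : Cat0 X)
    {J : Type*} {E : J → Set X} (hEc : ∀ j, IsClosed (E j)) (hE : ∀ j, LogTrivial (E j))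
    {x y : X} {ℓ : ℝ} {f g : ℝ → X} (hf : IsGeo (⋂ j, E j) x y ℓ f)
    (hg : IsGeo (⋂ j, E j) x y ℓ g) : f = g := by
  by_contra hne
  obtain ⟨s₀, hs₀⟩ := Function.ne_iff.1 hne
  have hfc := hf.arc.continuous
  have hgc := hg.arc.continuous
  have hs0 : 0 ≤ s₀ := by
    by_contra! h
    exact hs₀ (by rw [hf.arc.left _ h.le, hg.arc.left _ h.le])
  have hsℓ : s₀ ≤ ℓ := by
    by_contra! h
    exact hs₀ (by rw [hf.arc.right _ h.le, hg.arc.right _ h.le])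
  obtain ⟨s₁, s₂, h1, h2, h0s, hsl, hlt, hgap⟩ := exists_gap (isClosed_eq hfc hgc) (a := 0) (b := ℓ)
    (by rw [mem_ofPred, hf.arc.zero, hg.arc.zero]) (by rw [mem_ofPred, hf.arc.end_eq, hg.arc.end_eq])
    hs0 hsℓ hs₀
  have h1 : f s₁ = g s₁ := h1
  have h2 : f s₂ = g s₂ := h2
  set L := s₂ - s₁ with hL
  have hL0 : 0 < L := by rw [hL]; linarith
  set γ : unitInterval → X := fun t =>
    if (t : ℝ) ≤ 1 / 2 then f (s₁ + 2 * L * t) else g (s₁ + 2 * L * (1 - t)) with hγdef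
  have hγ : Continuous γ := by
    refine Continuous.if_le (by fun_prop) (by fun_prop) (by fun_prop) (by fun_prop) ?_
    intro t ht
    rw [ht, show s₁ + 2 * L * (1 / 2) = s₂ by rw [hL]; ring,
      show s₁ + 2 * L * (1 - 1 / 2) = s₂ by rw [hL]; ring]
    exact h2
  have hγ1 : ∀ t : unitInterval, (t : ℝ) ≤ 1 / 2 → γ t = f (s₁ + 2 * L * t) := fun t ht => if_pos ht
  have hγ2 : ∀ t : unitInterval, 1 / 2 < (t : ℝ) → γ t = g (s₁ + 2 * L * (1 - t)) :=
    fun t ht => if_neg (not_le.2 ht)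
  have hb1 : ∀ t : unitInterval, (t : ℝ) ≤ 1 / 2 → s₁ + 2 * L * t ∈ Icc s₁ s₂ := by
    intro t ht
    have := t.2.1
    constructor <;> nlinarith
  have hb2 : ∀ t : unitInterval, 1 / 2 < (t : ℝ) → s₁ + 2 * L * (1 - t) ∈ Icc s₁ s₂ := by
    intro t ht
    have := t.2.2
    constructor <;> nlinarith
  have h01 : γ 0 = γ 1 := by
    rw [hγ1 0 (by norm_num), hγ2 1 (by norm_num)]
    simpa using h1
  set t₁ : unitInterval := ⟨1 / 8, by norm_num, by norm_num⟩ with ht₁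
  set t₂ : unitInterval := ⟨3 / 8, by norm_num, by norm_num⟩ with ht₂
  have hinj : ∀ t t' : unitInterval, (t : ℝ) ≤ 1 / 2 → (t' : ℝ) ≤ 1 / 2 → γ t = γ t' → t = t' := by
    intro t t' ht ht' he
    rw [hγ1 t ht, hγ1 t' ht'] at he
    have h3 := hb1 t ht
    have h4 := hb1 t' ht'
    have := hf.injOn ⟨h0s.trans h3.1, h3.2.trans hsl⟩ ⟨h0s.trans h4.1, h4.2.trans hsl⟩ he
    ext
    have h5 : 2 * L * ((t : ℝ) - t') = 0 := by linarith
    rcases mul_eq_zero.1 h5 with h6 | h6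
    · linarith
    · linarith
  obtain ⟨u, R, P, hu, hγu, hnl⟩ := exists_flatAt_not_hasLog hκ PC hX hγ h01 (t₁ := t₁) (t₂ := t₂)
    (by rw [← Subtype.coe_le_coe]; norm_num)
    (fun he => by
      have := congrArg Subtype.val (hinj t₁ t₂ (by norm_num) (by norm_num) he)
      norm_num at this)
    (fun t ht t' ht' he => by
      have ht'1 : (1 / 8 : ℝ) ≤ t' := ht'.1
      have ht'2 : (t' : ℝ) ≤ 3 / 8 := ht'.2
      rcases le_or_gt (t : ℝ) (1 / 2) with h | h
      · exact ht (hinj t t' h (by linarith) he ▸ ht')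
      · rw [hγ2 t h, hγ1 t' (by linarith)] at he
        have h3 := hb2 t h
        have h4 := hb1 t' (by linarith)
        have h5 := hf.param_eq hg ⟨h0s.trans h4.1, h4.2.trans hsl⟩
          ⟨h0s.trans h3.1, h3.2.trans hsl⟩ he.symm
        rw [← h5] at he
        refine hgap (s₁ + 2 * L * t') ⟨?_, ?_⟩ he.symm
        · nlinarith
        · nlinarith)
  have hfu : ∀ s ∈ Icc s₁ s₂, f s ≠ u := by
    intro s hs he
    have h3 : (s - s₁) / (2 * L) ≤ 1 / 2 := by
      rw [div_le_iff₀ (by positivity)]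
      linarith [hs.2]
    have h4 : 0 ≤ (s - s₁) / (2 * L) := div_nonneg (by linarith [hs.1]) (by positivity)
    refine hγu ⟨(s - s₁) / (2 * L), h4, by linarith⟩ ?_
    rw [hγ1 _ h3, ← he]
    congr 1
    simp only
    field_simp
    ring
  have hgu : ∀ s ∈ Icc s₁ s₂, g s ≠ u := by
    intro s hs
    rcases eq_or_lt_of_le hs.2 with h | h
    · rw [h, ← h2]
      exact hfu s₂ ⟨hlt.le, le_rfl⟩
    intro he
    have h3 : (s - s₁) / (2 * L) < 1 / 2 := by
      rw [div_lt_iff₀ (by positivity)]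
      linarith
    have h4 : 0 ≤ (s - s₁) / (2 * L) := div_nonneg (by linarith [hs.1]) (by positivity)
    refine hγu ⟨1 - (s - s₁) / (2 * L), by linarith, by linarith⟩ ?_
    rw [hγ2 _ (by simp only; linarith), ← he]
    congr 1
    simp only
    field_simp
    ring
  have hgdc : ∀ a, Continuous fun z => gd u z a := fun a =>
    (hX.continuous_gd u).comp (continuous_id.prodMk continuous_const)
  -- directions in which some point of the given geodesic is visible
  let Θ : (ℝ → X) → Set Circle := fun k => (fun s => dir u R P (k s)) ''
    {s | s ∈ Icc s₁ s₂ ∧ ∀ a, gd u (k s) a ∈ ⋂ j, E j}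
  have hΘc : ∀ k : ℝ → X, Continuous k → (∀ s ∈ Icc s₁ s₂, k s ≠ u) → IsClosed (Θ k) := by
    intro k hk hku
    refine (IsCompact.image_of_continuousOn ?_ ?_).isClosed
    · refine isCompact_Icc.inter_right ?_
      have : {s | ∀ a, gd u (k s) a ∈ ⋂ j, E j} = ⋂ a : ℝ, {s | gd u (k s) a ∈ ⋂ j, E j} := by
        ext s
        simp
      change IsClosed {s | ∀ a, gd u (k s) a ∈ ⋂ j, E j}
      rw [this]
      exact isClosed_iInter fun a => (isClosed_iInter hEc).preimage ((hgdc a).comp hk)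
    · exact (hu.continuousOn_dir hX).comp hk.continuousOn fun s hs => hku s hs.1
  have hanti : ∀ k : ℝ → X, IsGeo (⋂ j, E j) x y ℓ k → (∀ s ∈ Icc s₁ s₂, k s ≠ u) →
      ∀ ζ ∈ Θ k, -ζ ∉ Θ k := by
    rintro k hk hku ζ ⟨s, ⟨hs, hv⟩, rfl⟩ ⟨s', ⟨hs', hv'⟩, he⟩
    rcases le_total s s' with h | h
    · exact hu.not_antipodal hX hk (h0s.trans hs.1) (hs'.2.trans hsl) h
        (fun t ht => hku t ⟨hs.1.trans ht.1, ht.2.trans hs'.2⟩) hv hv' he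
    · refine hu.not_antipodal hX hk (h0s.trans hs'.1) (hs.2.trans hsl) h
        (fun t ht => hku t ⟨hs'.1.trans ht.1, ht.2.trans hs.2⟩) hv' hv ?_
      simp only at he
      rw [he, neg_neg]
  have hcov : ∀ ζ, ζ ∈ Θ f ∨ ζ ∈ Θ g := by
    intro ζ
    obtain ⟨t, ht, hv⟩ := hu.exists_visible hκ PC hX hγ h01 hγu hnl hEc hE (fun j t => by
      rcases le_or_gt (t : ℝ) (1 / 2) with h | h
      · rw [hγ1 t h]
        exact mem_iInter.1 (hf.arc.mem _) j
      · rw [hγ2 t h]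
        exact mem_iInter.1 (hg.arc.mem _) j) ζ
    have hv' : ∀ a, gd u (γ t) a ∈ ⋂ j, E j := fun a => mem_iInter.2 fun j => hv j a
    rcases le_or_gt (t : ℝ) (1 / 2) with h | h
    · left
      rw [hγ1 t h] at ht hv'
      exact ⟨_, ⟨hb1 t h, hv'⟩, ht⟩
    · right
      rw [hγ2 t h] at ht hv'
      exact ⟨_, ⟨hb2 t h, hv'⟩, ht⟩
  have hdisj : ∀ ζ, ζ ∈ Θ f → ζ ∉ Θ g := by
    intro ζ h3 h4
    rcases hcov (-ζ) with h | h
    · exact hanti f hf hfu ζ h3 h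
    · exact hanti g hg hgu ζ h4 h
  have hcompl : (Θ f)ᶜ = Θ g := by
    ext ζ
    exact ⟨fun h => (hcov ζ).resolve_left h, fun h h' => hdisj ζ h' h⟩
  have hclopen : IsClopen (Θ f) :=
    ⟨hΘc f hfc hfu, by rw [← isClosed_compl_iff, hcompl]; exact hΘc g hgc hgu⟩
  have := circle_preconnectedSpace
  rcases isClopen_iff.1 hclopen with h | h
  · have hall : ∀ ζ, ζ ∈ Θ g := fun ζ => (hcov ζ).resolve_left (by rw [h]; exact notMem_empty _)
    exact hanti g hg hgu 1 (hall _) (hall _)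
  · have hall : ∀ ζ, ζ ∈ Θ f := fun ζ => by rw [h]; exact mem_univ _
    exact hanti f hf hfu 1 (hall _) (hall _)

end Cat2Cx
end

open Set Metric Filter
noncomputable section
namespace Cat2Cx

variable {X : Type*} [MetricSpace X]

section PathDist

variable {E : Set X} {x y : X}

theorem IsPathIn.rev {g : ℝ → X} (h : IsPathIn E g x y) :
    IsPathIn E (fun t => g (1 - t)) y x := by
  have hm : MapsTo (fun t : ℝ => 1 - t) (Icc 0 1) (Icc 0 1) := fun t ht =>
    ⟨by linarith [ht.2], by linarith [ht.1]⟩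
  exact ⟨h.1.comp (by fun_prop) hm, by simpa using h.2.2.1, by simpa using h.2.1,
    fun t ht => h.2.2.2 (hm ht)⟩

theorem pathDistIn_comm (E : Set X) (x y : X) : pathDistIn E x y = pathDistIn E y x := by
  have key : ∀ x y : X, (⨅ g : {g : ℝ → X // IsPathIn E g x y}, eVariationOn g.1 (Icc 0 1)) ≤
      ⨅ g : {g : ℝ → X // IsPathIn E g y x}, eVariationOn g.1 (Icc 0 1) := by
    intro x y
    refine le_iInf fun g => (iInf_le _ ⟨_, g.2.rev⟩).trans ?_
    refine eVariationOn.comp_le_of_antitoneOn g.1 (fun t => 1 - t) ?_ ?_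
    · intro a _ b _ hab
      simp only
      linarith
    · exact fun t ht => ⟨by linarith [ht.2], by linarith [ht.1]⟩
  unfold pathDistIn
  rw [le_antisymm (key x y) (key y x)]

theorem dist_le_pathDistIn (hE : RectConnected E) (hx : x ∈ E) (hy : y ∈ E) :
    dist x y ≤ pathDistIn E x y := by
  have h1 : edist x y ≤ ⨅ g : {g : ℝ → X // IsPathIn E g x y}, eVariationOn g.1 (Icc 0 1) := by
    refine le_iInf fun g => ?_
    have := eVariationOn.edist_le g.1 (s := Icc (0 : ℝ) 1) (left_mem_Icc.2 zero_le_one)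
      (right_mem_Icc.2 zero_le_one)
    rwa [g.2.2.1, g.2.2.2.1] at this
  obtain ⟨g, hg, hv⟩ := hE x hx y hy
  have h2 : (⨅ g : {g : ℝ → X // IsPathIn E g x y}, eVariationOn g.1 (Icc 0 1)) ≠ ⊤ :=
    ne_top_of_le_ne_top hv (iInf_le (fun g : {g : ℝ → X // IsPathIn E g x y} =>
      eVariationOn g.1 (Icc 0 1)) ⟨g, hg⟩)
  rw [dist_edist]
  exact ENNReal.toReal_mono h2 h1

theorem IsArc.pathDistIn_le {ℓ : ℝ} {f : ℝ → X} (h : IsArc E x y ℓ f) :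
    pathDistIn E x y ≤ ℓ := by
  have hp : IsPathIn E (fun t => f (ℓ * t)) x y :=
    ⟨(h.continuous.comp (by fun_prop)).continuousOn, by simpa using h.zero,
      by simpa using h.end_eq, fun t _ => h.mem _⟩
  have hL : LipschitzOnWith (Real.toNNReal ℓ) (fun t => f (ℓ * t)) (Icc 0 1) := by
    refine LipschitzOnWith.of_dist_le_mul fun s _ t _ => (h.dist_le _ _).trans ?_
    rw [← mul_sub, abs_mul, abs_of_nonneg h.nonneg, Real.dist_eq, Real.coe_toNNReal _ h.nonneg]
  have hv : eVariationOn (fun t => f (ℓ * t)) (Icc 0 1) ≤ ENNReal.ofReal ℓ := by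
    refine (hL.comp_eVariationOn_le (g := fun t : ℝ => t) (s := Icc 0 1)
      (fun t ht => ht)).trans ?_
    have : eVariationOn (fun t : ℝ => t) (Icc 0 1) ≤ ENNReal.ofReal 1 := by
      have := MonotoneOn.eVariationOn_eq (f := fun t : ℝ => t) (s := Icc (0 : ℝ) 1)
        (fun _ _ _ _ h => h) (left_mem_Icc.2 zero_le_one) (right_mem_Icc.2 zero_le_one)
      simpa using this.le
    calc (Real.toNNReal ℓ : ENNReal) * eVariationOn (fun t : ℝ => t) (Icc 0 1)
        ≤ (Real.toNNReal ℓ : ENNReal) * 1 := by gcongr; simpa using this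
      _ = ENNReal.ofReal ℓ := by rw [mul_one]; rfl
  unfold pathDistIn
  refine ENNReal.toReal_le_of_le_ofReal h.nonneg ((iInf_le (fun g : {g : ℝ → X //
    IsPathIn E g x y} => eVariationOn g.1 (Icc 0 1)) ⟨_, hp⟩).trans hv)

/-- A geodesic of the path metric, extended by constants, is an arc of least length in any
set `S ⊆ E` that contains it. -/
theorem isGeo_of_isGeodesicFromTo (hE : RectConnected E) {f : ℝ → X} {S : Set X}
    (hf : IsGeodesicFromTo (pathDistIn E) E f x y) (hS : S ⊆ E)
    (hfS : MapsTo f (Icc 0 (pathDistIn E x y)) S) :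
    IsGeo S x y (pathDistIn E x y) fun t => f (max 0 (min t (pathDistIn E x y))) := by
  obtain ⟨h0, h1, ⟨hd, hiso⟩, hm⟩ := hf
  have hc : ∀ t, max 0 (min t (pathDistIn E x y)) ∈ Icc 0 (pathDistIn E x y) := fun t =>
    ⟨le_max_left _ _, max_le hd (min_le_right _ _)⟩
  refine ⟨⟨hd, fun s t => ?_, fun t => hfS (hc t), fun t ht => ?_, fun t ht => ?_⟩,
    fun m g hg => (hg.mono fun t => hS (hg.mem t)).pathDistIn_le⟩
  · refine (dist_le_pathDistIn hE (hm (hc s)) (hm (hc t))).trans ?_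
    rw [hiso _ (hc s) _ (hc t)]
    refine (abs_max_sub_max_le_max _ _ _ _).trans ?_
    rw [sub_self, abs_zero, max_eq_right (abs_nonneg _)]
    refine (abs_min_sub_min_le_max _ _ _ _).trans ?_
    rw [sub_self, abs_zero, max_eq_left (abs_nonneg _)]
  · rw [max_eq_left ((min_le_left _ _).trans ht), h0]
  · rw [min_eq_right ht, max_eq_right hd, h1]

theorem range_clamp {Z : Type*} {f : ℝ → Z} {d : ℝ} (hd : 0 ≤ d) :
    range (fun t => f (max 0 (min t d))) = f '' Icc 0 d := by
  apply Subset.antisymm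
  · rintro _ ⟨t, rfl⟩
    exact ⟨_, ⟨le_max_left _ _, max_le hd (min_le_right _ _)⟩, rfl⟩
  · rintro _ ⟨t, ht, rfl⟩
    refine ⟨t, ?_⟩
    dsimp only
    rw [min_eq_left ht.2, max_eq_right ht.1]

theorem IsGeodesicFromTo.image_subset_geodSeg {Z : Type*} {E : Set Z} {x y : Z}
    {d : Z → Z → ℝ} {f : ℝ → Z}
    (hf : IsGeodesicFromTo d E f x y) : f '' Icc 0 (d x y) ⊆ geodSeg d E x y :=
  subset_biUnion_of_mem (u := fun f : ℝ → Z => f '' Icc 0 (d x y)) hf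

theorem IsGeodesicFromTo.rev {f : ℝ → X}
    (hf : IsGeodesicFromTo (pathDistIn E) E f x y) :
    IsGeodesicFromTo (pathDistIn E) E (fun t => f (pathDistIn E x y - t)) y x := by
  obtain ⟨h0, h1, ⟨hd, hiso⟩, hm⟩ := hf
  unfold IsGeodesicFromTo IsGeodesicWrt
  rw [pathDistIn_comm E y x]
  have hc : ∀ t ∈ Icc 0 (pathDistIn E x y),
      pathDistIn E x y - t ∈ Icc 0 (pathDistIn E x y) := fun t ht =>
    ⟨by linarith [ht.2], by linarith [ht.1]⟩
  refine ⟨by simpa using h1, by simpa using h0, ⟨hd, fun s hs t ht => ?_⟩,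
    fun t ht => hm (hc t ht)⟩
  rw [hiso _ (hc s hs) _ (hc t ht), abs_sub_comm s t]
  congr 1
  ring

theorem IsGeodesicFromTo.restrict {f : ℝ → X}
    (hf : IsGeodesicFromTo (pathDistIn E) E f x y) {t : ℝ}
    (ht : t ∈ Icc 0 (pathDistIn E x y)) :
    pathDistIn E x (f t) = t ∧ IsGeodesicFromTo (pathDistIn E) E f x (f t) := by
  obtain ⟨h0, h1, ⟨hd, hiso⟩, hm⟩ := hf
  have h : pathDistIn E x (f t) = t := by
    have := hiso 0 ⟨le_rfl, hd⟩ t ht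
    rwa [h0, zero_sub, abs_neg, abs_of_nonneg ht.1] at this
  refine ⟨h, h0, by rw [h], ?_, ?_⟩ <;> rw [h]
  · exact ⟨ht.1, fun s hs u hu => hiso s ⟨hs.1, hs.2.trans ht.2⟩ u ⟨hu.1, hu.2.trans ht.2⟩⟩
  · exact fun s hs => hm ⟨hs.1, hs.2.trans ht.2⟩

/-- Least-length arcs in `S` are determined by their endpoints. -/
def UniqueGeo (S : Set X) : Prop :=
  ∀ ⦃x y : X⦄ ⦃ℓ : ℝ⦄ ⦃f g : ℝ → X⦄, IsGeo S x y ℓ f → IsGeo S x y ℓ g → f = g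

theorem geodSeg_eq_range (hE : RectConnected E) {S : Set X} (hS : S ⊆ E) (hU : UniqueGeo S)
    (hseg : geodSeg (pathDistIn E) E x y ⊆ S) {f : ℝ → X}
    (hf : IsGeodesicFromTo (pathDistIn E) E f x y) :
    IsGeo S x y (pathDistIn E x y) (fun t => f (max 0 (min t (pathDistIn E x y)))) ∧
    geodSeg (pathDistIn E) E x y = range fun t => f (max 0 (min t (pathDistIn E x y))) := by
  have key : ∀ {g : ℝ → X}, IsGeodesicFromTo (pathDistIn E) E g x y →
      IsGeo S x y (pathDistIn E x y) fun t => g (max 0 (min t (pathDistIn E x y))) :=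
    fun {g} hg => isGeo_of_isGeodesicFromTo hE hg hS fun t ht =>
      hseg (hg.image_subset_geodSeg ⟨t, ht, rfl⟩)
  refine ⟨key hf, Subset.antisymm (iUnion₂_subset fun g hg => ?_) ?_⟩
  · rw [hU (key hf) (key hg), range_clamp hf.2.2.1.1]
  · rw [range_clamp hf.2.2.1.1]
    exact hf.image_subset_geodSeg

end PathDist

end Cat2Cx
end

open Set Metric Filter
noncomputable section
namespace Cat2Cx

variable {X : Type*} [MetricSpace X]

theorem SCC.isPreconnected_diff (γ : SCC X) (z : X) : IsPreconnected (γ.img \ {z}) := by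
  by_cases hz : z ∈ γ.img
  swap
  · rw [sdiff_singleton_eq_self hz]
    exact isPreconnected_Icc.image _ γ.contOn
  obtain ⟨s, hs, hsz⟩ : ∃ s ∈ Ico (0 : ℝ) 1, γ.toFun s = z := by
    obtain ⟨s, hs, hsz⟩ := hz
    rcases hs.2.lt_or_eq with h | h
    · exact ⟨s, ⟨hs.1, h⟩, hsz⟩
    · exact ⟨0, ⟨le_rfl, zero_lt_one⟩, by rw [γ.loop, ← h, hsz]⟩
  have hne : ∀ t ∈ Icc (0 : ℝ) 1, γ.toFun t = z → t = s ∨ (t = 1 ∧ s = 0) := by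
    intro t ht h
    rcases ht.2.lt_or_eq with h1 | h1
    · exact Or.inl (γ.inj ⟨ht.1, h1⟩ hs (h.trans hsz.symm))
    · refine Or.inr ⟨h1, ?_⟩
      rw [h1, ← γ.loop] at h
      exact (γ.inj ⟨le_rfl, zero_lt_one⟩ hs (h.trans hsz.symm)).symm
  rcases hs.1.lt_or_eq with hs0 | hs0
  · have he : γ.img \ {z} = γ.toFun '' Ico 0 s ∪ γ.toFun '' Ioc s 1 := by
      ext w
      constructor
      · rintro ⟨⟨t, ht, rfl⟩, hw⟩
        rcases lt_trichotomy t s with h | h | h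
        · exact Or.inl ⟨t, ⟨ht.1, h⟩, rfl⟩
        · exact absurd (by rw [h, hsz]; rfl) hw
        · exact Or.inr ⟨t, ⟨h, ht.2⟩, rfl⟩
      · rintro (⟨t, ht, rfl⟩ | ⟨t, ht, rfl⟩)
        · have ht1 : t ∈ Icc (0 : ℝ) 1 := ⟨ht.1, ht.2.le.trans hs.2.le⟩
          refine ⟨⟨t, ht1, rfl⟩, fun h => ?_⟩
          rcases hne t ht1 h with h | h
          · exact ht.2.ne h
          · exact hs0.ne' h.2
        · have ht1 : t ∈ Icc (0 : ℝ) 1 := ⟨hs.1.trans ht.1.le, ht.2⟩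
          refine ⟨⟨t, ht1, rfl⟩, fun h => ?_⟩
          rcases hne t ht1 h with h | h
          · exact ht.1.ne' h
          · exact hs0.ne' h.2
    rw [he]
    refine IsPreconnected.union (γ.toFun 0) ⟨0, ⟨le_rfl, hs0⟩, rfl⟩ ⟨1, ⟨hs.2, le_rfl⟩, γ.loop.symm⟩
      (isPreconnected_Ico.image _ (γ.contOn.mono fun t ht => ⟨ht.1, ht.2.le.trans hs.2.le⟩))
      (isPreconnected_Ioc.image _ (γ.contOn.mono fun t ht => ⟨hs.1.trans ht.1.le, ht.2⟩))
  · have he : γ.img \ {z} = γ.toFun '' Ioo 0 1 := by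
      ext w
      constructor
      · rintro ⟨⟨t, ht, rfl⟩, hw⟩
        refine ⟨t, ⟨lt_of_le_of_ne ht.1 fun h => hw ?_, lt_of_le_of_ne ht.2 fun h => hw ?_⟩, rfl⟩
        · rw [← h, hs0, hsz]; rfl
        · rw [h, ← γ.loop, hs0, hsz]; rfl
      · rintro ⟨t, ht, rfl⟩
        have ht1 : t ∈ Icc (0 : ℝ) 1 := ⟨ht.1.le, ht.2.le⟩
        refine ⟨⟨t, ht1, rfl⟩, fun h => ?_⟩
        rcases hne t ht1 h with h | h
        · exact ht.1.ne (hs0.trans h.symm)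
        · exact ht.2.ne h.1
    rw [he]
    exact isPreconnected_Ioo.image _ (γ.contOn.mono Ioo_subset_Icc_self)

/-- A simple closed curve has no cut point. -/
theorem SCC.no_cut (γ : SCC X) {A B : Set X} (hA : IsClosed A) (hB : IsClosed B)
    (hAB : γ.img = A ∪ B) {z a b : X} (hz : A ∩ B ⊆ {z}) (ha : a ∈ A) (haz : a ≠ z)
    (hb : b ∈ B) (hbz : b ≠ z) : False := by
  have h := isPreconnected_closed_iff.1 (γ.isPreconnected_diff z) A B hA hB
    (fun w hw => hAB ▸ hw.1) ⟨a, ⟨hAB ▸ Or.inl ha, haz⟩, ha⟩ ⟨b, ⟨hAB ▸ Or.inr hb, hbz⟩, hb⟩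
  obtain ⟨w, hw, hw'⟩ := h
  exact hw.2 (hz hw')

theorem range_rev {Z : Type*} (f : ℝ → Z) (ℓ : ℝ) : range (fun t => f (ℓ - t)) = range f := by
  apply Subset.antisymm
  · rintro _ ⟨t, rfl⟩
    exact ⟨_, rfl⟩
  · rintro _ ⟨t, rfl⟩
    exact ⟨ℓ - t, by simp⟩

namespace IsGeo

variable {S : Set X} {x y x' y' : X} {ℓ m : ℝ} {f g : ℝ → X}

theorem eq_of_eq (hU : UniqueGeo S) (hf : IsGeo S x y ℓ f) (hg : IsGeo S x' y' m g)
    {a a' b b' : ℝ} (ha : 0 ≤ a) (haa : a ≤ a') (ha' : a' ≤ ℓ) (hb : 0 ≤ b) (hbb : b ≤ b')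
    (hb' : b' ≤ m) (h : f a = g b) (h' : f a' = g b') :
    a' - a = b' - b ∧ ∀ u ∈ Icc 0 (a' - a), f (a + u) = g (b + u) := by
  have h1 := hf.sub ha haa ha'
  have h2 := hg.sub hb hbb hb'
  rw [← h, ← h'] at h2
  have hl := h1.length_eq h2
  refine ⟨hl, fun u hu => ?_⟩
  rw [← hl] at h2
  have := congrFun (hU h1 h2) u
  rwa [min_eq_left (by linarith [hu.2]), max_eq_right (by linarith [hu.1]),
    min_eq_left (by linarith [hu.2]), max_eq_right (by linarith [hu.1])] at this

/-- If a geodesic meets another one at two parameters, the part in between is contained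
in the other one. -/
theorem mem_image_of_mem_Icc (hU : UniqueGeo S) (hf : IsGeo S x y ℓ f) (hg : IsGeo S x' y' m g)
    {a a' b b' : ℝ} (ha : 0 ≤ a) (ha' : a' ≤ ℓ) (hb : b ∈ Icc 0 m) (hb' : b' ∈ Icc 0 m)
    (h : f a = g b) (h' : f a' = g b') {t : ℝ} (ht : t ∈ Icc a a') :
    f t ∈ g '' uIcc b b' := by
  have haa := ht.1.trans ht.2
  rcases le_total b b' with hbb | hbb
  · obtain ⟨hl, he⟩ := hf.eq_of_eq hU hg ha haa ha' hb.1 hbb hb'.2 h h'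
    refine ⟨b + (t - a), ?_, ?_⟩
    · rw [uIcc_of_le hbb]
      exact ⟨by linarith [ht.1], by linarith [ht.2]⟩
    · rw [← he (t - a) ⟨by linarith [ht.1], by linarith [ht.2]⟩, add_sub_cancel]
  · obtain ⟨hl, he⟩ := hf.eq_of_eq hU hg.rev ha haa ha' (b := m - b) (b' := m - b')
      (by linarith [hb.2]) (by linarith) (by linarith [hb'.1]) (by simpa using h)
      (by simpa using h')
    refine ⟨b - (t - a), ?_, ?_⟩
    · rw [uIcc_of_ge hbb]
      exact ⟨by linarith [ht.2], by linarith [ht.1]⟩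
    · have := he (t - a) ⟨by linarith [ht.1], by linarith [ht.2]⟩
      rw [add_sub_cancel] at this
      rw [this]
      congr 1
      ring

theorem range_eq (hf : IsGeo S x y ℓ f) : range f = f '' Icc 0 ℓ := by
  apply Subset.antisymm
  · rintro _ ⟨t, rfl⟩
    have h0 := hf.arc.nonneg
    rcases le_total t 0 with h | h
    · exact ⟨0, ⟨le_rfl, h0⟩, by rw [hf.arc.left t h, hf.arc.zero]⟩
    rcases le_total ℓ t with h' | h'
    · exact ⟨ℓ, ⟨h0, le_rfl⟩, by rw [hf.arc.right t h', hf.arc.end_eq]⟩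
    · exact ⟨t, ⟨h, h'⟩, rfl⟩
  · exact image_subset_range _ _

theorem isClosed_image (hf : IsGeo S x y ℓ f) (a b : ℝ) : IsClosed (f '' Icc a b) :=
  (isCompact_Icc.image hf.arc.continuous).isClosed

/-- Geodesics from a common point meet at equal parameters and agree up to there. -/
theorem agree (hU : UniqueGeo S) (hf : IsGeo S x y ℓ f) (hg : IsGeo S x y' m g) {s t : ℝ}
    (hs : s ∈ Icc 0 ℓ) (ht : t ∈ Icc 0 m) (h : f s = g t) :
    s = t ∧ ∀ u ∈ Icc 0 s, f u = g u := by
  obtain ⟨h1, h2⟩ := hf.eq_of_eq hU hg le_rfl hs.1 hs.2 le_rfl ht.1 ht.2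
    (by rw [hf.arc.zero, hg.arc.zero]) h
  simp only [sub_zero, zero_add] at h1 h2
  exact ⟨h1, h2⟩

end IsGeo

section Corner

variable {S : Set X} {a b c : X} {ℓ m n s : ℝ} {f g h : ℝ → X}

theorem SCC.no_common_segment (γ : SCC X) (hf : IsGeo S a b ℓ f)
    (hg : IsGeo S a c m g) {H : Set X} (hH : IsClosed H) (hγ : γ.img = range f ∪ range g ∪ H)
    (hs : s ∈ Ioc 0 ℓ) (hsm : s ≤ m) (hfg : ∀ u ∈ Icc 0 s, f u = g u)
    (hHs : ∀ u ∈ Icc 0 (s / 2), f u ∉ H) : False := by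
  have hs0 := hs.1
  refine γ.no_cut (A := f '' Icc 0 (s / 2))
    (B := f '' Icc (s / 2) ℓ ∪ g '' Icc (s / 2) m ∪ H) (z := f (s / 2)) (a := f 0) (b := f s)
    (hf.isClosed_image _ _) (((hf.isClosed_image _ _).union (hg.isClosed_image _ _)).union hH)
    ?_ ?_ ⟨0, ⟨le_rfl, by linarith⟩, rfl⟩ ?_ (Or.inl (Or.inl ⟨s, ⟨by linarith, hs.2⟩, rfl⟩)) ?_
  · rw [hγ, hf.range_eq, hg.range_eq]
    apply Subset.antisymm
    · rintro w ((⟨t, ht, rfl⟩ | ⟨t, ht, rfl⟩) | hw)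
      · rcases le_total t (s / 2) with h | h
        · exact Or.inl ⟨t, ⟨ht.1, h⟩, rfl⟩
        · exact Or.inr (Or.inl (Or.inl ⟨t, ⟨h, ht.2⟩, rfl⟩))
      · rcases le_total t (s / 2) with h | h
        · exact Or.inl ⟨t, ⟨ht.1, h⟩, hfg t ⟨ht.1, by linarith⟩⟩
        · exact Or.inr (Or.inl (Or.inr ⟨t, ⟨h, ht.2⟩, rfl⟩))
      · exact Or.inr (Or.inr hw)
    · rintro w (⟨t, ht, rfl⟩ | (⟨t, ht, rfl⟩ | ⟨t, ht, rfl⟩) | hw)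
      · exact Or.inl (Or.inl ⟨t, ⟨ht.1, by linarith [ht.2, hs.2]⟩, rfl⟩)
      · exact Or.inl (Or.inl ⟨t, ⟨by linarith [ht.1], ht.2⟩, rfl⟩)
      · exact Or.inl (Or.inr ⟨t, ⟨by linarith [ht.1], ht.2⟩, rfl⟩)
      · exact Or.inr hw
  · rintro _ ⟨⟨t, ht, rfl⟩, (⟨u, hu, he⟩ | ⟨u, hu, he⟩) | hw⟩
    · have := hf.injOn ⟨by linarith [hu.1], hu.2⟩ ⟨ht.1, by linarith [ht.2, hs.2]⟩ he
      have : t = s / 2 := by linarith [hu.1, ht.2]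
      rw [this]; rfl
    · rw [hfg t ⟨ht.1, by linarith [ht.2]⟩] at he
      have := hg.injOn ⟨by linarith [hu.1], hu.2⟩ ⟨ht.1, by linarith [ht.2, hs.2]⟩ he
      have : t = s / 2 := by linarith [hu.1, ht.2]
      rw [this]; rfl
    · exact absurd hw (hHs t ht)
  · intro he
    have := hf.injOn ⟨le_rfl, by linarith [hs.2]⟩ ⟨by linarith, by linarith [hs.2]⟩ he
    linarith
  · intro he
    have := hf.injOn ⟨by linarith, hs.2⟩ ⟨by linarith, by linarith [hs.2]⟩ he
    linarith

/-- The union of two geodesics from a common point is not a simple closed curve. -/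
theorem SCC.ne_union_of_two_geo (hU : UniqueGeo S) (γ : SCC X) (hf : IsGeo S a b ℓ f)
    (hg : IsGeo S a c m g) : γ.img ≠ range f ∪ range g := by
  have key : ∀ {b c : X} {ℓ m s : ℝ} {f g : ℝ → X}, IsGeo S a b ℓ f → IsGeo S a c m g →
      γ.img = range f ∪ range g → ∀ s ∈ Icc 0 ℓ, f s ≠ a → f s ∉ range g := by
    intro b c ℓ m s f g hf hg hγ s hs hsa hmem
    rw [hg.range_eq] at hmem
    obtain ⟨t, ht, he⟩ := hmem
    obtain ⟨h1, h2⟩ := hf.agree hU hg hs ht he.symm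
    refine γ.no_common_segment hf hg (H := ∅) isClosed_empty (by rw [hγ, union_empty])
      (s := s) ⟨lt_of_le_of_ne hs.1 fun h0 => hsa ?_, hs.2⟩ (h1 ▸ ht.2) h2
      fun u _ => notMem_empty _
    rw [← h0, hf.arc.zero]
  intro hγ
  have hfa : ∀ {b : X} {ℓ : ℝ} {f : ℝ → X}, IsGeo S a b ℓ f → γ.img = range f → False := by
    intro b ℓ f hf hγ
    have hs : γ.toFun 0 ≠ γ.toFun (1 / 2) := fun h => by
      have := γ.inj ⟨le_rfl, zero_lt_one⟩ ⟨by norm_num, by norm_num⟩ h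
      norm_num at this
    have h0 : γ.toFun 0 ∈ γ.img := ⟨0, ⟨le_rfl, zero_le_one⟩, rfl⟩
    have h1 : γ.toFun (1 / 2) ∈ γ.img := ⟨1 / 2, ⟨by norm_num, by norm_num⟩, rfl⟩
    have : ∃ w ∈ range f, w ≠ a := by
      by_contra! hc
      rw [hγ] at h0 h1
      exact hs ((hc _ h0).trans (hc _ h1).symm)
    obtain ⟨w, hw, hwa⟩ := this
    have hw' := hw
    rw [hf.range_eq] at hw'
    obtain ⟨s, hs, rfl⟩ := hw'
    exact key (s := s) hf hf (by rw [hγ, union_self]) s hs hwa hw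
  have hone : ∀ {b c : X} {ℓ m : ℝ} {f g : ℝ → X}, IsGeo S a b ℓ f → IsGeo S a c m g →
      γ.img = range f ∪ range g → ∃ w ∈ range g, w ≠ a := by
    intro b c ℓ m f g hf hg hγ
    by_contra! hc
    refine hfa hf ?_
    rw [hγ, union_eq_left]
    intro w hw
    exact ⟨0, by rw [hf.arc.zero, hc w hw]⟩
  obtain ⟨w, hw, hwa⟩ := hone hf hg hγ
  obtain ⟨v, hv, hva⟩ := hone hg hf (by rw [hγ, union_comm])
  refine γ.no_cut (A := range f) (B := range g) (z := a) (a := v) (b := w) ?_ ?_ hγ ?_ hv hva hw hwa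
  · rw [hf.range_eq]; exact hf.isClosed_image _ _
  · rw [hg.range_eq]; exact hg.isClosed_image _ _
  · rintro _ ⟨hf', hg'⟩
    by_contra hne
    rw [hf.range_eq] at hf'
    obtain ⟨s, hs, rfl⟩ := hf'
    exact key (s := s) hf hg hγ s hs hne hg'

/-- Two sides of a simple triangle meet only at their common vertex. -/
theorem SCC.corner (hU : UniqueGeo S) (γ : SCC X) (hf : IsGeo S a b ℓ f) (hg : IsGeo S a c m g)
    (hh : IsGeo S b c n h) (hγ : γ.img = range f ∪ range g ∪ range h) {x : X}
    (hxf : x ∈ range f) (hxg : x ∈ range g) : x = a := by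
  by_contra hxa
  rw [hf.range_eq] at hxf
  rw [hg.range_eq] at hxg
  obtain ⟨s, hs, rfl⟩ := hxf
  obtain ⟨t, ht, he⟩ := hxg
  obtain ⟨h1, h2⟩ := hf.agree hU hg hs ht he.symm
  have hs0 : 0 < s := lt_of_le_of_ne hs.1 fun h0 => hxa (by rw [← h0, hf.arc.zero])
  have hsm : s ≤ m := h1 ▸ ht.2
  refine γ.no_common_segment hf hg (H := range h)
    (by rw [hh.range_eq]; exact hh.isClosed_image _ _) hγ ⟨hs0, hs.2⟩ hsm h2 ?_
  intro u hu hmem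
  rw [hh.range_eq] at hmem
  obtain ⟨v, hv, hve⟩ := hmem
  have hn := hh.arc.nonneg
  have e1 := hf.mem_image_of_mem_Icc hU hh hu.1 le_rfl hv ⟨le_rfl, hn⟩ hve.symm
    (by rw [hf.arc.end_eq, hh.arc.zero]) (t := s) ⟨by linarith [hu.2], hs.2⟩
  have e2 := hg.mem_image_of_mem_Icc hU hh hu.1 le_rfl hv ⟨hn, le_rfl⟩
    (by rw [hve, h2 u ⟨hu.1, by linarith [hu.2]⟩]) (by rw [hg.arc.end_eq, hh.arc.end_eq])
    (t := s) ⟨by linarith [hu.2], hsm⟩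
  obtain ⟨v₁, hv₁, hv₁e⟩ := e1
  obtain ⟨v₂, hv₂, hv₂e⟩ := e2
  rw [uIcc_of_ge hv.1] at hv₁
  rw [uIcc_of_le hv.2] at hv₂
  have h3 := hh.injOn ⟨hv₁.1, hv₁.2.trans hv.2⟩ ⟨hv.1.trans hv₂.1, hv₂.2⟩
    (hv₁e.trans ((h2 s ⟨hs.1, le_rfl⟩).trans hv₂e.symm))
  have h4 : v₁ = v := le_antisymm hv₁.2 (h3 ▸ hv₂.1)
  rw [h4, hve] at hv₁e
  have := hf.injOn ⟨hu.1, by linarith [hu.2, hs.2]⟩ hs hv₁e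
  linarith [hu.2]

/-- A vertex of a simple triangle is not on the opposite side. -/
theorem SCC.apex (hU : UniqueGeo S) (γ : SCC X) (hf : IsGeo S a b ℓ f) (hg : IsGeo S a c m g)
    (hh : IsGeo S b c n h) (hγ : γ.img = range f ∪ range g ∪ range h) : a ∉ range h := by
  intro ha
  have hr : range (fun t => f (ℓ - t)) = range f := range_rev f ℓ
  have hab : a = b := γ.corner hU hf.rev hh hg
    (by rw [hγ, hr, union_right_comm]) (hr ▸ ⟨0, hf.arc.zero⟩) ha
  subst hab
  refine γ.ne_union_of_two_geo hU hg hh ?_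
  rw [hγ, union_assoc, union_eq_right]
  rintro w hw
  rw [hf.range_eq] at hw
  obtain ⟨t, ht, rfl⟩ := hw
  have hl := hf.le _ _ (IsArc.const (hf.arc.zero ▸ hf.arc.mem 0))
  exact Or.inl ⟨0, by rw [hg.arc.zero, hf.arc.left t (ht.2.trans hl)]⟩

end Corner

end Cat2Cx
end

open Set Metric Filter
noncomputable section
namespace Cat2Cx

variable {X : Type*} [MetricSpace X]

theorem continuous_of_isClosed_graph {Y Z : Type*} [TopologicalSpace Y] [TopologicalSpace Z]
    [CompactSpace Z] {f : Y → Z} (h : IsClosed {w : Y × Z | w.2 = f w.1}) : Continuous f := by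
  rw [continuous_iff_isClosed]
  intro C hC
  have : f ⁻¹' C = Prod.fst '' ({w : Y × Z | w.2 = f w.1} ∩ Prod.snd ⁻¹' C) := by
    ext y
    constructor
    · exact fun hy => ⟨(y, f y), ⟨rfl, hy⟩, rfl⟩
    · rintro ⟨⟨y, z⟩, ⟨hz, hzC⟩, rfl⟩
      have hz : z = f y := hz
      exact hz ▸ hzC
  rw [this]
  exact isClosedMap_fst_of_compactSpace _ (h.inter (hC.preimage continuous_snd))

section Compact

variable {S : Set X} {x y : X} {ℓ : ℝ} {f : ℝ → X}

theorem isArc_iff : IsArc S x y ℓ f ↔ 0 ≤ ℓ ∧ (∀ s t, dist (f s) (f t) ≤ |s - t|) ∧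
    (∀ t, f t ∈ S) ∧ (∀ t, dist (f t) x ≤ max 0 t) ∧ ∀ t, dist (f t) y ≤ max 0 (ℓ - t) := by
  constructor
  · intro h
    refine ⟨h.nonneg, h.dist_le, h.mem, fun t => ?_, fun t => ?_⟩
    · rcases le_total t 0 with ht | ht
      · rw [h.left t ht, dist_self]; exact le_max_left _ _
      · have := h.dist_le t 0
        rw [h.zero, sub_zero, abs_of_nonneg ht] at this
        exact this.trans (le_max_right _ _)
    · rcases le_total ℓ t with ht | ht
      · rw [h.right t ht, dist_self]; exact le_max_left _ _
      · have := h.dist_le t ℓ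
        rw [h.end_eq, abs_sub_comm, abs_of_nonneg (sub_nonneg.2 ht)] at this
        exact this.trans (le_max_right _ _)
  · rintro ⟨h0, hd, hm, hl, hr⟩
    refine ⟨h0, hd, hm, fun t ht => dist_le_zero.1 ?_, fun t ht => dist_le_zero.1 ?_⟩
    · have := hl t
      rwa [max_eq_left ht] at this
    · have := hr t
      rwa [max_eq_left (sub_nonpos.2 ht)] at this

theorem isClosed_setOf_isArc (hS : IsClosed S) :
    IsClosed {w : X × ℝ × (ℝ → X) | IsArc S x w.1 w.2.1 w.2.2} := by
  simp only [isArc_iff, ofPred_and, ofPred_forall]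
  refine IsClosed.inter ?_ (IsClosed.inter ?_ (IsClosed.inter ?_ (IsClosed.inter ?_ ?_)))
  · exact isClosed_le continuous_const (by fun_prop)
  · exact isClosed_iInter fun s => isClosed_iInter fun t =>
      isClosed_le (by fun_prop) continuous_const
  · exact isClosed_iInter fun t => hS.preimage (by fun_prop)
  · exact isClosed_iInter fun t => isClosed_le (by fun_prop) continuous_const
  · exact isClosed_iInter fun t => isClosed_le (by fun_prop) (by fun_prop)

theorem exists_isGeo (hS : IsCompact S) (h : IsArc S x y ℓ f) : ∃ m g, IsGeo S x y m g := by
  have hc : IsCompact (({y} : Set X) ×ˢ (Icc 0 ℓ ×ˢ (pi univ fun _ : ℝ => S))) :=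
    isCompact_singleton.prod (isCompact_Icc.prod (isCompact_univ_pi fun _ => hS))
  have hc' := hc.inter_right (isClosed_setOf_isArc (x := x) hS.isClosed)
  obtain ⟨⟨y', m, g⟩, ⟨⟨hy, -, -⟩, hg⟩, hmin⟩ := hc'.exists_isMinOn
    ⟨(y, ℓ, f), ⟨rfl, ⟨h.nonneg, le_rfl⟩, fun t _ => h.mem t⟩, h⟩
    (f := fun w => w.2.1) (by fun_prop)
  have hy : y' = y := hy
  subst hy
  have hg : IsArc S x y' m g := hg
  refine ⟨m, g, hg, fun k u hu => ?_⟩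
  have hmℓ : m ≤ ℓ := isMinOn_iff.1 hmin (y', ℓ, f)
    ⟨⟨rfl, ⟨h.nonneg, le_rfl⟩, fun t _ => h.mem t⟩, h⟩
  rcases le_total k ℓ with hk | hk
  · exact isMinOn_iff.1 hmin (y', k, u) ⟨⟨rfl, ⟨hu.nonneg, hk⟩, fun t _ => hu.mem t⟩, hu⟩
  · exact hmℓ.trans hk

/-- The geodesics from a point `q` to the points of an arc form a continuous family. -/
theorem exists_fan (hS : IsCompact S) (hU : UniqueGeo S) {q : X} {L : ℝ} {μ : ℝ → X}
    (hμ : IsArc S x y L μ) (hf : IsArc S q x ℓ f) :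
    ∃ (H : ℝ × ℝ → X) (d : ℝ → ℝ) (D : ℝ), Continuous H ∧ 0 ≤ D ∧ (∀ t, d t ≤ D) ∧
      ∀ t, IsGeo S q (μ t) (d t) fun u => H (t, u) := by
  have harc : ∀ t, ∃ m g, IsArc S q (μ t) m g := by
    intro t
    have := hμ.sub (a := min 0 t) (b := t) (min_le_right _ _)
    rw [hμ.left _ (min_le_left _ _)] at this
    exact ⟨_, _, hf.trans this⟩
  have hgeo : ∀ t, ∃ m g, IsGeo S q (μ t) m g := fun t => by
    obtain ⟨m, g, h⟩ := harc t
    exact exists_isGeo hS h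
  choose d G hG using hgeo
  have hd : ∀ s t, d t ≤ d s + |s - t| := by
    intro s t
    rcases le_total s t with h | h
    · have := (hG t).le _ _ ((hG s).arc.trans (hμ.sub h))
      rw [abs_sub_comm, abs_of_nonneg (sub_nonneg.2 h)]
      exact this
    · have := (hG t).le _ _ ((hG s).arc.trans (hμ.sub h).rev)
      rw [abs_of_nonneg (sub_nonneg.2 h)]
      exact this
  have hdc : Continuous d := by
    refine (LipschitzWith.of_dist_le_mul (K := 1) fun s t => ?_).continuous
    rw [NNReal.coe_one, one_mul, Real.dist_eq, Real.dist_eq, abs_le]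
    have h1 := hd s t
    have h2 := hd t s
    rw [abs_sub_comm] at h2
    constructor <;> linarith
  have : CompactSpace S := isCompact_iff_compactSpace.1 hS
  let G' : ℝ → ℝ → S := fun t u => ⟨G t u, (hG t).arc.mem u⟩
  have hG' : Continuous G' := by
    apply continuous_of_isClosed_graph
    have he : {w : ℝ × (ℝ → S) | w.2 = G' w.1} =
        (fun w : ℝ × (ℝ → S) => (μ w.1, d w.1, fun u => (w.2 u : X))) ⁻¹'
          {w : X × ℝ × (ℝ → X) | IsArc S q w.1 w.2.1 w.2.2} := by
      ext ⟨t, g⟩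
      constructor
      · intro h
        have h : g = G' t := h
        subst h
        exact (hG t).arc
      · intro h
        have h : IsArc S q (μ t) (d t) fun u => (g u : X) := h
        have := hU ⟨h, (hG t).le⟩ (hG t)
        exact funext fun u => Subtype.ext (congrFun this u)
    rw [he]
    refine (isClosed_setOf_isArc hS.isClosed).preimage ?_
    have := hμ.continuous
    fun_prop
  have hGu : ∀ u, Continuous fun t => G t u := fun u =>
    continuous_subtype_val.comp ((continuous_apply u).comp hG')
  refine ⟨fun w => G w.1 w.2, d, d 0 + |L|, ?_, ?_, ?_, fun t => hG t⟩
  · rw [continuous_iff_continuousAt]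
    rintro ⟨t, u⟩
    rw [ContinuousAt, tendsto_iff_dist_tendsto_zero]
    have h1 : Tendsto (fun w : ℝ × ℝ => |w.2 - u| + dist (G w.1 u) (G t u)) (nhds (t, u))
        (nhds 0) := by
      have hc : Continuous fun w : ℝ × ℝ => |w.2 - u| + dist (G w.1 u) (G t u) := by
        have := (hGu u).comp (continuous_fst (X := ℝ) (Y := ℝ))
        have h2 : Continuous fun w : ℝ × ℝ => G w.1 u := this
        fun_prop
      have := hc.tendsto (t, u)
      simpa using this
    refine squeeze_zero (fun _ => dist_nonneg) (fun w => ?_) h1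
    exact (dist_triangle _ (G w.1 u) _).trans (add_le_add ((hG w.1).arc.dist_le _ _) le_rfl)
  · exact add_nonneg (hG 0).arc.nonneg (abs_nonneg _)
  · have hL := hμ.nonneg
    intro t
    rcases le_total t 0 with h | h
    · have e : μ t = μ 0 := by rw [hμ.left t h, hμ.zero]
      have hGt := hG t
      rw [e] at hGt
      rw [hGt.length_eq (hG 0)]
      linarith [abs_nonneg L]
    rcases le_total L t with h' | h'
    · have e : μ t = μ L := by rw [hμ.right t h', hμ.end_eq]
      have hGt := hG t
      rw [e] at hGt
      rw [hGt.length_eq (hG L)]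
      have := hd 0 L
      rwa [zero_sub, abs_neg] at this
    · have := hd 0 t
      rw [zero_sub, abs_neg, abs_of_nonneg h] at this
      rw [abs_of_nonneg hL]
      linarith

/-- A fan of geodesics avoiding `p` stays away from `p`. -/
theorem exists_fan_avoiding (hS : IsCompact S) (hU : UniqueGeo S) {p q : X} {L : ℝ}
    {μ : ℝ → X} (hμ : IsArc S x y L μ) (hf : IsArc S q x ℓ f)
    (hp : ∀ t ∈ Icc 0 L, ∀ m g, IsGeo S q (μ t) m g → p ∉ range g) :
    ∃ (H : ℝ × ℝ → X) (d : ℝ → ℝ) (D : ℝ), Continuous H ∧ 0 ≤ D ∧ (∀ t, d t ≤ D) ∧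
      (∀ t, IsGeo S q (μ t) (d t) fun u => H (t, u)) ∧ ∃ ε > 0, ∀ w, ε ≤ dist p (H w) := by
  obtain ⟨H, d, D, hH, hD, hdD, hG⟩ := exists_fan hS hU hμ hf
  refine ⟨H, d, D, hH, hD, hdD, hG, ?_⟩
  have hL := hμ.nonneg
  have hc : IsCompact (Icc (0 : ℝ) L ×ˢ Icc (0 : ℝ) D) := isCompact_Icc.prod isCompact_Icc
  obtain ⟨ε, hε, hmin⟩ := hc.exists_forall_le' (f := fun w => dist p (H w)) (a := 0)
    (by fun_prop) fun w hw => by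
      refine dist_pos.2 fun h => hp w.1 hw.1 _ _ (hG w.1) ⟨w.2, h.symm⟩
  refine ⟨ε, hε, ?_⟩
  have h1 : ∀ t, ∀ u, 0 ≤ u → H (t, u) = H (t, min u D) := by
    intro t u hu
    rcases le_total u D with h | h
    · rw [min_eq_left h]
    · rw [min_eq_right h]
      exact ((hG t).arc.right u ((hdD t).trans h)).trans ((hG t).arc.right D (hdD t)).symm
  have h2 : ∀ t u, ∃ v ∈ Icc 0 D, H (t, u) = H (t, v) := by
    intro t u
    rcases le_total u 0 with h | h
    · exact ⟨0, ⟨le_rfl, hD⟩, ((hG t).arc.left u h).trans ((hG t).arc.left 0 le_rfl).symm⟩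
    · exact ⟨min u D, ⟨le_min h hD, min_le_right _ _⟩, h1 t u h⟩
  have h3 : ∀ t, ∃ s ∈ Icc 0 L, μ t = μ s := by
    intro t
    rcases le_total t 0 with h | h
    · exact ⟨0, ⟨le_rfl, hL⟩, by rw [hμ.left t h, hμ.zero]⟩
    rcases le_total L t with h' | h'
    · exact ⟨L, ⟨hL, le_rfl⟩, by rw [hμ.right t h', hμ.end_eq]⟩
    · exact ⟨t, ⟨h, h'⟩, rfl⟩
  rintro ⟨t, u⟩
  obtain ⟨s, hs, hts⟩ := h3 t
  obtain ⟨v, hv, huv⟩ := h2 s u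
  have hGt := hG t
  rw [hts] at hGt
  have e := hGt.length_eq (hG s)
  rw [e] at hGt
  have := congrFun (hU hGt (hG s)) u
  have h4 := hmin (s, v) ⟨hs, hv⟩
  rw [this, huv]
  exact h4

end Compact

end Cat2Cx
end

open Set Metric Filter
noncomputable section
namespace Cat2Cx

variable {X : Type*} [MetricSpace X]

namespace PathCocycle

section Along

variable {B : Type*} [TopologicalSpace B] {A : Type*} [CommGroup A] (c : PathCocycle B A)
  {Z : Type*} [TopologicalSpace Z] [SimplyConnectedSpace Z]

/-- The value of a cocycle on the image of any path from `a` to `b` in a simply connected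
space. -/
def along (m : C(Z, B)) (a b : Z) : A :=
  c.val ((PathConnectedSpace.somePath a b).map m.continuous)

theorem along_eq (m : C(Z, B)) {a b : Z} (p : Path a b) :
    c.along m a b = c.val (p.map m.continuous) :=
  c.val_map_eq m.continuous _ _

theorem along_mul (m : C(Z, B)) (a b d : Z) :
    c.along m a b * c.along m b d = c.along m a d := by
  rw [c.along_eq m ((PathConnectedSpace.somePath a b).trans (PathConnectedSpace.somePath b d)),
    Path.map_trans, c.val_trans]
  rfl

theorem along_comp {W : Type*} [TopologicalSpace W] [SimplyConnectedSpace W] (m : C(Z, B))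
    (φ : C(W, Z)) (a b : W) : c.along (m.comp φ) a b = c.along m (φ a) (φ b) := by
  rw [c.along_eq m ((PathConnectedSpace.somePath a b).map φ.continuous)]
  rfl

end Along

section Run

variable {x : X} {A : Type*} [CommGroup A] (c : PathCocycle ↥({x}ᶜ : Set X) A)

open Classical in
/-- The value of a cocycle of `X \ {x}` along a curve in `X`, between two parameters. -/
def run (f : ℝ → X) (a b : ℝ) : A :=
  if h : Continuous f ∧ ∀ t, f t ≠ x then
    c.along ⟨fun t => ⟨f t, h.2 t⟩, h.1.subtype_mk _⟩ a b
  else 1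

variable {f g : ℝ → X}

theorem run_eq (hf : Continuous f) (hx : ∀ t, f t ≠ x) (a b : ℝ) :
    c.run f a b = c.along ⟨fun t => ⟨f t, hx t⟩, hf.subtype_mk _⟩ a b :=
  dif_pos ⟨hf, hx⟩

theorem run_mul (f : ℝ → X) (a b d : ℝ) : c.run f a b * c.run f b d = c.run f a d := by
  unfold run
  split_ifs
  · exact c.along_mul _ _ _ _
  · exact one_mul 1

theorem run_self (f : ℝ → X) (a : ℝ) : c.run f a a = 1 :=
  left_eq_mul.1 (c.run_mul f a a a).symm

theorem run_swap (f : ℝ → X) (a b : ℝ) : c.run f b a = (c.run f a b)⁻¹ := by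
  rw [eq_inv_iff_mul_eq_one, c.run_mul, c.run_self]

theorem run_comp (hf : Continuous f) (hx : ∀ t, f t ≠ x) {φ : ℝ → ℝ} (hφ : Continuous φ)
    (a b : ℝ) : c.run (fun t => f (φ t)) a b = c.run f (φ a) (φ b) := by
  rw [c.run_eq hf hx, c.run_eq (f := fun t => f (φ t)) (hf.comp hφ) fun t => hx _]
  exact c.along_comp ⟨fun t => ⟨f t, hx t⟩, hf.subtype_mk _⟩ ⟨φ, hφ⟩ a b

theorem run_congr (hf : Continuous f) (hx : ∀ t, f t ≠ x) (hg : Continuous g)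
    (hx' : ∀ t, g t ≠ x) {a b : ℝ} (hab : a ≤ b) (h : ∀ t ∈ Icc a b, f t = g t) :
    c.run f a b = c.run g a b := by
  have hφ : Continuous fun t : ℝ => max a (min t b) := by fun_prop
  have h1 := c.run_comp hf hx hφ a b
  have h2 := c.run_comp hg hx' hφ a b
  have h3 : (fun t => f (max a (min t b))) = fun t => g (max a (min t b)) :=
    funext fun t => h _ ⟨le_max_left _ _, max_le hab (min_le_right _ _)⟩
  rw [h3, h2] at h1
  simpa [hab] using h1.symm

theorem run_fan {H : ℝ × ℝ → X} (hH : Continuous H) (hx : ∀ w, H w ≠ x) {q : X}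
    (hq : ∀ t, H (t, 0) = q) (L D : ℝ) :
    c.run (fun u => H (0, u)) 0 D * c.run (fun t => H (t, D)) 0 L =
      c.run (fun u => H (L, u)) 0 D := by
  let m : C(ℝ × ℝ, ↥({x}ᶜ : Set X)) := ⟨fun w => ⟨H w, hx w⟩, hH.subtype_mk _⟩
  have hv : ∀ t, c.run (fun u => H (t, u)) 0 D = c.along m (t, 0) (t, D) := by
    intro t
    rw [c.run_eq (by fun_prop) fun u => hx _]
    exact c.along_comp m ⟨fun u => (t, u), by fun_prop⟩ 0 D
  have hh : ∀ u, c.run (fun t => H (t, u)) 0 L = c.along m (0, u) (L, u) := by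
    intro u
    rw [c.run_eq (by fun_prop) fun t => hx _]
    exact c.along_comp m ⟨fun t => (t, u), by fun_prop⟩ 0 L
  have h1 : c.along m (0, 0) (L, 0) = 1 := by
    rw [← hh, ← c.run_self (fun t => H (t, 0)) 0]
    have := c.run_comp (f := fun t => H (t, 0)) (by fun_prop) (fun t => hx _)
      (φ := fun _ => 0) continuous_const 0 L
    simp only [hq] at this ⊢
    exact this
  rw [hv, hv, hh, c.along_mul, ← c.along_mul m (0, 0) (L, 0), h1, one_mul]

theorem run_append {S : Set X} {a b d : X} {ℓ m : ℝ} (hf : IsArc S a b ℓ f)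
    (hg : IsArc S b d m g) (hxf : ∀ t, f t ≠ x) (hxg : ∀ t, g t ≠ x) :
    c.run (fun t => if t ≤ ℓ then f t else g (t - ℓ)) 0 (ℓ + m) =
      c.run f 0 ℓ * c.run g 0 m := by
  have hfg := (hf.trans hg).continuous
  have hx : ∀ t, (if t ≤ ℓ then f t else g (t - ℓ)) ≠ x := by
    intro t
    split_ifs
    · exact hxf _
    · exact hxg _
  rw [← c.run_mul _ 0 ℓ (ℓ + m), c.run_congr hfg hx hf.continuous hxf hf.nonneg
    fun t ht => if_pos ht.2]
  congr 1
  have h2 := c.run_comp hg.continuous hxg (φ := fun t => t - ℓ) (by fun_prop) ℓ (ℓ + m)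
  simp only [sub_self, add_sub_cancel_left] at h2
  rw [← h2]
  refine c.run_congr (g := fun t => g (t - ℓ)) hfg hx (hg.continuous.comp (by fun_prop)) (fun t => hxg _)
    (by linarith [hg.nonneg]) fun t ht => ?_
  split_ifs with h
  · have : t = ℓ := le_antisymm h ht.1
    rw [this, sub_self, hf.end_eq, hg.zero]
  · rfl

end Run

end PathCocycle

universe v

namespace SCC

/-- The periodic extension of a simple closed curve. -/
def periodic (γ : SCC X) : ℝ → X := γ.toFun ∘ Int.fract

theorem continuous_periodic (γ : SCC X) : Continuous γ.periodic :=
  γ.contOn.comp_fract'' γ.loop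

theorem periodic_add_int (γ : SCC X) (t : ℝ) (n : ℤ) : γ.periodic (t + n) = γ.periodic t := by
  simp [periodic]

theorem periodic_eq (γ : SCC X) {t : ℝ} (ht : t ∈ Icc (0 : ℝ) 1) :
    γ.periodic t = γ.toFun t := by
  rcases ht.2.lt_or_eq with h | h
  · simp only [periodic, Function.comp_apply, Int.fract_eq_self.2 ⟨ht.1, h⟩]
  · rw [h]
    simp [periodic, γ.loop]

theorem periodic_mem (γ : SCC X) (t : ℝ) : γ.periodic t ∈ γ.img :=
  ⟨_, ⟨Int.fract_nonneg t, (Int.fract_lt_one t).le⟩, rfl⟩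

theorem periodic_ne (γ : SCC X) {x : X} (hx : x ∉ γ.img) (t : ℝ) : γ.periodic t ≠ x :=
  fun h => hx (h ▸ γ.periodic_mem t)

theorem val_pathIn (γ : SCC X) {x : X} (h : γ.img ⊆ {x}ᶜ) {A : Type*} [CommGroup A]
    (c : PathCocycle ↥({x}ᶜ : Set X) A) :
    c.val (γ.pathIn _ h) = c.run γ.periodic 0 1 := by
  have hx : x ∉ γ.img := fun hx => h hx rfl
  let p : Path (0 : ℝ) 1 := ⟨⟨fun t => (t : ℝ), by fun_prop⟩, rfl, rfl⟩
  rw [c.run_eq γ.continuous_periodic (γ.periodic_ne hx), c.along_eq _ p]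
  have key : ∀ {a b a' b' : ↥({x}ᶜ : Set X)} (p : Path a b) (q : Path a' b'),
      (∀ t, p t = q t) → c.val p = c.val q := by
    intro a b a' b' p q hpq
    have ha : a = a' := by rw [← p.source, ← q.source, hpq]
    have hb : b = b' := by rw [← p.target, ← q.target, hpq]
    subst ha hb
    rw [Path.ext (funext hpq)]
  exact key _ _ fun t => Subtype.ext (γ.periodic_eq t.2).symm

theorem nullhomologousIn_iff {X : Type v} [MetricSpace X] (γ : SCC X) {x : X}
    (hx : x ∉ γ.img) : γ.NullhomologousIn {x}ᶜ ↔
      ∀ (A : Type v) [CommGroup A] (c : PathCocycle ↥({x}ᶜ : Set X) A),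
        c.run γ.periodic 0 1 = 1 := by
  have h : γ.img ⊆ {x}ᶜ := fun y hy hyx => hx (hyx ▸ hy)
  constructor
  · intro hn A _ c
    rw [← γ.val_pathIn h c]
    exact c.val_eq_one_of_loopClassH1 (hn h)
  · intro hc h'
    apply loopClassH1_eq_one
    rw [γ.val_pathIn h']
    exact hc _ _

/-- Any simple closed curve with the same image as `δ` factors through `δ`. -/
theorem exists_lift_periodic (γ δ : SCC X) (h : γ.img ⊆ δ.img) :
    ∃ H : ℝ → ℝ, Continuous H ∧ (∀ t ∈ Icc (0 : ℝ) 1, γ.periodic t = δ.periodic (H t)) ∧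
      ∃ n : ℤ, H 1 = H 0 + n := by
  have hex : ∀ t : unitInterval, ∃ s ∈ Icc (0 : ℝ) 1, δ.toFun s = γ.toFun t :=
    fun t => h ⟨t, t.2, rfl⟩
  choose s hs hsγ using hex
  have hδ : ∀ s ∈ Icc (0 : ℝ) 1, ∀ s' ∈ Icc (0 : ℝ) 1, δ.toFun s = δ.toFun s' →
      Circle.exp (2 * Real.pi * s) = Circle.exp (2 * Real.pi * s') := by
    intro s hs s' hs' he
    have key : ∀ s ∈ Icc (0 : ℝ) 1, Circle.exp (2 * Real.pi * s) =
        Circle.exp (2 * Real.pi * Int.fract s) := by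
      intro s _
      rw [Circle.exp_eq_exp]
      refine ⟨⌊s⌋, ?_⟩
      have := Int.fract_add_floor s
      nth_rewrite 1 [← this]
      ring
    rw [key s hs, key s' hs']
    have hi := δ.inj ⟨Int.fract_nonneg s, Int.fract_lt_one s⟩
      ⟨Int.fract_nonneg s', Int.fract_lt_one s'⟩
      ((δ.periodic_eq hs).trans (he.trans (δ.periodic_eq hs').symm))
    rw [hi]
  have hγc : Continuous fun t : unitInterval => γ.toFun t :=
    γ.contOn.comp_continuous continuous_subtype_val fun t => t.2
  have hδc : Continuous fun t : unitInterval => δ.toFun t :=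
    δ.contOn.comp_continuous continuous_subtype_val fun t => t.2
  let h : unitInterval → Circle := fun t => Circle.exp (2 * Real.pi * s t)
  have hh : Continuous h := by
    apply continuous_of_isClosed_graph
    have hK : IsClosed {w : unitInterval × unitInterval | δ.toFun w.1 = γ.toFun w.2} :=
      isClosed_eq (hδc.comp continuous_fst) (hγc.comp continuous_snd)
    have he : {w : unitInterval × Circle | w.2 = h w.1} =
        (fun w : unitInterval × unitInterval => (w.2, Circle.exp (2 * Real.pi * w.1))) ''
          {w | δ.toFun w.1 = γ.toFun w.2} := by
      ext ⟨t, ζ⟩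
      constructor
      · intro hζ
        exact ⟨(⟨s t, hs t⟩, t), hsγ t, Prod.ext rfl (Eq.symm hζ)⟩
      · rintro ⟨⟨a, b⟩, hab, hw⟩
        obtain ⟨rfl, rfl⟩ := Prod.ext_iff.1 hw
        exact hδ _ a.2 _ (hs _) ((show δ.toFun a = γ.toFun b from hab).trans (hsγ b).symm)
    rw [he]
    exact (hK.isCompact.image (by fun_prop)).isClosed
  obtain ⟨k, hk, hke⟩ := exists_lift hh
  have hp : (2 * Real.pi) ≠ 0 := by positivity
  refine ⟨fun t => k (projIcc 0 1 zero_le_one t) / (2 * Real.pi), by fun_prop, ?_, ?_⟩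
  · intro t ht
    beta_reduce
    rw [γ.periodic_eq ht, projIcc_of_mem _ ht]
    obtain ⟨n, hn⟩ := Circle.exp_eq_exp.1 (hke ⟨t, ht⟩)
    have h1 : k ⟨t, ht⟩ / (2 * Real.pi) = s ⟨t, ht⟩ + (-n : ℤ) := by
      rw [div_eq_iff hp]
      push_cast
      linarith
    rw [h1, δ.periodic_add_int, δ.periodic_eq (hs _)]
    exact (hsγ ⟨t, ht⟩).symm
  · have h01 : h 1 = h 0 := hδ _ (hs _) _ (hs _) (by
      rw [hsγ, hsγ]
      exact γ.loop.symm)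
    rw [hke, hke] at h01
    obtain ⟨n, hn⟩ := Circle.exp_eq_exp.1 h01
    refine ⟨n, ?_⟩
    have e0 : projIcc (0 : ℝ) 1 zero_le_one 0 = 0 := projIcc_left _
    have e1 : projIcc (0 : ℝ) 1 zero_le_one 1 = 1 := projIcc_right _
    beta_reduce
    rw [e0, e1, hn]
    field_simp

theorem run_eq_one_of_img_subset (γ δ : SCC X) (h : γ.img ⊆ δ.img) {x : X} (hx : x ∉ δ.img)
    {A : Type*} [CommGroup A] (c : PathCocycle ↥({x}ᶜ : Set X) A)
    (hδ : c.run δ.periodic 0 1 = 1) : c.run γ.periodic 0 1 = 1 := by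
  obtain ⟨H, hH, hγ, n, hn⟩ := γ.exists_lift_periodic δ h
  have hδc := δ.continuous_periodic
  have hδx := δ.periodic_ne hx
  rw [c.run_congr γ.continuous_periodic (γ.periodic_ne fun h' => hx (h h')) (hδc.comp hH)
    (fun t => hδx _) zero_le_one hγ, Function.comp_def, c.run_comp hδc hδx hH, hn]
  have hper : Function.Periodic (c.run δ.periodic 0) 1 := by
    intro a
    rw [← c.run_mul _ 0 1 (a + 1), hδ, one_mul]
    have := c.run_comp hδc hδx (φ := fun t => t + 1) (by fun_prop) 0 a
    have he : (fun t => δ.periodic (t + 1)) = δ.periodic :=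
      funext fun t => by simpa using δ.periodic_add_int t 1
    rw [he, zero_add] at this
    exact this.symm
  have h1 := hper.int_mul n (H 0)
  rw [mul_one, ← c.run_mul _ 0 (H 0)] at h1
  exact mul_eq_left.1 h1

theorem nullhomologousIn_congr {X : Type v} [MetricSpace X] {γ δ : SCC X} (h : γ.img = δ.img)
    {x : X} (hx : x ∉ δ.img) : γ.NullhomologousIn {x}ᶜ ↔ δ.NullhomologousIn {x}ᶜ := by
  rw [γ.nullhomologousIn_iff (h ▸ hx), δ.nullhomologousIn_iff hx]
  exact ⟨fun H A _ c => δ.run_eq_one_of_img_subset γ h.symm.subset (h ▸ hx) c (H A c),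
    fun H A _ c => γ.run_eq_one_of_img_subset δ h.subset hx c (H A c)⟩

end SCC

end Cat2Cx
end

open Set Metric Filter
noncomputable section
namespace Cat2Cx

variable {X : Type*} [MetricSpace X]

section Triangle

variable {S : Set X} {a b d : X} {ℓ m n : ℝ} {f g h : ℝ → X}

/-- The simple closed curve running along the sides of a triangle. -/
theorem exists_scc_of_geo (hf : IsGeo S a b ℓ f) (hg : IsGeo S b d m g) (hh : IsGeo S d a n h)
    (hℓ : 0 < ℓ) (hfg : ∀ w ∈ range f, w ∈ range g → w = b)
    (hgh : ∀ w ∈ range g, w ∈ range h → w = d) (hfh : ∀ w ∈ range f, w ∈ range h → w = a) :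
    ∃ δ : SCC X, δ.img = range f ∪ range g ∪ range h ∧
      ∀ {x : X}, x ∉ δ.img → ∀ {A : Type*} [CommGroup A] (c : PathCocycle ↥({x}ᶜ : Set X) A),
        c.run δ.periodic 0 1 = c.run f 0 ℓ * c.run g 0 m * c.run h 0 n := by
  have hfg' := hf.arc.trans hg.arc
  have hk' := hfg'.trans hh.arc
  set k₁ : ℝ → X := fun t => if t ≤ ℓ then f t else g (t - ℓ) with hk₁
  set k : ℝ → X := fun t => if t ≤ ℓ + m then k₁ t else h (t - (ℓ + m)) with hk
  have hm := hg.arc.nonneg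
  have hn := hh.arc.nonneg
  have k1 : ∀ t ≤ ℓ, k t = f t := fun t ht => by
    simp only [hk, hk₁, if_pos ht, if_pos (show t ≤ ℓ + m by linarith)]
  have k2 : ∀ t, ℓ < t → t ≤ ℓ + m → k t = g (t - ℓ) := fun t ht ht' => by
    simp only [hk, hk₁, if_pos ht', if_neg (not_le.2 ht)]
  have k3 : ∀ t, ℓ + m < t → k t = h (t - (ℓ + m)) := fun t ht => by
    simp only [hk, if_neg (not_le.2 ht)]
  set N := ℓ + m + n with hN
  have hN0 : 0 < N := by linarith
  have hinj : ∀ s t, 0 ≤ s → s < t → t < N → k s ≠ k t := by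
    intro s t hs hst ht he
    rcases le_or_gt t ℓ with h1 | h1
    · rw [k1 s (hst.le.trans h1), k1 t h1] at he
      have := hf.injOn ⟨hs, hst.le.trans h1⟩ ⟨hs.trans hst.le, h1⟩ he
      linarith
    rcases le_or_gt t (ℓ + m) with h2 | h2
    · rw [k2 t h1 h2] at he
      rcases le_or_gt s ℓ with h3 | h3
      · rw [k1 s h3] at he
        have e := hfg _ ⟨s, rfl⟩ ⟨t - ℓ, he.symm⟩
        rw [he, ← hg.arc.zero] at e
        have := hg.injOn ⟨by linarith, by linarith⟩ ⟨le_rfl, hm⟩ e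
        linarith
      · rw [k2 s h3 (hst.le.trans h2)] at he
        have := hg.injOn ⟨by linarith, by linarith⟩ ⟨by linarith, by linarith⟩ he
        linarith
    · rw [k3 t h2] at he
      rcases le_or_gt s ℓ with h3 | h3
      · rw [k1 s h3] at he
        have e := hfh _ ⟨s, rfl⟩ ⟨t - (ℓ + m), he.symm⟩
        rw [he, ← hh.arc.end_eq] at e
        have := hh.injOn ⟨by linarith, by linarith⟩ ⟨hn, le_rfl⟩ e
        linarith
      rcases le_or_gt s (ℓ + m) with h4 | h4
      · rw [k2 s h3 h4] at he
        have e := hgh _ ⟨s - ℓ, rfl⟩ ⟨t - (ℓ + m), he.symm⟩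
        rw [he, ← hh.arc.zero] at e
        have := hh.injOn ⟨by linarith, by linarith⟩ ⟨le_rfl, hn⟩ e
        linarith
      · rw [k3 s h4] at he
        have := hh.injOn ⟨by linarith, by linarith⟩ ⟨by linarith, by linarith⟩ he
        linarith
  have hkc := hk'.continuous
  let δ : SCC X :=
    { toFun := fun t => k (N * t)
      contOn := (hkc.comp (by fun_prop)).continuousOn
      loop := by
        rw [mul_zero, mul_one, hk'.zero, hk'.end_eq]
      inj := by
        intro s hs t ht he
        by_contra hne
        rcases lt_or_gt_of_ne hne with hlt | hlt
        · exact hinj _ _ (mul_nonneg hN0.le hs.1) (mul_lt_mul_of_pos_left hlt hN0)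
            (by nlinarith [ht.2]) he
        · exact hinj _ _ (mul_nonneg hN0.le ht.1) (mul_lt_mul_of_pos_left hlt hN0)
            (by nlinarith [hs.2]) he.symm }
  have himg : δ.img = range f ∪ range g ∪ range h := by
    apply Subset.antisymm
    · rintro _ ⟨t, -, rfl⟩
      change k (N * t) ∈ _
      rcases le_or_gt (N * t) ℓ with h1 | h1
      · rw [k1 _ h1]; exact Or.inl (Or.inl ⟨_, rfl⟩)
      rcases le_or_gt (N * t) (ℓ + m) with h2 | h2
      · rw [k2 _ h1 h2]; exact Or.inl (Or.inr ⟨_, rfl⟩)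
      · rw [k3 _ h2]; exact Or.inr ⟨_, rfl⟩
    · have key : ∀ t ∈ Icc 0 N, k t ∈ δ.img := fun t ht =>
        ⟨t / N, ⟨div_nonneg ht.1 hN0.le, (div_le_one hN0).2 ht.2⟩, by
          change k (N * (t / N)) = k t
          rw [mul_div_cancel₀ _ hN0.ne']⟩
      rw [hf.range_eq, hg.range_eq, hh.range_eq]
      rintro _ ((⟨t, ht, rfl⟩ | ⟨t, ht, rfl⟩) | ⟨t, ht, rfl⟩)
      · rw [← k1 t ht.2]
        exact key t ⟨ht.1, by linarith [ht.2]⟩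
      · rcases ht.1.lt_or_eq with h0 | h0
        · have := key (t + ℓ) ⟨by linarith, by linarith [ht.2]⟩
          rwa [k2 _ (by linarith) (by linarith [ht.2]), add_sub_cancel_right] at this
        · have := key ℓ ⟨by linarith, by linarith⟩
          rwa [k1 _ le_rfl, hf.arc.end_eq, ← hg.arc.zero, h0] at this
      · rcases ht.1.lt_or_eq with h0 | h0
        · have := key (t + (ℓ + m)) ⟨by linarith, by linarith [ht.2]⟩
          rwa [k3 _ (by linarith), add_sub_cancel_right] at this
        · have := key (ℓ + m) ⟨by linarith, by linarith⟩
          have e : k (ℓ + m) = d := by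
            simp only [hk, le_refl, if_true]
            exact hfg'.end_eq
          rwa [e, ← hh.arc.zero, h0] at this
  refine ⟨δ, himg, ?_⟩
  intro x hx A _ c
  have hx1 : ∀ t, f t ≠ x := fun t he => hx (himg ▸ Or.inl (Or.inl ⟨t, he⟩))
  have hx2 : ∀ t, g t ≠ x := fun t he => hx (himg ▸ Or.inl (Or.inr ⟨t, he⟩))
  have hx3 : ∀ t, h t ≠ x := fun t he => hx (himg ▸ Or.inr ⟨t, he⟩)
  have hx4 : ∀ t, k₁ t ≠ x := fun t => by
    simp only [hk₁]
    split_ifs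
    · exact hx1 _
    · exact hx2 _
  have hx5 : ∀ t, k t ≠ x := fun t => by
    simp only [hk]
    split_ifs
    · exact hx4 _
    · exact hx3 _
  have e1 : c.run δ.periodic 0 1 = c.run (fun t => k (N * t)) 0 1 :=
    c.run_congr δ.continuous_periodic (δ.periodic_ne hx) (by fun_prop) (fun t => hx5 _)
      zero_le_one fun t ht => δ.periodic_eq ht
  rw [e1, c.run_comp hkc hx5 (φ := fun t => N * t) (by fun_prop), mul_zero, mul_one]
  have e2 := c.run_append hfg' hh.arc hx4 hx3
  have e3 := c.run_append hf.arc hg.arc hx1 hx2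
  rw [← e3]
  exact e2

theorem IsGeo.run_rev {x : X} {A : Type*} [CommGroup A] (c : PathCocycle ↥({x}ᶜ : Set X) A)
    (hf : IsGeo S a b ℓ f) (hx : ∀ t, f t ≠ x) :
    c.run (fun t => f (ℓ - t)) 0 ℓ = (c.run f 0 ℓ)⁻¹ := by
  rw [c.run_comp hf.arc.continuous hx (φ := fun t => ℓ - t) (by fun_prop), sub_zero, sub_self,
    c.run_swap]

universe v

/-- The homology class of a simple triangle, in terms of its sides. -/
theorem SCC.nullhomologousIn_triangle {X : Type v} [MetricSpace X] {S : Set X} {a b d : X}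
    {ℓ m n : ℝ} {f g h : ℝ → X} (hU : UniqueGeo S) (γ : SCC X) (hf : IsGeo S a b ℓ f)
    (hg : IsGeo S b d m g) (hh : IsGeo S a d n h) (hγ : γ.img = range f ∪ range g ∪ range h)
    {x : X} (hx : x ∉ γ.img) : γ.NullhomologousIn {x}ᶜ ↔
      ∀ (A : Type v) [CommGroup A] (c : PathCocycle ↥({x}ᶜ : Set X) A),
        c.run f 0 ℓ * c.run g 0 m = c.run h 0 n := by
  have rf := range_rev f ℓ
  have rg := range_rev g m
  have rh := range_rev h n
  have hapex : a ∉ range g := γ.apex hU hf hh hg (by rw [hγ, union_right_comm])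
  have hℓ : 0 < ℓ := lt_of_le_of_ne hf.arc.nonneg fun h0 => hapex ⟨0, by
    rw [hg.arc.zero, ← hf.arc.end_eq, ← h0, hf.arc.zero]⟩
  obtain ⟨δ, hδ, hrun⟩ := exists_scc_of_geo hf hg hh.rev hℓ
    (fun w h1 h2 => γ.corner hU hf.rev hg hh (by rw [hγ, rf]) (rf ▸ h1) h2)
    (fun w h1 h2 => γ.corner hU hg.rev hh.rev hf.rev
      (by rw [hγ, rf, rg, rh]; ac_rfl) (rg ▸ h1) h2)
    (fun w h1 h2 => γ.corner hU hf hh hg (by rw [hγ, union_right_comm]) h1 (rh ▸ h2))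
  rw [rh, ← hγ] at hδ
  have hxδ : x ∉ δ.img := hδ ▸ hx
  have hxh : ∀ t, h t ≠ x := fun t he => hx (hγ ▸ Or.inr ⟨t, he⟩)
  rw [SCC.nullhomologousIn_congr hδ.symm hxδ, δ.nullhomologousIn_iff hxδ]
  refine forall_congr' fun A => forall_congr' fun _ => forall_congr' fun c => ?_
  rw [hrun hxδ c, hh.run_rev c hxh, mul_inv_eq_one]

end Triangle

end Cat2Cx
end

open Set Metric Filter
noncomputable section
namespace Cat2Cx

variable {X : Type*} [MetricSpace X]

theorem IsGeo.run_eq_of_le {S : Set X} {a b x : X} {ℓ D : ℝ} {f : ℝ → X} {A : Type*}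
    [CommGroup A] (c : PathCocycle ↥({x}ᶜ : Set X) A) (hf : IsGeo S a b ℓ f)
    (hx : ∀ t, f t ≠ x) (hD : ℓ ≤ D) : c.run f 0 D = c.run f 0 ℓ := by
  have hfc := hf.arc.continuous
  rw [← c.run_mul f 0 ℓ D, mul_eq_left,
    c.run_congr hfc hx (g := fun _ => f ℓ) continuous_const (fun _ => hx _) hD fun t ht => by
      rw [hf.arc.right t ht.1, hf.arc.end_eq],
    c.run_comp hfc hx (φ := fun _ => ℓ) continuous_const, c.run_self]

/-- Two geodesics with the same endpoints have the same cocycle values. -/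
theorem IsGeo.run_eq_run {S : Set X} (hU : UniqueGeo S) {a b x : X} {ℓ m D D' : ℝ}
    {f g : ℝ → X} {A : Type*} [CommGroup A] (c : PathCocycle ↥({x}ᶜ : Set X) A)
    (hf : IsGeo S a b ℓ f) (hg : IsGeo S a b m g) (hx : ∀ t, f t ≠ x) (hD : ℓ ≤ D)
    (hD' : m ≤ D') : c.run f 0 D = c.run g 0 D' := by
  obtain rfl := hf.length_eq hg
  obtain rfl := hU hf hg
  rw [hf.run_eq_of_le c hx hD, hf.run_eq_of_le c hx hD']

section Subtriangle

variable {S : Set X} {p q r q' r' : X} {ℓ ℓ' m m' n n' : ℝ} {f f' g g' h h' : ℝ → X}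

/-- A geodesic from `q` through `p` traverses the side `[p,q]` backwards. -/
theorem IsGeo.eq_rev_of_through (hU : UniqueGeo S) (hf : IsGeo S p q ℓ f) {y : X} {M s : ℝ}
    {G : ℝ → X} (hG : IsGeo S q y M G) (hs : s ∈ Icc 0 M) (hp : G s = p) :
    s = ℓ ∧ ∀ v ∈ Icc 0 ℓ, G v = f (ℓ - v) := by
  obtain ⟨h1, h2⟩ := hG.agree hU hf.rev hs ⟨hf.arc.nonneg, le_rfl⟩
    (by rw [hp, sub_self, hf.arc.zero])
  exact ⟨h1, h1 ▸ h2⟩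

theorem notMem_geo_of_side (hU : UniqueGeo S) (hf : IsGeo S p q ℓ f) (hh : IsGeo S p r n h)
    (hℓ : ℓ' ∈ Icc 0 ℓ) (hn : n' ∈ Icc 0 n) (hg' : IsGeo S (f ℓ') (h n') m' g')
    (hp : p ∉ range g') {u M : ℝ} (hu : u ∈ Icc n' n) {G : ℝ → X}
    (hG : IsGeo S q (h u) M G) : p ∉ range G := by
  intro hmem
  rw [hG.range_eq] at hmem
  obtain ⟨s, hs, hsp⟩ := hmem
  obtain ⟨rfl, h1⟩ := hf.eq_rev_of_through hU hG hs hsp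
  obtain ⟨h2, h3⟩ := hG.eq_of_eq hU hh hs.1 hs.2 le_rfl le_rfl (hn.1.trans hu.1) hu.2
    (by rw [hsp, hh.arc.zero]) (by rw [hG.arc.end_eq])
  have e1 : G (s - ℓ') = f ℓ' := by
    rw [h1 _ ⟨by linarith [hℓ.2], by linarith [hℓ.1]⟩, sub_sub_cancel]
  have e2 : G (s + n') = h n' := by
    rw [h3 n' ⟨hn.1, by linarith [hu.1]⟩, zero_add]
  have hm := hg'.arc.nonneg
  obtain ⟨v, -, hv⟩ := hG.mem_image_of_mem_Icc hU hg' (a := s - ℓ') (a' := s + n')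
    (by linarith [hℓ.2]) (by linarith [hu.1]) ⟨le_rfl, hm⟩ ⟨hm, le_rfl⟩
    (by rw [e1, hg'.arc.zero]) (by rw [e2, hg'.arc.end_eq]) (t := s)
    ⟨by linarith [hℓ.1], by linarith [hn.1]⟩
  exact hp ⟨v, hv.trans hsp⟩

theorem notMem_geo_of_base (hU : UniqueGeo S) (hf : IsGeo S p q ℓ f)
    (hℓ : ℓ' ∈ Icc 0 ℓ) (hg' : IsGeo S (f ℓ') r' m' g')
    (hp : p ∉ range g') {u M : ℝ} (hu : u ∈ Icc 0 m') {G : ℝ → X}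
    (hG : IsGeo S q (g' u) M G) : p ∉ range G := by
  intro hmem
  rw [hG.range_eq] at hmem
  obtain ⟨s, hs, hsp⟩ := hmem
  obtain ⟨rfl, h1⟩ := hf.eq_rev_of_through hU hG hs hsp
  have e1 : G (s - ℓ') = f ℓ' := by
    rw [h1 _ ⟨by linarith [hℓ.2], by linarith [hℓ.1]⟩, sub_sub_cancel]
  obtain ⟨v, -, hv⟩ := hG.mem_image_of_mem_Icc hU hg' (a := s - ℓ') (a' := M)
    (by linarith [hℓ.2]) le_rfl ⟨le_rfl, hg'.arc.nonneg⟩ hu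
    (by rw [e1, hg'.arc.zero]) hG.arc.end_eq (t := s)
    ⟨by linarith [hℓ.1], hs.2⟩
  exact hp ⟨v, hv.trans hsp⟩

theorem exists_pos_le_dist {C : Set X} (hC : IsClosed C) (hp : p ∉ C) :
    ∃ ε > 0, ∀ x ∈ ball p ε, x ∉ C := by
  obtain ⟨ε, hε, h⟩ := Metric.isOpen_iff.1 hC.isOpen_compl p hp
  exact ⟨ε, hε, fun x hx => h hx⟩

universe v

theorem interiorSet_inter_ball_eq {X : Type v} [MetricSpace X] {S : Set X} {p q r q' r' : X}
    {ℓ ℓ' m m' n n' : ℝ} {f f' g g' h h' : ℝ → X} (hS : IsCompact S) (hU : UniqueGeo S)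
    {γ γ' : SCC X} (hf : IsGeo S p q ℓ f) (hg : IsGeo S q r m g) (hh : IsGeo S p r n h)
    (hf' : IsGeo S p q' ℓ' f') (hg' : IsGeo S q' r' m' g') (hh' : IsGeo S p r' n' h')
    (hℓ : ℓ' ≤ ℓ) (hn : n' ≤ n) (hff : ∀ t ∈ Icc 0 ℓ', f t = f' t)
    (hhh : ∀ t ∈ Icc 0 n', h t = h' t) (hγ : γ.img = range f ∪ range g ∪ range h)
    (hγ' : γ'.img = range f' ∪ range g' ∪ range h') :
    ∃ ε > 0, γ.interiorSet ∩ ball p ε = γ'.interiorSet ∩ ball p ε := by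
  have hℓ0 := hf'.arc.nonneg
  have hn0 := hh'.arc.nonneg
  have hq' : f ℓ' = q' := by rw [hff ℓ' ⟨hℓ0, le_rfl⟩, hf'.arc.end_eq]
  have hr' : h n' = r' := by rw [hhh n' ⟨hn0, le_rfl⟩, hh'.arc.end_eq]
  have hpg : p ∉ range g := γ.apex hU hf hh hg (by rw [hγ, union_right_comm])
  have hpg' : p ∉ range g' := γ'.apex hU hf' hh' hg' (by rw [hγ', union_right_comm])
  have hpf : p ∉ f '' Icc ℓ' ℓ := by
    rintro ⟨t, ht, he⟩
    have h0 := hf.injOn ⟨hℓ0.trans ht.1, ht.2⟩ ⟨le_rfl, hℓ0.trans hℓ⟩ (he.trans hf.arc.zero.symm)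
    have h1 : ℓ' = 0 := by linarith [ht.1]
    rw [h1, hf.arc.zero] at hq'
    exact hpg' ⟨0, by rw [hg'.arc.zero, hq']⟩
  have hph : p ∉ h '' Icc n' n := by
    rintro ⟨t, ht, he⟩
    have h0 := hh.injOn ⟨hn0.trans ht.1, ht.2⟩ ⟨le_rfl, hn0.trans hn⟩ (he.trans hh.arc.zero.symm)
    have h1 : n' = 0 := by linarith [ht.1]
    rw [h1, hh.arc.zero] at hr'
    exact hpg' ⟨m', by rw [hg'.arc.end_eq, hr']⟩
  have hμ := hh.arc.sub hn
  have hs1 := hf.arc.rev.trans hh'.arc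
  rw [← hr'] at hs1
  have hs2 := (hf.arc.sub hℓ).rev
  rw [hf.arc.end_eq, hq'] at hs2
  have hg'' := hg'
  rw [← hq', ← hr'] at hg''
  obtain ⟨H₁, d₁, D₁, hH₁, hD₁, hdD₁, hG₁, ε₁, hε₁, hp₁⟩ := exists_fan_avoiding hS hU (p := p) hμ
    hs1 fun t ht M G hG => notMem_geo_of_side hU hf hh ⟨hℓ0, hℓ⟩ ⟨hn0, hn⟩ hg'' hpg'
      (u := max n' (min (n' + t) n)) ⟨le_max_left _ _, max_le hn (min_le_right _ _)⟩ hG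
  obtain ⟨H₂, d₂, D₂, hH₂, hD₂, hdD₂, hG₂, ε₂, hε₂, hp₂⟩ := exists_fan_avoiding hS hU (p := p)
    hg'.arc hs2 fun t ht M G hG => notMem_geo_of_base hU hf ⟨hℓ0, hℓ⟩ hg'' hpg' ht hG
  have cl : ∀ {a b : X} {l : ℝ} {k : ℝ → X}, IsGeo S a b l k → IsClosed (range k) := by
    intro a b l k hk
    rw [hk.range_eq]
    exact hk.isClosed_image _ _
  obtain ⟨ε₃, hε₃, hp₃⟩ := exists_pos_le_dist (((cl hg).union (cl hg')).union
    ((hf.isClosed_image ℓ' ℓ).union (hh.isClosed_image n' n)))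
    (by rintro ((h1 | h1) | h1 | h1)
        exacts [hpg h1, hpg' h1, hpf h1, hph h1])
  refine ⟨min ε₁ (min ε₂ ε₃), lt_min hε₁ (lt_min hε₂ hε₃), ?_⟩
  ext x
  simp only [mem_inter_iff, and_congr_left_iff]
  intro hx
  have hx' : dist p x < min ε₁ (min ε₂ ε₃) := by rw [dist_comm]; exact hx
  have hx₃ := hp₃ x (ball_subset_ball ((min_le_right _ _).trans (min_le_right _ _)) hx)
  have hxH₁ : ∀ w, H₁ w ≠ x := fun w he => by
    have := hp₁ w
    rw [he] at this
    exact absurd (hx'.trans_le (min_le_left _ _)) (not_lt.2 this)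
  have hxH₂ : ∀ w, H₂ w ≠ x := fun w he => by
    have := hp₂ w
    rw [he] at this
    exact absurd (hx'.trans_le ((min_le_right _ _).trans (min_le_left _ _))) (not_lt.2 this)
  have hside : ∀ {b b' : X} {l l' : ℝ} {k k' : ℝ → X}, IsGeo S p b l k → IsGeo S p b' l' k' →
      l' ≤ l → (∀ t ∈ Icc 0 l', k t = k' t) → x ∉ k '' Icc l' l →
      (x ∈ range k ↔ x ∈ range k') := by
    intro b b' l l' k k' hk hk' hl he hxk
    rw [hk.range_eq, hk'.range_eq]
    constructor
    · rintro ⟨t, ht, hxt⟩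
      rcases le_total t l' with h1 | h1
      · exact ⟨t, ⟨ht.1, h1⟩, by rw [← he t ⟨ht.1, h1⟩, hxt]⟩
      · exact absurd ⟨t, ⟨h1, ht.2⟩, hxt⟩ hxk
    · rintro ⟨t, ht, hxt⟩
      exact ⟨t, ⟨ht.1, ht.2.trans hl⟩, by rw [he t ht, hxt]⟩
  have hxg : x ∉ range g := fun hc => hx₃ (Or.inl (Or.inl hc))
  have hxg' : x ∉ range g' := fun hc => hx₃ (Or.inl (Or.inr hc))
  have himg : x ∈ γ.img ↔ x ∈ γ'.img := by
    simp only [hγ, hγ', mem_union, hxg, hxg', or_false]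
    rw [hside hf hf' hℓ hff fun hc => hx₃ (Or.inr (Or.inl hc)),
      hside hh hh' hn hhh fun hc => hx₃ (Or.inr (Or.inr hc))]
  change x ∉ γ.img ∧ ¬ γ.NullhomologousIn {x}ᶜ ↔ x ∉ γ'.img ∧ ¬ γ'.NullhomologousIn {x}ᶜ
  by_cases hxγ : x ∈ γ.img
  · exact iff_of_false (fun hc => hc.1 hxγ) fun hc => hc.1 (himg.1 hxγ)
  have hxγ' : x ∉ γ'.img := fun hc => hxγ (himg.2 hc)
  refine and_congr (iff_of_true hxγ hxγ') (not_congr ?_)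
  rw [γ.nullhomologousIn_triangle hU hf hg hh hγ hxγ,
    γ'.nullhomologousIn_triangle hU hf' hg' hh' hγ' hxγ']
  refine forall_congr' fun A => forall_congr' fun _ => forall_congr' fun c => ?_
  have hxf : ∀ t, f t ≠ x := fun t he => hxγ (hγ ▸ Or.inl (Or.inl ⟨t, he⟩))
  have hxh : ∀ t, h t ≠ x := fun t he => hxγ (hγ ▸ Or.inr ⟨t, he⟩)
  have hxf' : ∀ t, f' t ≠ x := fun t he => hxγ' (hγ' ▸ Or.inl (Or.inl ⟨t, he⟩))
  have hxh' : ∀ t, h' t ≠ x := fun t he => hxγ' (hγ' ▸ Or.inr ⟨t, he⟩)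
  have fan₁ := c.run_fan hH₁ hxH₁ (q := q) (fun t => (hG₁ t).arc.zero) (n - n') D₁
  have fan₂ := c.run_fan hH₂ hxH₂ (q := q) (fun t => (hG₂ t).arc.zero) m' D₂
  have e1 : (fun t => H₁ (t, D₁)) = fun t => h (max n' (min (n' + t) n)) :=
    funext fun t => (hG₁ t).arc.right D₁ (hdD₁ t)
  have e2 : (fun t => H₂ (t, D₂)) = g' := funext fun t => (hG₂ t).arc.right D₂ (hdD₂ t)
  rw [e1, c.run_comp hh.arc.continuous hxh (φ := fun t => max n' (min (n' + t) n))
    (by fun_prop)] at fan₁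
  have hb1 : max n' (min (n' + 0) n) = n' := by rw [add_zero, min_eq_left hn, max_self]
  have hb2 : max n' (min (n' + (n - n')) n) = n := by
    rw [add_sub_cancel, min_self, max_eq_right hn]
  have G10 := hG₁ 0
  have G11 := hG₁ (n - n')
  have G20 := hG₂ 0
  have G21 := hG₂ m'
  rw [hb1, hr'] at G10
  rw [hb2, hh.arc.end_eq] at G11
  rw [hg'.arc.zero] at G20
  rw [hg'.arc.end_eq] at G21
  have r11 := G11.run_eq_run hU c hg (fun u => hxH₁ _) (hdD₁ _) le_rfl
  have r10 := G10.run_eq_run hU c G21 (fun u => hxH₁ _) (hdD₁ _) (hdD₂ _)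
  have hrev := hf.rev.sub le_rfl (sub_nonneg.2 hℓ) (sub_le_self ℓ hℓ0)
  simp only [sub_zero, sub_sub_cancel, hf.arc.end_eq, hq'] at hrev
  have r20 := G20.run_eq_run hU c hrev (fun u => hxH₂ _) (hdD₂ _) le_rfl
  rw [c.run_comp hf.arc.continuous hxf (φ := fun t => ℓ - max 0 (min (0 + t) (ℓ - ℓ')))
    (by fun_prop)] at r20
  have hb3 : ℓ - max 0 (min (0 + 0) (ℓ - ℓ')) = ℓ := by
    rw [add_zero, min_eq_left (sub_nonneg.2 hℓ), max_self, sub_zero]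
  have hb4 : ℓ - max 0 (min (0 + (ℓ - ℓ')) (ℓ - ℓ')) = ℓ' := by
    rw [zero_add, min_self, max_eq_right (sub_nonneg.2 hℓ), sub_sub_cancel]
  rw [hb3, hb4, c.run_swap f] at r20
  rw [hb1, hb2, r11, r10] at fan₁
  rw [e2, r20] at fan₂
  rw [← c.run_congr hf.arc.continuous hxf hf'.arc.continuous hxf' hℓ0 hff,
    ← c.run_congr hh.arc.continuous hxh hh'.arc.continuous hxh' hn0 hhh,
    ← c.run_mul f 0 ℓ' ℓ, ← c.run_mul h 0 n' n, ← fan₁, ← fan₂,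
    show c.run f 0 ℓ' * c.run f ℓ' ℓ * ((c.run f ℓ' ℓ)⁻¹ * c.run g' 0 m' * c.run h n' n) =
      c.run f 0 ℓ' * c.run g' 0 m' * c.run h n' n by
        rw [mul_assoc, mul_assoc ((c.run f ℓ' ℓ)⁻¹), mul_inv_cancel_left, mul_assoc],
    mul_left_inj]

end Subtriangle

end Cat2Cx
end

open Set Metric Filter
noncomputable section
namespace Cat2Cx

section Assemble

variable {X : Type*} [MetricSpace X]

theorem isCompact_img (γ : SCC X) : IsCompact γ.img :=
  isCompact_Icc.image_of_continuousOn γ.contOn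

theorem geodSeg_subset {Z : Type*} {d : Z → Z → ℝ} {E : Set Z} {x y : Z} :
    geodSeg d E x y ⊆ E := by
  refine iUnion₂_subset fun f hf => ?_
  rintro _ ⟨t, ht, rfl⟩
  exact hf.2.2.2 ht

theorem geodSeg_subset_comm (E : Set X) (x y : X) :
    geodSeg (pathDistIn E) E x y ⊆ geodSeg (pathDistIn E) E y x := by
  refine iUnion₂_subset fun f hf => ?_
  rintro _ ⟨t, ht, rfl⟩
  refine IsGeodesicFromTo.image_subset_geodSeg (IsGeodesicFromTo.rev hf)
    ⟨pathDistIn E x y - t, ?_, by simp⟩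
  rw [pathDistIn_comm E y x]
  exact ⟨sub_nonneg.2 ht.2, sub_le_self _ ht.1⟩

theorem geodSeg_comm (E : Set X) (x y : X) :
    geodSeg (pathDistIn E) E x y = geodSeg (pathDistIn E) E y x :=
  (geodSeg_subset_comm E x y).antisymm (geodSeg_subset_comm E y x)

/-- A subsegment of a geodesic of the path metric, as a pair of nested geodesics of `S`. -/
theorem exists_nested_isGeo {E S : Set X} (hE : RectConnected E) (hS : S ⊆ E)
    (hU : UniqueGeo S) {p q q' : X} (hseg : geodSeg (pathDistIn E) E p q ⊆ S)
    (hseg' : geodSeg (pathDistIn E) E p q' ⊆ S) (hq' : q' ∈ geodSeg (pathDistIn E) E p q) :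
    ∃ (ℓ ℓ' : ℝ) (f f' : ℝ → X), IsGeo S p q ℓ f ∧ IsGeo S p q' ℓ' f' ∧ ℓ' ≤ ℓ ∧
      (∀ t ∈ Icc 0 ℓ', f t = f' t) ∧ geodSeg (pathDistIn E) E p q = range f ∧
      geodSeg (pathDistIn E) E p q' = range f' := by
  obtain ⟨f, hf, s, hs, rfl⟩ := mem_iUnion₂.1 hq'
  replace hf : IsGeodesicFromTo (pathDistIn E) E f p q := hf
  obtain ⟨hd, hf'⟩ := hf.restrict hs
  obtain ⟨h1, h2⟩ := geodSeg_eq_range hE hS hU hseg hf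
  obtain ⟨h3, h4⟩ := geodSeg_eq_range hE hS hU hseg' hf'
  refine ⟨_, _, _, _, h1, h3, hd.trans_le hs.2, fun t ht => ?_, h2, h4⟩
  rw [min_eq_left ht.2, min_eq_left (ht.2.trans (hd.trans_le hs.2))]

/-- The third side of a simple triangle is a geodesic. -/
theorem exists_isGeo_base {E S : Set X} (hE : RectConnected E) (hS : S ⊆ E)
    (hU : UniqueGeo S) {p q r : X} {γ : SCC X} {ℓ n : ℝ} {f h : ℝ → X}
    (hseg : geodSeg (pathDistIn E) E q r ⊆ S) (hf : IsGeo S p q ℓ f) (hh : IsGeo S p r n h)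
    (hγ : γ.img = range f ∪ geodSeg (pathDistIn E) E q r ∪ range h) :
    ∃ (m : ℝ) (g : ℝ → X), IsGeo S q r m g ∧ geodSeg (pathDistIn E) E q r = range g := by
  by_cases hg : ∃ g, IsGeodesicFromTo (pathDistIn E) E g q r
  · obtain ⟨g, hg⟩ := hg
    exact ⟨_, _, geodSeg_eq_range hE hS hU hseg hg⟩
  · refine absurd ?_ (SCC.ne_union_of_two_geo hU γ hf hh)
    have : geodSeg (pathDistIn E) E q r = ∅ :=
      eq_empty_of_forall_notMem fun x hx => by
        obtain ⟨g, h, -⟩ := mem_iUnion₂.1 hx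
        exact hg ⟨g, h⟩
    rw [hγ, this, union_empty]

end Assemble

end Cat2Cx
end

open Cat2Cx in
/-- **Lemma (subtriangle_interiors).**  Let `T` be a simple geodesic triangle in `Y` with
vertices `p, q, r`, and `T̂` a simple geodesic triangle in `Y` with vertices `p, q', r'`
where `q' ∈ [p,q]_Y` and `r' ∈ [p,r]_Y`.  Then for some `ε > 0`,
`Int T ∩ B_X(p,ε) = Int T̂ ∩ B_X(p,ε)`. -/
theorem subtriangle_interiors_agree_near_vertex
    {κ : ℝ} (hκ : κ ≤ 0) {X : Type*} [MetricSpace X]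
    (PC : PolyComplex2 κ X) (hX : IsCATSpace κ X)
    (E : Set X) (hEclosed : IsClosed E) (hErc : RectConnected E) (hH1 : H1Trivial ↥E)
    (γT γT' : SCC X) (p q r q' r' : X)
    (hT : IsYTriangle E γT.img p q r) (hT' : IsYTriangle E γT'.img p q' r')
    (hq' : q' ∈ geodSeg (pathDistIn E) E p q) (hr' : r' ∈ geodSeg (pathDistIn E) E p r) :
    ∃ ε > 0, γT.interiorSet ∩ Metric.ball p ε = γT'.interiorSet ∩ Metric.ball p ε := by
  have hC := hX.cat0 hκ
  let K : Set X := cone p (γT.img ∪ γT'.img)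
  have hK : IsCompact K := hC.isCompact_cone p ((isCompact_img γT).union (isCompact_img γT'))
  let F : Bool → Set X := fun j => if j then E else K
  have hS : (⋂ j, F j) = E ∩ K := by
    ext x
    simp [F, and_comm]
  have hU : UniqueGeo (E ∩ K) := by
    rw [← hS]
    refine fun _ _ _ _ _ hf hg => IsGeo.unique hκ PC hC (E := F) ?_ ?_ hf hg
    · rintro (_ | _)
      · exact hK.isClosed
      · exact hEclosed
    · rintro (_ | _)
      · exact hC.logTrivial_cone p _
      · exact hH1.logTrivial
  have hSE : E ∩ K ⊆ E := Set.inter_subset_left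
  have hKs : ∀ {x y : X}, geodSeg (pathDistIn E) E x y ⊆ γT.img ∪ γT'.img →
      geodSeg (pathDistIn E) E x y ⊆ E ∩ K := fun h =>
    Set.subset_inter geodSeg_subset (h.trans (hC.subset_cone p _))
  obtain ⟨-, -, -, hT⟩ := hT
  obtain ⟨-, -, -, hT'⟩ := hT'
  rw [geodSeg_comm E r p] at hT
  rw [geodSeg_comm E r' p] at hT'
  have hpq := hKs (x := p) (y := q) fun x hx => Or.inl (hT ▸ Or.inl (Or.inl hx))
  have hqr := hKs (x := q) (y := r) fun x hx => Or.inl (hT ▸ Or.inl (Or.inr hx))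
  have hpr := hKs (x := p) (y := r) fun x hx => Or.inl (hT ▸ Or.inr hx)
  have hpq' := hKs (x := p) (y := q') fun x hx => Or.inr (hT' ▸ Or.inl (Or.inl hx))
  have hqr' := hKs (x := q') (y := r') fun x hx => Or.inr (hT' ▸ Or.inl (Or.inr hx))
  have hpr' := hKs (x := p) (y := r') fun x hx => Or.inr (hT' ▸ Or.inr hx)
  obtain ⟨ℓ, ℓ', f, f', hf, hf', hℓ, hff, ef, ef'⟩ :=
    exists_nested_isGeo hErc hSE hU hpq hpq' hq'
  obtain ⟨n, n', h, h', hh, hh', hn, hhh, eh, eh'⟩ :=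
    exists_nested_isGeo hErc hSE hU hpr hpr' hr'
  rw [ef, eh] at hT
  rw [ef', eh'] at hT'
  obtain ⟨m, g, hg, eg⟩ := exists_isGeo_base hErc hSE hU hqr hf hh hT
  obtain ⟨m', g', hg', eg'⟩ := exists_isGeo_base hErc hSE hU hqr' hf' hh' hT'
  rw [eg] at hT
  rw [eg'] at hT'
  exact interiorSet_inter_ball_eq (hK.inter_left hEclosed) hU hf hg hh hf' hg' hh' hℓ hn hff hhh
    hT hT'
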